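/- Nilpotency is undecidable even within the class of uniquely ergodic and asymptotically-nilpotent-in-density cellular automata: there is no total computable function g from codes (n, f) (of radius-1 cellular automata Φ_{n,f}) to Bool such that for every code (n,f) for which Φ_{n,f} is both uniquely ergodic and asymptotically nilpotent in density, g(n,f) = true if and only if Φ_{n,f} is nilpotent. -/

import Mathlib

open MeasureTheory Filter

/-- The radius-1 cellular automaton induced by a local rule `f`. -/
def caOfRule {n : ℕ} (f : Fin (n + 1) × Fin (n + 1) × Fin (n + 1) → Fin (n + 1)) :
    (ℤ → Fin (n + 1)) → (ℤ → Fin (n + 1)) :=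
  fun x i => f (x (i - 1), x i, x (i + 1))

/-- The Besicovitch pseudometric on `α^ℤ`:
`d_B(x,y) = limsup_{m→∞} |{i ∈ [-m,m] : x_i ≠ y_i}| / (2m+1)`. -/
noncomputable def besicovitchDist {α : Type} [DecidableEq α] (x y : ℤ → α) : ℝ :=
  Filter.limsup (fun m : ℕ =>
      (((Finset.Icc (-(m : ℤ)) (m : ℤ)).filter fun i => x i ≠ y i).card : ℝ) /
        (2 * (m : ℝ) + 1))
    Filter.atTop

section
namespace SimCA

inductive Dir | m | z | p
  deriving DecidableEq

instance : Fintype Dir := ⟨{.m, .z, .p}, by intro x; cases x <;> simp⟩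

def Dir.toInt : Dir → ℤ
  | .m => -1
  | .z => 0
  | .p => 1

inductive Op | nop | getO | getP | exS | exN | getX | putX | dl | dlc | run | cur
  deriving DecidableEq

instance : Fintype Op :=
  ⟨{.nop, .getO, .getP, .exS, .exN, .getX, .putX, .dl, .dlc, .run, .cur}, by
    intro x; cases x <;> simp⟩

abbrev Pos := Bool × Fin 27

/-- the letter machine -/
structure Mealy (L : Type) where
  d1 : L → L → L
  d2 : L → L → L
  b0 : L
  u0 : L
  hlt : L → Bool

@[ext] structure V (L : Type) where
  pos : Pos
  op : Op
  dr : Dir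
  f : Bool
  l : L
  deriving DecidableEq

@[ext] structure Wk (L : Type) where
  x : V L
  o : V L
  mO : V L
  mP : V L
  rO : V L
  rP : V L
  qO : V L
  qP : V L
  op : Op
  k : Op
  d : Dir
  deriving DecidableEq

@[ext] structure S (L : Type) where
  pos : Pos
  w : Wk L
  z : L
  deriving DecidableEq

@[ext] structure Q (L Γ : Type) where
  pos : Pos
  w : Wk L
  s : S L
  g : Γ
  deriving DecidableEq

structure Alg (L : Type) where
  Γ : Type
  run : Γ → L → Γ × L
  cur : Γ

def nextP (p : Pos) : Pos := (p.1, p.2 + 1)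
def flipP (p : Pos) : Pos := (!p.1, p.2)

/-- move phases -/
def mvN (n : ℕ) : Bool := n == 4 || n == 13 || (22 ≤ n && n ≤ 25)
/-- exchange phases -/
def exN (n : ℕ) : Bool := 5 ≤ n && n ≤ 12
def mvP (p : Pos) : Bool := mvN p.2.1
def exP (p : Pos) : Bool := exN p.2.1
def ctP (p : Pos) : Bool := !mvP p && !exP p

/-- side of the partner -/
def sd (p : Pos) : ℤ := if xor p.1 (exP p) then -1 else 1

variable {L : Type} (M : Mealy L)

def dflt : V L := ⟨(false, 0), .nop, .z, false, M.b0⟩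

def isG : Op → Bool
  | .run => true
  | .cur => true
  | _ => false

/-- select the message of the neighbour on the relevant side -/
def selO (w : Wk L) : V L := if sd w.x.pos = 1 then w.qO else w.rO
def selP (w : Wk L) : V L := if sd w.x.pos = 1 then w.qP else w.rP
def selV (w : Wk L) : Bool :=
  (selP w).f && decide ((selP w).pos = flipP w.x.pos) && !mvP w.x.pos

def act0 : ℕ → Option (V L) → Wk L → Option (Wk L)
  | 0, _, w => some { w with op := .getO }
  | 1, _, w => some { w with mO := w.x, o := w.x, op := .getP }
  | 2, _, w => some { w with mP := w.x, o := w.x, op := .nop }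
  | 3, _, w => some { w with o := w.mO, d := .m, op := .nop }
  | 5, m, w => some { w with rO := m.getD (dflt M), o := w.mP, op := .nop }
  | 6, m, w => some { w with rP := { m.getD (dflt M) with f := m.isSome }, op := .nop }
  | 12, _, w => some { w with o := w.rO, d := .p, op := .nop }
  | 14, m, w => some { w with qO := m.getD (dflt M), op := .nop }
  | 15, m, w => some { w with qP := m.getD (dflt M), op := .getP }
  | 16, _, w => some { w with x := selO w, op := if selV w then .exS else .exN }
  | 17, _, w => if w.x.f then
      some { w with k := w.x.op, d := w.x.dr, o := w.x, op := .getX } else none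
  | 18, _, w => some { w with o := w.x, op := if isG w.k then w.k else .nop }
  | 19, _, w => some (if w.k = .run then { w with op := .dl } else
      if w.k = .cur then { w with x := { w.x with l := M.u0 }, op := .run } else
        { w with op := .nop })
  | 20, _, w => some { w with op := if w.k = .run then .putX else
      if w.k = .cur then .dlc else .nop }
  | 21, m, w => some (if isG w.k then { w with o := { w.o with dr := w.d }, op := .nop }
      else { w with o := { w.o with dr := w.d }, x := m.getD (dflt M), op := .putX })
  | 26, m, w => if (m.getD (dflt M)).dr = w.d then some { w with op := .nop } else none
  | _, _, w => some { w with op := .nop }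

def act1 : ℕ → Option (V L) → Wk L → Option (Wk L)
  | 0, _, w => some { w with op := .cur }
  | 1, _, w => some { w with x := { w.x with l := M.u0 }, op := .run }
  | 2, m, w => if M.hlt w.x.l then none else some { w with mO := m.getD (dflt M), op := .nop }
  | 3, m, w => some { w with mP := m.getD (dflt M), o := w.mO, d := .p, op := .nop }
  | 5, m, w => some { w with rO := m.getD (dflt M), o := w.mP, op := .nop }
  | 6, m, w => some { w with rP := { m.getD (dflt M) with f := m.isSome }, op := .nop }
  | 12, _, w => some { w with o := w.rO, d := .m, op := .nop }
  | 14, _, w => some { w with o := w.rP, op := .nop }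
  | 18, m, w => some { w with k := (m.getD (dflt M)).op, d := (m.getD (dflt M)).dr, op := .nop }
  | 19, m, w => some { w with x := m.getD (dflt M), op := if isG w.k then .nop else w.k }
  | 20, _, w => some { w with o := w.x, op := .nop }
  | 21, _, w => some { w with o := { w.o with dr := w.d }, op := .nop }
  | 26, m, w => if (m.getD (dflt M)).dr = w.d then some { w with op := .nop } else none
  | _, _, w => some { w with op := .nop }

def act (p : Pos) (m : Option (V L)) (w : Wk L) : Option (Wk L) :=
  if ctP p && m.isNone then none else
    if p.1 then act1 M p.2.1 m w else act0 M p.2.1 m w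

def dirW (p : Pos) (w : Wk L) : Dir := if mvP p then w.d else .z

def ex (m : Option (V L)) (x : V L) (s : S L) : V L × S L :=
  match act M s.pos m s.w with
  | none => ({ x with f := false }, s)
  | some w1 => ({ x with f := true, op := w1.op, dr := dirW s.pos s.w },
      { s with pos := nextP s.pos, w := w1 })

def sto (op : Op) (x : V L) (s : S L) : V L × S L :=
  match op with
  | .getO => (s.w.o, s)
  | .getP => ({ x with pos := s.pos }, s)
  | .exS => ex M (some x) x s
  | .exN => ex M none x s
  | .getX => (s.w.x, s)
  | .putX => (x, { s with w := { s.w with x := x } })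
  | .dl => ({ x with l := M.d2 s.z x.l }, { s with z := M.d1 s.z x.l })
  | .dlc => (x, { s with z := M.d1 M.b0 x.l })
  | _ => (x, s)

def gop (A : Alg L) (op : Op) (x : V L) (g : A.Γ) : V L × A.Γ :=
  match op with
  | .run => ({ x with l := (A.run g x.l).2 }, (A.run g x.l).1)
  | .cur => (x, A.cur)
  | _ => (x, g)

/-- what happens after the action -/
def fin (A : Alg L) (q : Q L A.Γ) (w1 : Wk L) : Q L A.Γ :=
  { pos := nextP q.pos
    w := { w1 with x := (gop A w1.op (sto M w1.op w1.x q.s).1 q.g).1 }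
    s := (sto M w1.op w1.x q.s).2
    g := (gop A w1.op (sto M w1.op w1.x q.s).1 q.g).2 }

def step (A : Alg L) (q : Q L A.Γ) (m : Option (V L)) : Option (Q L A.Γ) :=
  (act M q.pos m q.w).map (fin M A q)

/-- direction in which a particle moves -/
def dirQ {Γ : Type} (q : Q L Γ) : Dir := dirW q.pos q.w

def up (A : Alg L) : Alg L where
  Γ := A.Γ × L
  run := fun g l => (((A.run g.1 l).1, M.d1 g.2 (A.run g.1 l).2), M.d2 g.2 (A.run g.1 l).2)
  cur := ((A.run A.cur M.u0).1, M.d1 M.b0 (A.run A.cur M.u0).2)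

/-- the composite particle represented by a pair -/
def mac (A : Alg L) (x0 x1 : Q L A.Γ) : Q L (up M A).Γ :=
  { pos := x0.s.pos, w := x0.s.w, s := x1.s, g := (x0.g, x0.s.z) }

variable {M}

end SimCA
end

section
namespace SimCA

variable {L : Type} {M : Mealy L} {A : Alg L}

theorem nextP_inj {p q : Pos} (h : nextP p = nextP q) : p = q := by
  have h1 := congrArg Prod.fst h
  have h2 := congrArg Prod.snd h
  exact Prod.ext h1 (add_right_cancel h2)

theorem flipP_flipP (p : Pos) : flipP (flipP p) = p := by simp [flipP]

theorem step_pos {q q' : Q L A.Γ} {m} (h : step M A q m = some q') : q'.pos = nextP q.pos := by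
  unfold step at h
  rw [Option.map_eq_some_iff] at h
  obtain ⟨w, _, rfl⟩ := h
  rfl

/-- the phase with a given number -/
def ph (n : ℕ) : Fin 27 := ⟨n % 27, Nat.mod_lt _ (by norm_num)⟩

theorem ph_succ (n : ℕ) : ph n + 1 = ph (n + 1) := by
  apply Fin.ext
  simp [ph, Fin.val_add]

theorem ph_val {n : ℕ} (h : n < 27) : (ph n).1 = n := Nat.mod_eq_of_lt h

def ctN (n : ℕ) : Bool := !mvN n && !exN n

/-- two particles following the program for n phases, seeing each other in contact phases -/
structure Chain (M : Mealy L) (A : Alg L) (n : ℕ) (X0 X1 : ℕ → Q L A.Γ)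
    (m0 m1 : ℕ → Option (V L)) : Prop where
  h0 : ∀ φ < n, step M A (X0 φ) (m0 φ) = some (X0 (φ + 1))
  h1 : ∀ φ < n, step M A (X1 φ) (m1 φ) = some (X1 (φ + 1))
  p0 : (X0 0).pos = (false, 0)
  p1 : (X1 0).pos = (true, 0)
  c0 : ∀ φ < n, ctN φ = true → m0 φ = some (X1 φ).w.o
  c1 : ∀ φ < n, ctN φ = true → m1 φ = some (X0 φ).w.o

namespace Chain
variable {n : ℕ} {X0 X1 : ℕ → Q L A.Γ} {m0 m1 : ℕ → Option (V L)}

theorem mono (h : Chain M A n X0 X1 m0 m1) {k : ℕ} (hk : k ≤ n) : Chain M A k X0 X1 m0 m1 :=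
  ⟨fun φ hφ => h.h0 φ (by omega), fun φ hφ => h.h1 φ (by omega), h.p0, h.p1,
   fun φ hφ => h.c0 φ (by omega), fun φ hφ => h.c1 φ (by omega)⟩

theorem pos0 (h : Chain M A n X0 X1 m0 m1) : ∀ φ ≤ n, (X0 φ).pos = (false, ph φ) := by
  intro φ
  induction φ with
  | zero => intro _; exact h.p0
  | succ k ih =>
    intro hk
    rw [step_pos (h.h0 k (by omega)), ih (by omega)]
    simp [nextP, ph_succ]

theorem pos1 (h : Chain M A n X0 X1 m0 m1) : ∀ φ ≤ n, (X1 φ).pos = (true, ph φ) := by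
  intro φ
  induction φ with
  | zero => intro _; exact h.p1
  | succ k ih =>
    intro hk
    rw [step_pos (h.h1 k (by omega)), ih (by omega)]
    simp [nextP, ph_succ]

theorem act0_eq (h : Chain M A n X0 X1 m0 m1) {φ : ℕ} (hφ : φ < n) (hn : φ < 27) :
    ∃ w1, act0 M φ (m0 φ) (X0 φ).w = some w1 ∧ X0 (φ + 1) = fin M A (X0 φ) w1 := by
  have h1 := h.h0 φ hφ
  unfold step at h1
  rw [Option.map_eq_some_iff] at h1
  obtain ⟨w, hw, hw2⟩ := h1
  refine ⟨w, ?_, hw2.symm⟩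
  unfold act at hw
  rw [h.pos0 φ hφ.le] at hw
  split_ifs at hw with h2 h3
  · simp at h3
  · simpa [ph_val hn] using hw

theorem act1_eq (h : Chain M A n X0 X1 m0 m1) {φ : ℕ} (hφ : φ < n) (hn : φ < 27) :
    ∃ w1, act1 M φ (m1 φ) (X1 φ).w = some w1 ∧ X1 (φ + 1) = fin M A (X1 φ) w1 := by
  have h1 := h.h1 φ hφ
  unfold step at h1
  rw [Option.map_eq_some_iff] at h1
  obtain ⟨w, hw, hw2⟩ := h1
  refine ⟨w, ?_, hw2.symm⟩
  unfold act at hw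
  rw [h.pos1 φ hφ.le] at hw
  split_ifs at hw with h2 h3
  · simpa [ph_val hn] using hw
  · simp at h3

theorem segA0 (h : Chain M A n X0 X1 m0 m1) (hn : 4 ≤ n) :
    (X0 4).s = (X0 0).s ∧ (X0 4).g = (X0 0).g ∧ (X0 4).w.o = (X0 0).s.w.o ∧
    (X0 4).w.mP.pos = (X0 0).s.pos ∧ (X0 4).w.d = .m ∧ (X0 2).w.o = (X0 0).s.w.o ∧
    (X0 3).w.o.pos = (X0 0).s.pos ∧ (X0 4).w.op = .nop := by
  obtain ⟨_, a0, e0⟩ := h.act0_eq (φ := 0) (by omega) (by omega)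
  obtain ⟨_, a1, e1⟩ := h.act0_eq (φ := 1) (by omega) (by omega)
  obtain ⟨_, a2, e2⟩ := h.act0_eq (φ := 2) (by omega) (by omega)
  obtain ⟨_, a3, e3⟩ := h.act0_eq (φ := 3) (by omega) (by omega)
  simp only [act0, Option.some.injEq, zero_add] at a0 a1 a2 a3 e0 e1 e2 e3
  subst a0 a1 a2 a3
  norm_num at e1 e2 e3
  simp [e3, e2, e1, e0, fin, sto, gop]

theorem segA1 (h : Chain M A n X0 X1 m0 m1) (hn : 4 ≤ n) :
    (X1 4).s = (X1 0).s ∧ (X1 4).w.o = (X0 0).s.w.o ∧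
    (X1 4).w.mP.pos = (X0 0).s.pos ∧ (X1 4).w.d = .p ∧ (X1 4).w.op = .nop := by
  obtain ⟨-, -, -, -, -, f2, f3, -⟩ := h.segA0 hn
  obtain ⟨_, a0, e0⟩ := h.act1_eq (φ := 0) (by omega) (by omega)
  obtain ⟨_, a1, e1⟩ := h.act1_eq (φ := 1) (by omega) (by omega)
  obtain ⟨_, a2, e2⟩ := h.act1_eq (φ := 2) (by omega) (by omega)
  obtain ⟨_, a3, e3⟩ := h.act1_eq (φ := 3) (by omega) (by omega)
  rw [h.c1 2 (by omega) rfl] at a2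
  rw [h.c1 3 (by omega) rfl] at a3
  simp only [act1, Option.some.injEq, zero_add] at a0 a1 a2 a3 e0 e1 e2 e3
  split_ifs at a2
  simp only [Option.some.injEq] at a2
  subst a0 a1 a2 a3
  norm_num at e1 e2 e3
  simp [e3, e2, e1, e0, fin, sto, gop, f2, f3]

/-- the quantity tested for halting -/
theorem hltVal (h : Chain M A n X0 X1 m0 m1) (hn : 2 ≤ n) :
    (X1 2).w.x.l = (A.run A.cur M.u0).2 := by
  obtain ⟨_, a0, e0⟩ := h.act1_eq (φ := 0) (by omega) (by omega)
  obtain ⟨_, a1, e1⟩ := h.act1_eq (φ := 1) (by omega) (by omega)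
  simp only [act1, Option.some.injEq, zero_add] at a0 a1 e0 e1
  subst a0 a1
  norm_num at e1
  simp [e1, e0, fin, sto, gop]

theorem segC0 (h : Chain M A n X0 X1 m0 m1) (hn : 14 ≤ n) :
    (X0 14).s = (X0 0).s ∧ (X0 14).g = (X0 0).g ∧ (X0 5).w.o = (X0 0).s.w.o ∧
    (X0 6).w.o.pos = (X0 0).s.pos ∧ (X0 13).w.d = .p ∧
    (X0 14).w.rO = (m0 5).getD (dflt M) ∧
    (X0 14).w.rP = { (m0 6).getD (dflt M) with f := (m0 6).isSome } := by
  obtain ⟨b1, b2, b3, b4, -, -, -, -⟩ := h.segA0 (by omega)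
  obtain ⟨_, a4, e4⟩ := h.act0_eq (φ := 4) (by omega) (by omega)
  obtain ⟨_, a5, e5⟩ := h.act0_eq (φ := 5) (by omega) (by omega)
  obtain ⟨_, a6, e6⟩ := h.act0_eq (φ := 6) (by omega) (by omega)
  obtain ⟨_, a7, e7⟩ := h.act0_eq (φ := 7) (by omega) (by omega)
  obtain ⟨_, a8, e8⟩ := h.act0_eq (φ := 8) (by omega) (by omega)
  obtain ⟨_, a9, e9⟩ := h.act0_eq (φ := 9) (by omega) (by omega)
  obtain ⟨_, a10, e10⟩ := h.act0_eq (φ := 10) (by omega) (by omega)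
  obtain ⟨_, a11, e11⟩ := h.act0_eq (φ := 11) (by omega) (by omega)
  obtain ⟨_, a12, e12⟩ := h.act0_eq (φ := 12) (by omega) (by omega)
  obtain ⟨_, a13, e13⟩ := h.act0_eq (φ := 13) (by omega) (by omega)
  simp only [act0, Option.some.injEq] at a4 a5 a6 a7 a8 a9 a10 a11 a12 a13
  subst a4 a5 a6 a7 a8 a9 a10 a11 a12 a13
  norm_num at e4 e5 e6 e7 e8 e9 e10 e11 e12 e13
  simp [e4, e5, e6, e7, e8, e9, e10, e11, e12, e13, fin, sto, gop, b1, b2, b3, b4]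

theorem segC1 (h : Chain M A n X0 X1 m0 m1) (hn : 14 ≤ n) :
    (X1 14).s = (X1 0).s ∧ (X1 5).w.o = (X0 0).s.w.o ∧
    (X1 6).w.o.pos = (X0 0).s.pos ∧ (X1 13).w.d = .m ∧
    (X1 14).w.o = (m1 5).getD (dflt M) ∧
    (X1 14).w.rP = { (m1 6).getD (dflt M) with f := (m1 6).isSome } := by
  obtain ⟨b1, b2, b3, b4, -⟩ := h.segA1 (by omega)
  obtain ⟨_, a4, e4⟩ := h.act1_eq (φ := 4) (by omega) (by omega)
  obtain ⟨_, a5, e5⟩ := h.act1_eq (φ := 5) (by omega) (by omega)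
  obtain ⟨_, a6, e6⟩ := h.act1_eq (φ := 6) (by omega) (by omega)
  obtain ⟨_, a7, e7⟩ := h.act1_eq (φ := 7) (by omega) (by omega)
  obtain ⟨_, a8, e8⟩ := h.act1_eq (φ := 8) (by omega) (by omega)
  obtain ⟨_, a9, e9⟩ := h.act1_eq (φ := 9) (by omega) (by omega)
  obtain ⟨_, a10, e10⟩ := h.act1_eq (φ := 10) (by omega) (by omega)
  obtain ⟨_, a11, e11⟩ := h.act1_eq (φ := 11) (by omega) (by omega)
  obtain ⟨_, a12, e12⟩ := h.act1_eq (φ := 12) (by omega) (by omega)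
  obtain ⟨_, a13, e13⟩ := h.act1_eq (φ := 13) (by omega) (by omega)
  simp only [act1, Option.some.injEq] at a4 a5 a6 a7 a8 a9 a10 a11 a12 a13
  subst a4 a5 a6 a7 a8 a9 a10 a11 a12 a13
  norm_num at e4 e5 e6 e7 e8 e9 e10 e11 e12 e13
  simp [e4, e5, e6, e7, e8, e9, e10, e11, e12, e13, fin, sto, gop, b1, b2, b3, b4]

end Chain
end SimCA
end

section
namespace SimCA

variable {L : Type} {M : Mealy L} {A : Alg L}

/-- the message the composite particle receives -/
def msgM (M : Mealy L) (p : Pos) (a5 a6 b5 b6 : Option (V L)) : Option (V L) :=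
  if (if sd p = 1 then b6 else a6).isSome ∧
      ((if sd p = 1 then b6 else a6).getD (dflt M)).pos = flipP p ∧ mvP p = false then
    some ((if sd p = 1 then b5 else a5).getD (dflt M)) else none

namespace Chain
variable {n : ℕ} {X0 X1 : ℕ → Q L A.Γ} {m0 m1 : ℕ → Option (V L)}

theorem seg16 (h : Chain M A n X0 X1 m0 m1) (hn : 16 ≤ n) :
    (X0 16).s = (X0 0).s ∧ (X0 16).g = (X0 0).g ∧ (X1 16).s = (X1 0).s ∧
    selO (X0 16).w = (if sd (X0 0).s.pos = 1 then m1 5 else m0 5).getD (dflt M) ∧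
    (selV (X0 16).w = true ↔ (if sd (X0 0).s.pos = 1 then m1 6 else m0 6).isSome ∧
      ((if sd (X0 0).s.pos = 1 then m1 6 else m0 6).getD (dflt M)).pos = flipP (X0 0).s.pos ∧
      mvP (X0 0).s.pos = false) := by
  obtain ⟨b1, b2, -, -, -, b3, b4⟩ := h.segC0 (by omega)
  obtain ⟨b5, -, -, -, b6, b7⟩ := h.segC1 (by omega)
  obtain ⟨_, a14, e14⟩ := h.act0_eq (φ := 14) (by omega) (by omega)
  obtain ⟨_, a15, e15⟩ := h.act0_eq (φ := 15) (by omega) (by omega)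
  obtain ⟨_, c14, f14⟩ := h.act1_eq (φ := 14) (by omega) (by omega)
  obtain ⟨_, c15, f15⟩ := h.act1_eq (φ := 15) (by omega) (by omega)
  rw [h.c0 14 (by omega) rfl] at a14
  rw [h.c0 15 (by omega) rfl] at a15
  simp only [act0, act1, Option.some.injEq] at a14 a15 c14 c15
  subst a14 a15 c14 c15
  norm_num at e14 e15 f14 f15
  have hp : (X0 16).w.x.pos = (X0 0).s.pos := by simp [e14, e15, fin, sto, gop, b1]
  refine ⟨by simp [e14, e15, fin, sto, gop, b1], by simp [e14, e15, fin, sto, gop, b2],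
    by simp [f14, f15, fin, sto, gop, b5], ?_, ?_⟩
  · unfold selO
    rw [hp]
    have h1 : (X0 16).w.qO = (m1 5).getD (dflt M) := by simp [e14, e15, fin, sto, gop, b6]
    have h2 : (X0 16).w.rO = (m0 5).getD (dflt M) := by simp [e14, e15, fin, sto, gop, b3]
    rw [h1, h2]
    split_ifs <;> rfl
  · have h1 : (X0 16).w.qP = { (m1 6).getD (dflt M) with f := (m1 6).isSome } := by
      simp [e14, e15, f14, fin, sto, gop, b7]
    have h2 : (X0 16).w.rP = { (m0 6).getD (dflt M) with f := (m0 6).isSome } := by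
      simp [e14, e15, fin, sto, gop, b4]
    unfold selV selP
    rw [hp, h1, h2]
    split_ifs <;> simp [and_assoc]

theorem seg17 (h : Chain M A n X0 X1 m0 m1) (hn : 17 ≤ n) :
    (X0 17).g = (X0 0).g ∧ (X1 17).s = (X1 0).s ∧ ∃ x,
    ((X0 17).w.x, (X0 17).s) =
      ex M (msgM M (X0 0).s.pos (m0 5) (m0 6) (m1 5) (m1 6)) x (X0 0).s := by
  obtain ⟨b1, b2, b3, b4, b5⟩ := h.seg16 (by omega)
  obtain ⟨_, a16, e16⟩ := h.act0_eq (φ := 16) (by omega) (by omega)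
  obtain ⟨_, c16, f16⟩ := h.act1_eq (φ := 16) (by omega) (by omega)
  simp only [act0, act1, Option.some.injEq] at a16 c16
  subst a16 c16
  norm_num at e16 f16
  unfold msgM
  by_cases hv : selV (X0 16).w = true
  · rw [if_pos (b5.1 hv), ← b4]
    refine ⟨by simp [e16, fin, sto, gop, b2, hv], by simp [f16, fin, sto, gop, b3],
      selO (X0 16).w, ?_⟩
    simp [e16, fin, sto, gop, b1, hv]
  · rw [if_neg (fun h' => hv (b5.2 h'))]
    refine ⟨by simp [e16, fin, sto, gop, b2, hv], by simp [f16, fin, sto, gop, b3],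
      selO (X0 16).w, ?_⟩
    simp [e16, fin, sto, gop, b1, hv]

theorem alive17 (h : Chain M A n X0 X1 m0 m1) (hn : 17 ≤ n) :
    (X0 17).w.x.f = (act M (X0 0).s.pos (msgM M (X0 0).s.pos (m0 5) (m0 6) (m1 5) (m1 6))
      (X0 0).s.w).isSome := by
  obtain ⟨-, -, x, hx⟩ := h.seg17 hn
  unfold ex at hx
  split at hx <;> rename_i h1 <;> rw [h1] <;> have := congrArg (fun y => y.1.f) hx <;> simpa using this

theorem act_dead17 (h : Chain M A n X0 X1 m0 m1) (hn : 18 ≤ n) : (X0 17).w.x.f = true := by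
  obtain ⟨_, a17, e17⟩ := h.act0_eq (φ := 17) (by omega) (by omega)
  simp only [act0] at a17
  split_ifs at a17 with h1
  exact h1

theorem seg22 (h : Chain M A n X0 X1 m0 m1) (hn : 22 ≤ n) : ∃ w1,
    act M (X0 0).s.pos (msgM M (X0 0).s.pos (m0 5) (m0 6) (m1 5) (m1 6)) (X0 0).s.w = some w1 ∧
    mac M A (X0 22) (X1 22) = fin M (up M A) (mac M A (X0 0) (X1 0)) w1 ∧
    (X0 22).w.d = dirW (X0 0).s.pos (X0 0).s.w ∧ (X1 22).w.d = dirW (X0 0).s.pos (X0 0).s.w ∧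
    (X0 22).w.o.dr = dirW (X0 0).s.pos (X0 0).s.w ∧
    (X1 22).w.o.dr = dirW (X0 0).s.pos (X0 0).s.w := by
  have hal := h.alive17 (by omega)
  rw [h.act_dead17 (by omega), eq_comm, Option.isSome_iff_exists] at hal
  obtain ⟨w1, hw1⟩ := hal
  refine ⟨w1, hw1, ?_⟩
  obtain ⟨b1, b2, x, b3⟩ := h.seg17 (by omega)
  have hf := h.act_dead17 (by omega)
  unfold ex at b3
  rw [hw1] at b3
  simp only [Prod.mk.injEq] at b3
  obtain ⟨b3, b4⟩ := b3
  obtain ⟨_, a17, e17⟩ := h.act0_eq (φ := 17) (by omega) (by omega)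
  obtain ⟨_, a18, e18⟩ := h.act0_eq (φ := 18) (by omega) (by omega)
  obtain ⟨_, a19, e19⟩ := h.act0_eq (φ := 19) (by omega) (by omega)
  obtain ⟨_, a20, e20⟩ := h.act0_eq (φ := 20) (by omega) (by omega)
  obtain ⟨_, a21, e21⟩ := h.act0_eq (φ := 21) (by omega) (by omega)
  obtain ⟨_, c17, f17⟩ := h.act1_eq (φ := 17) (by omega) (by omega)
  obtain ⟨_, c18, f18⟩ := h.act1_eq (φ := 18) (by omega) (by omega)
  obtain ⟨_, c19, f19⟩ := h.act1_eq (φ := 19) (by omega) (by omega)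
  obtain ⟨_, c20, f20⟩ := h.act1_eq (φ := 20) (by omega) (by omega)
  obtain ⟨_, c21, f21⟩ := h.act1_eq (φ := 21) (by omega) (by omega)
  rw [h.c1 18 (by omega) rfl] at c18
  rw [h.c1 19 (by omega) rfl] at c19
  rw [h.c0 21 (by omega) rfl] at a21
  simp only [act0, act1, Option.some.injEq, hf, if_true, Option.getD_some]
    at a17 a18 a19 a20 a21 c17 c18 c19 c20 c21
  subst a17 a18 a19 a20 a21 c17 c18 c19 c20 c21
  norm_num at e17 e18 e19 e20 e21 f17 f18 f19 f20 f21
  -- after phase 17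
  have k18 : (X0 18).w.k = w1.op := by simp [e17, fin, b3]
  have x18 : (X0 18).w.x = w1.x := by simp [e17, fin, sto, gop, b4]
  have d18 : (X0 18).w.d = dirW (X0 0).s.pos (X0 0).s.w := by simp [e17, fin, b3]
  have o18 : (X0 18).w.o.op = w1.op := by simp [e17, fin, b3]
  have od18 : (X0 18).w.o.dr = dirW (X0 0).s.pos (X0 0).s.w := by simp [e17, fin, b3]
  have s18 : (X0 18).s = { (X0 0).s with pos := nextP (X0 0).s.pos, w := w1 } := by
    simp [e17, fin, sto, b4]
  have g18 : (X0 18).g = (X0 0).g := by simp [e17, fin, sto, gop, b1]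
  have t18 : (X1 18).s = (X1 0).s := by simp [f17, fin, sto, b2]
  clear e17 f17 b3 b4 b1 b2 hf
  have k19 : (X0 19).w.k = w1.op := by simp [e18, fin, k18]
  have d19 : (X0 19).w.d = dirW (X0 0).s.pos (X0 0).s.w := by simp [e18, fin, d18]
  have o19 : (X0 19).w.o = w1.x := by simp [e18, fin, x18]
  have t19 : (X1 19).s = (X1 0).s := by simp [f18, fin, sto, t18]
  have l19 : (X1 19).w.k = w1.op := by simp [f18, fin, o18]
  have m19 : (X1 19).w.d = dirW (X0 0).s.pos (X0 0).s.w := by simp [f18, fin, od18]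
  have D0 : (X0 22).w.d = dirW (X0 0).s.pos (X0 0).s.w := by
    simp only [e21, e20, e19, fin]
    split_ifs <;> simp [d19]
  have D1 : (X1 22).w.d = dirW (X0 0).s.pos (X0 0).s.w := by
    simp only [f21, f20, f19, fin]
    simp [m19]
  have E0 : (X0 22).w.o.dr = dirW (X0 0).s.pos (X0 0).s.w := by
    rw [← D0]
    simp only [e21, fin]
    split_ifs <;> rfl
  have E1 : (X1 22).w.o.dr = dirW (X0 0).s.pos (X0 0).s.w := by
    rw [← D1]
    simp only [f21, fin]
  refine ⟨?_, D0, D1, E0, E1⟩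
  by_cases hr : w1.op = .run
  · have x19 : (X0 19).w.x = { w1.x with l := (A.run (X0 0).g w1.x.l).2 } ∧
        (X0 19).g = (A.run (X0 0).g w1.x.l).1 ∧ (X0 19).s = (X0 18).s := by
      simp [e18, fin, k18, hr, isG, sto, gop, x18, g18]
    obtain ⟨x19, g19, s19⟩ := x19
    have z20 : (X0 20).w.x = ((gop (up M A) .run w1.x ((X0 0).g, (X0 0).s.z)).1) ∧
        (X0 20).g = (A.run (X0 0).g w1.x.l).1 ∧ (X0 20).s = { (X0 18).s with
          z := M.d1 (X0 0).s.z (A.run (X0 0).g w1.x.l).2 } ∧ (X0 20).w.k = .run := by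
      simp [e19, fin, k19, hr, isG, sto, gop, x19, g19, s19, s18, up]
    obtain ⟨x20, g20, s20, k20⟩ := z20
    have t22 : (X1 22).s = (X1 0).s := by
      simp [f21, f20, f19, fin, sto, l19, hr, isG, t19]
    have s22 : (X0 22).s = { (X0 20).s with w := { (X0 20).s.w with x := (X0 20).w.x } } ∧
        (X0 22).g = (X0 20).g := by
      simp [e21, e20, fin, k20, sto, gop, isG]
    obtain ⟨s22, g22⟩ := s22
    ext1
    · simp [mac, fin, s22, s20, s18]
    · simp [mac, fin, s22, s20, s18, x20, hr, sto]
    · simp [mac, fin, t22, hr, sto]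
    · simp [mac, fin, g22, g20, s22, s20, hr, sto, gop, up]
  by_cases hc : w1.op = .cur
  · have x19 : (X0 19).g = A.cur ∧ (X0 19).s = (X0 18).s := by
      simp [e18, fin, k18, hc, isG, sto, gop]
    obtain ⟨g19, s19⟩ := x19
    have z20 : (X0 20).w.x.l = (A.run A.cur M.u0).2 ∧
        (X0 20).g = (A.run A.cur M.u0).1 ∧ (X0 20).s = (X0 18).s ∧ (X0 20).w.k = .cur := by
      simp [e19, fin, k19, hc, sto, gop, g19, s19]
    obtain ⟨x20, g20, s20, k20⟩ := z20
    have t22 : (X1 22).s = (X1 0).s := by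
      simp [f21, f20, f19, fin, sto, l19, hc, isG, t19]
    have s22 : (X0 22).s = { (X0 20).s with z := M.d1 M.b0 (X0 20).w.x.l } ∧
        (X0 22).g = (X0 20).g := by
      simp [e21, e20, fin, k20, sto, gop, isG]
    obtain ⟨s22, g22⟩ := s22
    ext1
    · simp [mac, fin, s22, s20, s18]
    · have hst : ∀ y, sto M w1.op w1.x y = (w1.x, y) := by intro y; rw [hc]; rfl
      have hgo : ∀ y (g : A.Γ) (z : L), (gop (up M A) w1.op y ((g, z) : A.Γ × L)).1 = y := by
        intro y g z; rw [hc]; rfl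
      simp only [mac, fin, s22, s20, s18, hst, hgo]
    · simp [mac, fin, t22, hc, sto]
    · simp [mac, fin, g22, g20, s22, s20, hc, gop, up, x20]
  · have hG : isG w1.op = false := by
      revert hr hc; cases w1.op <;> simp [isG]
    have x19 : (X0 19).g = (X0 0).g ∧ (X0 19).s = (X0 18).s := by
      simp [e18, fin, k18, hG, sto, gop, g18]
    obtain ⟨g19, s19⟩ := x19
    have z21 : (X0 21).g = (X0 0).g ∧ (X0 21).s = (X0 18).s ∧ (X0 21).w.k = w1.op := by
      simp [e20, e19, fin, k19, hr, hc, sto, gop, g19, s19]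
    obtain ⟨g21, s21, k21⟩ := z21
    have y20 : (X1 20).w.x = (sto M w1.op w1.x (X1 0).s).1 ∧
        (X1 20).s = (sto M w1.op w1.x (X1 0).s).2 := by
      have : ∀ y g, (gop A w1.op y g).1 = y := by
        intro y g; revert hr hc; cases w1.op <;> simp [gop]
      simp [f19, fin, l19, hG, o19, t19, this]
    obtain ⟨y20, t20⟩ := y20
    have y21 : (X1 21).w.o = (X1 20).w.x ∧ (X1 22).s = (X1 20).s := by
      simp [f21, f20, fin, sto]
    obtain ⟨y21, t22⟩ := y21
    have s22 : (X0 22).s = { (X0 21).s with w := { (X0 21).s.w with x := (X1 21).w.o } } ∧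
        (X0 22).g = (X0 21).g := by
      simp [e21, fin, k21, hG, sto, gop]
    obtain ⟨s22, g22⟩ := s22
    have hgo : ∀ y (g : A.Γ) (z : L),
        gop (up M A) w1.op y ((g, z) : A.Γ × L) = (y, ((g, z) : A.Γ × L)) := by
      intro y g z; revert hr hc; cases w1.op <;> simp [gop] <;> rfl
    ext1
    · simp [mac, fin, s22, s21, s18]
    · simp only [mac, fin, s22, s21, s18, y21, y20, hgo]
    · simp [mac, fin, t22, t20]
    · simp [mac, fin, g22, g21, s22, s21, s18, hgo]
      rfl

theorem seg26 (h : Chain M A n X0 X1 m0 m1) (hn : 26 ≤ n) :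
    (∀ φ, 22 ≤ φ → φ ≤ 26 → (X0 φ).w.d = (X0 22).w.d ∧ (X1 φ).w.d = (X1 22).w.d) ∧
    (X0 26).s = (X0 22).s ∧ (X0 26).g = (X0 22).g ∧ (X1 26).s = (X1 22).s ∧
    (X0 26).w.o = (X0 22).w.o ∧ (X1 26).w.o = (X1 22).w.o := by
  obtain ⟨_, a22, e22⟩ := h.act0_eq (φ := 22) (by omega) (by omega)
  obtain ⟨_, a23, e23⟩ := h.act0_eq (φ := 23) (by omega) (by omega)
  obtain ⟨_, a24, e24⟩ := h.act0_eq (φ := 24) (by omega) (by omega)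
  obtain ⟨_, a25, e25⟩ := h.act0_eq (φ := 25) (by omega) (by omega)
  obtain ⟨_, c22, f22⟩ := h.act1_eq (φ := 22) (by omega) (by omega)
  obtain ⟨_, c23, f23⟩ := h.act1_eq (φ := 23) (by omega) (by omega)
  obtain ⟨_, c24, f24⟩ := h.act1_eq (φ := 24) (by omega) (by omega)
  obtain ⟨_, c25, f25⟩ := h.act1_eq (φ := 25) (by omega) (by omega)
  simp only [act0, act1, Option.some.injEq] at a22 a23 a24 a25 c22 c23 c24 c25
  subst a22 a23 a24 a25 c22 c23 c24 c25
  norm_num at e22 e23 e24 e25 f22 f23 f24 f25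
  refine ⟨?_, ?_⟩
  · intro φ h1 h2
    interval_cases φ <;> simp [e22, e23, e24, e25, f22, f23, f24, f25, fin]
  · simp [e22, e23, e24, e25, f22, f23, f24, f25, fin, sto, gop]

theorem macStep (h : Chain M A 27 X0 X1 m0 m1) :
    step M (up M A) (mac M A (X0 0) (X1 0))
      (msgM M (X0 0).s.pos (m0 5) (m0 6) (m1 5) (m1 6)) = some (mac M A (X0 27) (X1 27)) := by
  obtain ⟨w1, h1, h2, -⟩ := h.seg22 (by omega)
  obtain ⟨-, b1, b2, b3, -⟩ := h.seg26 (by omega)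
  obtain ⟨_, a26, e26⟩ := h.act0_eq (φ := 26) (by omega) (by omega)
  obtain ⟨_, c26, f26⟩ := h.act1_eq (φ := 26) (by omega) (by omega)
  simp only [act0, act1] at a26 c26
  split_ifs at a26 c26
  simp only [Option.some.injEq] at a26 c26
  subst a26 c26
  norm_num at e26 f26
  have : mac M A (X0 27) (X1 27) = mac M A (X0 22) (X1 22) := by
    simp [mac, e26, f26, fin, sto, gop, b1, b2, b3]
  rw [this, h2]
  unfold step
  have hx : act M (mac M A (X0 0) (X1 0)).pos
    (msgM M (X0 0).s.pos (m0 5) (m0 6) (m1 5) (m1 6)) (mac M A (X0 0) (X1 0)).w = some w1 := h1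
  rw [hx]; rfl

/-- directions of the two particles -/
theorem dirs (h : Chain M A n X0 X1 m0 m1) :
    (5 ≤ n → dirQ (X0 4) = .m ∧ dirQ (X1 4) = .p) ∧
    (14 ≤ n → dirQ (X0 13) = .p ∧ dirQ (X1 13) = .m) ∧
    (26 ≤ n → ∀ φ, 22 ≤ φ → φ < 26 → dirQ (X0 φ) = dirW (X0 0).s.pos (X0 0).s.w ∧
      dirQ (X1 φ) = dirW (X0 0).s.pos (X0 0).s.w) ∧
    (∀ φ ≤ n, φ < 27 → mvN φ = false → dirQ (X0 φ) = .z ∧ dirQ (X1 φ) = .z) := by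
  have mv : ∀ φ a, φ < 27 → mvP (a, ph φ) = mvN φ := by
    intro φ a h1; simp [mvP, ph_val h1]
  refine ⟨fun hn => ?_, fun hn => ?_, fun hn φ h1 h2 => ?_, fun φ h1 h2 h3 => ?_⟩
  · unfold dirQ dirW
    rw [h.pos0 4 (by omega), h.pos1 4 (by omega), mv _ _ (by omega), mv _ _ (by omega)]
    exact ⟨(h.segA0 (by omega)).2.2.2.2.1, (h.segA1 (by omega)).2.2.2.1⟩
  · unfold dirQ dirW
    rw [h.pos0 13 (by omega), h.pos1 13 (by omega), mv _ _ (by omega), mv _ _ (by omega)]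
    exact ⟨(h.segC0 (by omega)).2.2.2.2.1, (h.segC1 (by omega)).2.2.2.1⟩
  · have hm : mvN φ = true := by interval_cases φ <;> rfl
    have e0 : dirQ (X0 φ) = (X0 φ).w.d := by
      unfold dirQ dirW
      rw [h.pos0 φ (by omega), mv _ _ (by omega), hm, if_pos rfl]
    have e1 : dirQ (X1 φ) = (X1 φ).w.d := by
      unfold dirQ dirW
      rw [h.pos1 φ (by omega), mv _ _ (by omega), hm, if_pos rfl]
    obtain ⟨w1, -, -, h5, h6, -⟩ := h.seg22 (by omega)
    obtain ⟨h7, -⟩ := h.seg26 (by omega)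
    rw [e0, e1, (h7 φ h1 (by omega)).1, (h7 φ h1 (by omega)).2, h5, h6]
    exact ⟨rfl, rfl⟩
  · unfold dirQ dirW
    rw [h.pos0 φ (by omega), h.pos1 φ (by omega), mv _ _ (by omega), mv _ _ (by omega), h3]
    simp

end Chain
end SimCA
end

section
namespace SimCA

variable {L : Type} {M : Mealy L} {A : Alg L}

/-- one particle following the program for n phases -/
structure Sng (M : Mealy L) (A : Alg L) (b : Bool) (n : ℕ) (X : ℕ → Q L A.Γ)
    (m : ℕ → Option (V L)) : Prop where
  h : ∀ φ < n, step M A (X φ) (m φ) = some (X (φ + 1))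
  p : (X 0).pos = (b, 0)

/-- offset of a particle in units of the spacing -/
def off (b : Bool) (D : ℤ) (φ : ℕ) : ℤ :=
  if φ ≤ 4 then 0 else if φ ≤ 13 then (if b then 1 else -1) else
    if φ ≤ 22 then 0 else if φ ≤ 26 then D * ((φ : ℤ) - 22) else 4 * D

theorem mvP_ph {φ : ℕ} (b : Bool) (h : φ < 27) : mvP (b, ph φ) = mvN φ := by
  simp [mvP, ph_val h]
theorem exP_ph {φ : ℕ} (b : Bool) (h : φ < 27) : exP (b, ph φ) = exN φ := by
  simp [exP, ph_val h]

namespace Sng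
variable {n : ℕ} {b : Bool} {X : ℕ → Q L A.Γ} {m : ℕ → Option (V L)}

theorem mono (h : Sng M A b n X m) {k : ℕ} (hk : k ≤ n) : Sng M A b k X m :=
  ⟨fun φ hφ => h.h φ (by omega), h.p⟩

theorem pos (h : Sng M A b n X m) : ∀ φ ≤ n, (X φ).pos = (b, ph φ) := by
  intro φ
  induction φ with
  | zero => intro _; exact h.p
  | succ k ih =>
    intro hk
    rw [step_pos (h.h k (by omega)), ih (by omega)]
    simp [nextP, ph_succ]

theorem contact (h : Sng M A b n X m) {φ : ℕ} (hφ : φ < n) (hn : φ < 27) (hc : ctN φ = true) :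
    ∃ v, m φ = some v := by
  have h1 := h.h φ hφ
  unfold step at h1
  rw [Option.map_eq_some_iff] at h1
  obtain ⟨w, hw, hw2⟩ := h1
  unfold act at hw
  rw [h.pos φ hφ.le] at hw
  have : ctP (b, ph φ) = true := by
    simpa [ctP, ctN, mvP_ph b hn, exP_ph b hn] using hc
  rw [this] at hw
  cases hm : m φ with
  | none => simp [hm] at hw
  | some v => exact ⟨v, rfl⟩

theorem act_eq (h : Sng M A b n X m) {φ : ℕ} (hφ : φ < n) (hn : φ < 27) :
    ∃ w1, (if b then act1 M φ (m φ) (X φ).w else act0 M φ (m φ) (X φ).w) = some w1 ∧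
      X (φ + 1) = fin M A (X φ) w1 := by
  have h1 := h.h φ hφ
  unfold step at h1
  rw [Option.map_eq_some_iff] at h1
  obtain ⟨w, hw, hw2⟩ := h1
  refine ⟨w, ?_, hw2.symm⟩
  unfold act at hw
  rw [h.pos φ hφ.le] at hw
  split_ifs at hw with h2 h3
  · simp only [ph_val hn] at hw
    rw [if_pos h3]; exact hw
  · simp only [ph_val hn] at hw
    rw [if_neg h3]; exact hw

theorem act_eq0 (h : Sng M A false n X m) {φ : ℕ} (hφ : φ < n) (hn : φ < 27) :
    ∃ w1, act0 M φ (m φ) (X φ).w = some w1 ∧ X (φ + 1) = fin M A (X φ) w1 := by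
  simpa using h.act_eq hφ hn

theorem act_eq1 (h : Sng M A true n X m) {φ : ℕ} (hφ : φ < n) (hn : φ < 27) :
    ∃ w1, act1 M φ (m φ) (X φ).w = some w1 ∧ X (φ + 1) = fin M A (X φ) w1 := by
  simpa using h.act_eq hφ hn

theorem d4 (h : Sng M A b n X m) (hn : 4 ≤ n) : (X 4).w.d = if b then .p else .m := by
  cases b
  · obtain ⟨_, a, e⟩ := h.act_eq0 (φ := 3) (by omega) (by omega)
    simp only [act0, Option.some.injEq] at a
    subst a
    simp at e
    simp [e, fin]
  · obtain ⟨_, a, e⟩ := h.act_eq1 (φ := 3) (by omega) (by omega)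
    simp only [act1, Option.some.injEq] at a
    subst a
    simp at e
    simp [e, fin]

theorem d13 (h : Sng M A b n X m) (hn : 13 ≤ n) : (X 13).w.d = if b then .m else .p := by
  cases b
  · obtain ⟨_, a, e⟩ := h.act_eq0 (φ := 12) (by omega) (by omega)
    simp only [act0, Option.some.injEq] at a
    subst a
    simp at e
    simp [e, fin]
  · obtain ⟨_, a, e⟩ := h.act_eq1 (φ := 12) (by omega) (by omega)
    simp only [act1, Option.some.injEq] at a
    subst a
    simp at e
    simp [e, fin]

theorem dsucc (h : Sng M A b n X m) {φ : ℕ} (hn : φ < n) (h1 : 22 ≤ φ) (h2 : φ < 26) :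
    (X (φ + 1)).w.d = (X φ).w.d ∧ (X (φ + 1)).w.o = (X φ).w.o := by
  cases b
  · obtain ⟨_, a, e⟩ := h.act_eq0 (φ := φ) (by omega) (by omega)
    interval_cases φ <;> simp only [act0, Option.some.injEq] at a <;> subst a <;> simp at e <;>
      simp [e, fin]
  · obtain ⟨_, a, e⟩ := h.act_eq1 (φ := φ) (by omega) (by omega)
    interval_cases φ <;> simp only [act1, Option.some.injEq] at a <;> subst a <;> simp at e <;>
      simp [e, fin]

theorem dconst (h : Sng M A b n X m) {φ : ℕ} (hn : φ ≤ n) (h1 : 22 ≤ φ) (h2 : φ ≤ 26) :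
    (X φ).w.d = (X 22).w.d ∧ (X φ).w.o = (X 22).w.o := by
  induction φ, h1 using Nat.le_induction with
  | base => simp
  | succ k hk ih =>
    obtain ⟨e1, e2⟩ := h.dsucc (φ := k) (by omega) hk (by omega)
    rw [e1, e2]
    exact ih (by omega) (by omega)

theorem odr (h : Sng M A b n X m) (hn : 22 ≤ n) : (X 22).w.o.dr = (X 22).w.d := by
  cases b
  · obtain ⟨_, a, e⟩ := h.act_eq0 (φ := 21) (by omega) (by omega)
    simp only [act0, Option.some.injEq] at a
    subst a
    simp at e
    simp only [e, fin]
    split_ifs <;> rfl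
  · obtain ⟨_, a, e⟩ := h.act_eq1 (φ := 21) (by omega) (by omega)
    simp only [act1, Option.some.injEq] at a
    subst a
    simp at e
    simp [e, fin]

theorem dir (h : Sng M A b n X m) {φ : ℕ} (hφ : φ ≤ n) (hn : φ < 27) :
    (dirQ (X φ)).toInt = off b (X 22).w.d.toInt (φ + 1) - off b (X 22).w.d.toInt φ := by
  unfold dirQ dirW
  rw [h.pos φ hφ, mvP_ph b hn]
  by_cases h4 : φ = 4
  · subst h4; rw [h.d4 (by omega)]; cases b <;> simp [mvN, off, Dir.toInt]
  by_cases h13 : φ = 13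
  · subst h13; rw [h.d13 (by omega)]; cases b <;> simp [mvN, off, Dir.toInt]
  by_cases h22 : 22 ≤ φ ∧ φ ≤ 25
  · rw [(h.dconst (φ := φ) hφ h22.1 (by omega)).1]
    obtain ⟨h1, h2⟩ := h22
    interval_cases φ <;> simp [mvN, off] <;> ring
  · have : mvN φ = false := by
      simp [mvN]; omega
    rw [this]
    have : off b (X 22).w.d.toInt (φ + 1) = off b (X 22).w.d.toInt φ := by
      unfold off
      interval_cases φ <;> simp_all <;> ring
    rw [this, sub_self]; rfl

theorem check (h : Sng M A b n X m) (hn : 27 ≤ n) : ∀ v, m 26 = some v → v.dr = (X 26).w.d := by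
  intro v hv
  cases b
  · obtain ⟨_, a, e⟩ := h.act_eq0 (φ := 26) (by omega) (by omega)
    simp only [act0, hv] at a
    split_ifs at a with h1
    simpa using h1
  · obtain ⟨_, a, e⟩ := h.act_eq1 (φ := 26) (by omega) (by omega)
    simp only [act1, hv] at a
    split_ifs at a with h1
    simpa using h1

theorem readA0 (h : Sng M A false n X m) (hn : 3 ≤ n) :
    (X 2).w.o = (X 0).s.w.o ∧ (X 3).w.o.pos = (X 0).s.pos ∧ (X 3).w.mO = (X 0).s.w.o ∧
    (X 3).w.mP.pos = (X 0).s.pos := by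
  obtain ⟨_, a0, e0⟩ := h.act_eq0 (φ := 0) (by omega) (by omega)
  obtain ⟨_, a1, e1⟩ := h.act_eq0 (φ := 1) (by omega) (by omega)
  obtain ⟨_, a2, e2⟩ := h.act_eq0 (φ := 2) (by omega) (by omega)
  simp only [act0, Option.some.injEq, zero_add] at a0 a1 a2 e0 e1 e2
  subst a0 a1 a2
  norm_num at e1 e2
  simp [e2, e1, e0, fin, sto, gop]

theorem read0 (h : Sng M A false n X m) (hn : 6 ≤ n) :
    (X 5).w.o = (X 0).s.w.o ∧ (X 6).w.o.pos = (X 0).s.pos := by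
  obtain ⟨-, -, b1, b2⟩ := h.readA0 (by omega)
  obtain ⟨_, a3, e3⟩ := h.act_eq0 (φ := 3) (by omega) (by omega)
  obtain ⟨_, a4, e4⟩ := h.act_eq0 (φ := 4) (by omega) (by omega)
  obtain ⟨_, a5, e5⟩ := h.act_eq0 (φ := 5) (by omega) (by omega)
  simp only [act0, Option.some.injEq] at a3 a4 a5
  subst a3 a4 a5
  norm_num at e3 e4 e5
  simp [e5, e4, e3, fin, b1, b2]

theorem read1 (h : Sng M A true n X m) (hn : 6 ≤ n) {Y : ℕ → Q L A.Γ} {m' : ℕ → Option (V L)}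
    (h' : Sng M A false 3 Y m') (h2 : m 2 = some (Y 2).w.o) (h3 : m 3 = some (Y 3).w.o) :
    (X 5).w.o = (Y 0).s.w.o ∧ (X 6).w.o.pos = (Y 0).s.pos := by
  obtain ⟨b1, b2, -, -⟩ := h'.readA0 (by omega)
  obtain ⟨_, a2, e2⟩ := h.act_eq1 (φ := 2) (by omega) (by omega)
  obtain ⟨_, a3, e3⟩ := h.act_eq1 (φ := 3) (by omega) (by omega)
  obtain ⟨_, a4, e4⟩ := h.act_eq1 (φ := 4) (by omega) (by omega)
  obtain ⟨_, a5, e5⟩ := h.act_eq1 (φ := 5) (by omega) (by omega)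
  simp only [act1, Option.some.injEq, h2, h3] at a2 a3 a4 a5
  split_ifs at a2
  simp only [Option.some.injEq] at a2
  subst a2 a3 a4 a5
  norm_num at e2 e3 e4 e5
  simp [e5, e4, e3, e2, fin, b1, b2]

end Sng
end SimCA
end

section
namespace SimCA

variable {L : Type} {M : Mealy L} {A : Alg L}

/-- scale data: time unit, spacing, extent, member offsets -/
structure Sc where
  τ : ℕ
  ℓ : ℤ
  h : ℤ
  D : ℤ → Prop

def Sc.up (c : Sc) : Sc := ⟨27 * c.τ, 4 * c.ℓ, c.h + c.ℓ, fun d => c.D d ∨ c.D (d - c.ℓ)⟩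

def scl : ℕ → Sc
  | 0 => ⟨1, 1, 0, fun d => d = 0⟩
  | k + 1 => (scl k).up

structure Sc.Ok (c : Sc) : Prop where
  τ : 0 < c.τ
  ℓ : 0 < c.ℓ
  h : 0 ≤ c.h
  h3 : 3 * c.h = c.ℓ - 1
  D0 : c.D 0
  Dh : c.D c.h

theorem Sc.Ok.up {c : Sc} (h : c.Ok) : c.up.Ok :=
  ⟨by have := h.τ; simp [Sc.up]; omega, by have := h.ℓ; simp [Sc.up]; omega,
   by have := h.h; have := h.ℓ; simp [Sc.up]; omega,
   by have := h.h3; simp [Sc.up]; omega, Or.inl h.D0, Or.inr (by simpa [Sc.up] using h.Dh)⟩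

theorem scl_ok (k : ℕ) : (scl k).Ok := by
  induction k with
  | zero => exact ⟨by decide, by decide, by decide, by decide, rfl, rfl⟩
  | succ k ih => exact ih.up

variable {c : Sc} {P : ℕ → ℤ → ℕ → ℤ → Prop}

structure Link (M : Mealy L) (A : Alg L) (c : Sc) (P : ℕ → ℤ → ℕ → ℤ → Prop)
    (η : ℕ → ℤ → Option (Q L A.Γ)) (t : ℕ) (i j : ℤ) (x y : Q L A.Γ)
    (m : Option (V L)) : Prop where
  src : η t j = some x
  mov : i = j + c.ℓ * (dirQ x).toInt
  stp : step M A x m = some y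
  see : ∀ v, m = some v → mvP x.pos = false ∧ ∃ z, η t (j + c.ℓ * sd x.pos) = some z ∧
    z.pos = flipP x.pos ∧ v = z.w.o
  uns : m = none → mvP x.pos = false → ∀ z, η t (j + c.ℓ * sd x.pos) = some z →
    z.pos = flipP x.pos → ∀ y', η (t + c.τ) (j + c.ℓ * sd x.pos) = some y' →
      y'.pos ≠ nextP z.pos
  mem : ∀ d, c.D d → P t (j + d) (t + c.τ) (i + d)
  ext : ∀ u, t ≤ u → u ≤ t + c.τ → ∃ a b, P u a (t + c.τ) i ∧ P u b (t + c.τ) (i + c.h) ∧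
    a ≤ max i j ∧ min i j + c.h ≤ b
  adj : ∀ v, m = some v → sd x.pos = 1 → ∀ y', η (t + c.τ) (i + c.ℓ) = some y' →
    y'.pos = flipP y.pos → ∃ u a, t ≤ u ∧ u ≤ t + c.τ ∧ P u a (t + c.τ) (i + c.h) ∧
      P u (a + 1) (t + c.τ) (i + c.ℓ)

def Hist (M : Mealy L) (A : Alg L) (c : Sc) (P : ℕ → ℤ → ℕ → ℤ → Prop)
    (η : ℕ → ℤ → Option (Q L A.Γ)) : Prop :=
  ∀ t i y, η (t + c.τ) i = some y → ∃ j x m, Link M A c P η t i j x y m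

open Classical in
noncomputable def dec (M : Mealy L) (A : Alg L) (c : Sc) (η : ℕ → ℤ → Option (Q L A.Γ)) (s : ℕ) (r : ℤ) :
    Option (Q L (up M A).Γ) :=
  if h : ∃ x : Q L A.Γ × Q L A.Γ, η s r = some x.1 ∧ η s (r + c.ℓ) = some x.2 ∧
    x.1.pos = (false, 0) ∧ x.2.pos = (true, 0) then
    some (mac M A h.choose.1 h.choose.2) else none

variable {η : ℕ → ℤ → Option (Q L A.Γ)}

theorem dec_eq {s : ℕ} {r : ℤ} {x0 x1 : Q L A.Γ} (h0 : η s r = some x0)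
    (h1 : η s (r + c.ℓ) = some x1) (p0 : x0.pos = (false, 0)) (p1 : x1.pos = (true, 0)) :
    dec M A c η s r = some (mac M A x0 x1) := by
  have h : ∃ x : Q L A.Γ × Q L A.Γ, η s r = some x.1 ∧ η s (r + c.ℓ) = some x.2 ∧
    x.1.pos = (false, 0) ∧ x.2.pos = (true, 0) := ⟨(x0, x1), h0, h1, p0, p1⟩
  unfold dec
  rw [dif_pos h]
  have hs := h.choose_spec
  rw [Option.some.inj (h0.symm.trans hs.1), Option.some.inj (h1.symm.trans hs.2.1)]

theorem of_dec {s : ℕ} {r : ℤ} {y : Q L (up M A).Γ} (h : dec M A c η s r = some y) :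
    ∃ x0 x1, η s r = some x0 ∧ η s (r + c.ℓ) = some x1 ∧ x0.pos = (false, 0) ∧
      x1.pos = (true, 0) ∧ y = mac M A x0 x1 := by
  unfold dec at h
  split_ifs at h with h1
  have hs := h1.choose_spec
  simp only [Option.some.injEq] at h
  exact ⟨_, _, hs.1, hs.2.1, hs.2.2.1, hs.2.2.2, h.symm⟩

def PTrans (P : ℕ → ℤ → ℕ → ℤ → Prop) : Prop :=
  ∀ u a t i t' i', P u a t i → P t i t' i' → P u a t' i'

/-- a backward trace -/
structure Tr (M : Mealy L) (A : Alg L) (c : Sc) (P : ℕ → ℤ → ℕ → ℤ → Prop)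
    (η : ℕ → ℤ → Option (Q L A.Γ)) (t : ℕ) (b : Bool) (n : ℕ) (J : ℕ → ℤ)
    (X : ℕ → Q L A.Γ) (m : ℕ → Option (V L)) : Prop where
  link : ∀ φ < n, Link M A c P η (t + φ * c.τ) (J (φ + 1)) (J φ) (X φ) (X (φ + 1)) (m φ)
  sng : Sng M A b n X m
  val : ∀ φ ≤ n, η (t + φ * c.τ) (J φ) = some (X φ)

theorem ph_inj_next {b : Bool} {p : Pos} {n : ℕ} (h : nextP p = (b, ph (n + 1))) :
    p = (b, ph n) := by
  apply nextP_inj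
  rw [h]
  simp [nextP, ph_succ]

theorem exists_tr (H : Hist M A c P η) (t : ℕ) (b : Bool) (n : ℕ) (i : ℤ) (y : Q L A.Γ)
    (hy : η (t + n * c.τ) i = some y) (hp : y.pos = (b, ph n)) :
    ∃ J X m, Tr M A c P η t b n J X m ∧ J n = i ∧ X n = y := by
  induction n generalizing i y with
  | zero =>
    exact ⟨fun _ => i, fun _ => y, fun _ => none, ⟨by simp, ⟨by simp, hp⟩, fun φ hφ => by
      obtain rfl : φ = 0 := by omega
      exact hy⟩, rfl, rfl⟩
  | succ n ih =>
    have e : t + (n + 1) * c.τ = (t + n * c.τ) + c.τ := by ring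
    have hy' := hy
    rw [e] at hy
    obtain ⟨j, x, m, hl⟩ := H _ _ _ hy
    have hx : x.pos = (b, ph n) := ph_inj_next (by rw [← step_pos hl.stp, hp])
    obtain ⟨J, X, ms, hT, hJ, hX⟩ := ih j x hl.src hx
    have s : ∀ φ, φ < n → ((if φ + 1 ≤ n then J (φ + 1) else i) = J (φ + 1) ∧
        (if φ + 1 ≤ n then X (φ + 1) else y) = X (φ + 1)) := fun φ h => by
      rw [if_pos (by omega), if_pos (by omega)]; simp
    have lk : ∀ φ < n + 1, Link M A c P η (t + φ * c.τ) (if φ + 1 ≤ n then J (φ + 1) else i)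
        (if φ ≤ n then J φ else i) (if φ ≤ n then X φ else y)
        (if φ + 1 ≤ n then X (φ + 1) else y) (if φ < n then ms φ else m) := by
      intro φ hφ
      by_cases h1 : φ < n
      · rw [(s φ h1).1, (s φ h1).2, if_pos h1.le, if_pos h1.le, if_pos h1]
        exact hT.link φ h1
      · obtain rfl : φ = n := by omega
        simp only [Nat.not_succ_le_self, le_refl, if_true, if_false, lt_irrefl, hJ, hX]
        exact hl
    refine ⟨fun φ => if φ ≤ n then J φ else i, fun φ => if φ ≤ n then X φ else y,
      fun φ => if φ < n then ms φ else m, ⟨lk, ⟨fun φ hφ => (lk φ hφ).stp, ?_⟩, ?_⟩, by simp, by simp⟩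
    · simpa using hT.sng.p
    · intro φ hφ
      by_cases h1 : φ ≤ n
      · simpa [h1] using hT.val φ h1
      · obtain rfl : φ = n + 1 := by omega
        simpa using hy'

namespace Tr
variable {t n : ℕ} {b : Bool} {J : ℕ → ℤ} {X : ℕ → Q L A.Γ} {m : ℕ → Option (V L)}

theorem mono (h : Tr M A c P η t b n J X m) {k : ℕ} (hk : k ≤ n) : Tr M A c P η t b k J X m :=
  ⟨fun φ hφ => h.link φ (by omega), h.sng.mono hk, fun φ hφ => h.val φ (by omega)⟩

theorem J_eq (h : Tr M A c P η t b n J X m) : ∀ φ ≤ n, φ ≤ 27 →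
    J φ = J 0 + c.ℓ * off b (X 22).w.d.toInt φ := by
  intro φ
  induction φ with
  | zero => intro _ _; simp [off]
  | succ k ih =>
    intro h1 h2
    rw [(h.link k (by omega)).mov, ih (by omega) (by omega), h.sng.dir (by omega) (by omega)]
    ring

theorem contact (h : Tr M A c P η t b n J X m) {φ : ℕ} (h1 : φ < n) (h2 : φ < 27)
    (hc : ctN φ = true) : ∃ z, η (t + φ * c.τ) (J φ + c.ℓ * (if b then -1 else 1)) = some z ∧
      z.pos = (!b, ph φ) ∧ m φ = some z.w.o := by
  obtain ⟨v, hv⟩ := h.sng.contact h1 h2 hc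
  obtain ⟨-, z, hz, hz2, hz3⟩ := (h.link φ h1).see v hv
  have hs : sd (X φ).pos = if b then -1 else 1 := by
    rw [h.sng.pos φ h1.le]
    unfold sd
    rw [exP_ph b h2]
    simp only [ctN, Bool.and_eq_true, Bool.not_eq_true'] at hc
    rw [hc.2]
    cases b <;> simp
  rw [hs] at hz
  refine ⟨z, hz, ?_, by rw [hv, hz3]⟩
  rw [hz2, h.sng.pos φ h1.le]; rfl

theorem path (tr : PTrans P)
    (h : Tr M A c P η t b n J X m) {d : ℤ} (hd : c.D d) {φ : ℕ} (h1 : φ < n) :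
    P (t + φ * c.τ) (J φ + d) (t + n * c.τ) (J n + d) := by
  have key : ∀ k, φ + 1 + k ≤ n →
      P (t + φ * c.τ) (J φ + d) (t + (φ + 1 + k) * c.τ) (J (φ + 1 + k) + d) := by
    intro k
    induction k with
    | zero =>
      intro _
      have := (h.link φ h1).mem d hd
      rwa [show t + φ * c.τ + c.τ = t + (φ + 1 + 0) * c.τ by ring] at this
    | succ k ih =>
      intro hk
      have := (h.link (φ + 1 + k) (by omega)).mem d hd
      rw [show t + (φ + 1 + k) * c.τ + c.τ = t + (φ + 1 + (k + 1)) * c.τ by ring] at this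
      exact tr _ _ _ _ _ _ (ih (by omega)) this
  have := key (n - (φ + 1)) (by omega)
  rwa [show φ + 1 + (n - (φ + 1)) = n by omega] at this

end Tr

theorem off_ct {φ : ℕ} (h : φ ≤ 27) (hc : ctN φ = true) (D : ℤ) (b b' : Bool) :
    off b D φ = off b' D φ := by
  revert hc
  interval_cases φ <;> simp [ctN, mvN, exN, off]

/-- a pair traced through a whole cycle -/
structure PairT (M : Mealy L) (A : Alg L) (c : Sc) (P : ℕ → ℤ → ℕ → ℤ → Prop)
    (η : ℕ → ℤ → Option (Q L A.Γ)) (t : ℕ) (j : ℤ) (D : ℤ) (J0 J1 : ℕ → ℤ)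
    (X0 X1 : ℕ → Q L A.Γ) (m0 m1 : ℕ → Option (V L)) : Prop where
  t0 : Tr M A c P η t false 27 J0 X0 m0
  t1 : Tr M A c P η t true 27 J1 X1 m1
  ch : Chain M A 27 X0 X1 m0 m1
  j0 : ∀ φ ≤ 27, J0 φ = j + c.ℓ * off false D φ
  j1 : ∀ φ ≤ 27, J1 φ = j + c.ℓ + c.ℓ * off true D φ
  hD : D = (dirQ (mac M A (X0 0) (X1 0))).toInt

theorem exists_pair (H : Hist M A c P η) (t : ℕ) (i : ℤ) (y : Q L (up M A).Γ)
    (hy : dec M A c η (t + 27 * c.τ) i = some y) :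
    ∃ j D J0 J1 X0 X1 m0 m1, PairT M A c P η t j D J0 J1 X0 X1 m0 m1 ∧ i = j + 4 * c.ℓ * D ∧
      y = mac M A (X0 27) (X1 27) := by
  obtain ⟨y0, y1, h0, h1, p0, p1, rfl⟩ := of_dec hy
  obtain ⟨J0, X0, m0, T0, e0, f0⟩ := exists_tr H t false 27 i y0 h0 p0
  obtain ⟨J1, X1, m1, T1, e1, f1⟩ := exists_tr H t true 27 _ y1 h1 p1
  have a0 := T0.J_eq
  have a1 := T1.J_eq
  have b0 : J0 26 = i := by
    rw [a0 26 (by omega) (by omega), ← e0, a0 27 (by omega) (by omega)]; norm_num [off]; left; ring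
  have b1 : J1 26 = i + c.ℓ := by
    rw [a1 26 (by omega) (by omega), ← e1, a1 27 (by omega) (by omega)]; norm_num [off]; left; ring
  obtain ⟨z, hz1, hz2, hz3⟩ := T0.contact (φ := 26) (by omega) (by omega) rfl
  have : z = X1 26 := by
    have h2 := T1.val 26 (by omega)
    rw [b1] at h2
    simp only [b0] at hz1
    simpa [h2, eq_comm] using hz1
  subst this
  have hd : (X0 22).w.d = (X1 22).w.d := by
    have h2 := T0.sng.check (by omega) _ hz3
    rw [(T1.sng.dconst (φ := 26) (by omega) (by omega) (by omega)).2, T1.sng.odr (by omega),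
      (T0.sng.dconst (φ := 26) (by omega) (by omega) (by omega)).1] at h2
    exact h2.symm
  rw [← hd] at a1
  have hj : J1 0 = J0 0 + c.ℓ := by
    have h2 := a0 27 (by omega) (by omega)
    have h3 := a1 27 (by omega) (by omega)
    rw [e0] at h2; rw [e1] at h3
    simp [off] at h2 h3
    linarith
  rw [hj] at a1
  have hadj : ∀ φ ≤ 27, ctN φ = true → J1 φ = J0 φ + c.ℓ := by
    intro φ h2 h3
    rw [a0 φ h2 h2, a1 φ h2 h2, off_ct h2 h3 _ true false]; ring
  have CH : Chain M A 27 X0 X1 m0 m1 := by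
    refine ⟨T0.sng.h, T1.sng.h, T0.sng.p, T1.sng.p, ?_, ?_⟩
    · intro φ h2 h3
      obtain ⟨z, hz1, hz2, hz3⟩ := T0.contact h2 h2 h3
      have h4 := T1.val φ h2.le
      rw [hadj φ h2.le h3] at h4
      simp only [Bool.false_eq_true, if_false, mul_one, h4, Option.some.injEq] at hz1
      rw [hz3, hz1]
    · intro φ h2 h3
      obtain ⟨z, hz1, hz2, hz3⟩ := T1.contact h2 h2 h3
      have h4 := T0.val φ h2.le
      rw [hadj φ h2.le h3] at hz1
      simp only [if_true, mul_neg, mul_one, add_neg_cancel_right, h4, Option.some.injEq] at hz1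
      rw [hz3, hz1]
  refine ⟨J0 0, (X0 22).w.d.toInt, J0, J1, X0, X1, m0, m1, ⟨T0, T1, CH, fun φ h => a0 φ h h,
    fun φ h => a1 φ h h, ?_⟩, ?_, by rw [f0, f1]⟩
  · obtain ⟨w1, -, -, h5, -⟩ := CH.seg22 (by omega)
    rw [h5]; rfl
  · rw [← e0, a0 27 (by omega) (by omega)]; simp [off]; ring

theorem nbr (H : Hist M A c P η) (t : ℕ) (b : Bool) (K : ℤ) (z : Q L A.Γ)
    (hz : η (t + 6 * c.τ) (K + c.ℓ * (if b then 2 else -1)) = some z) (hp : z.pos = (b, ph 6)) :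
    ∃ Z z5, dec M A c η t K = some Z ∧
      η (t + 5 * c.τ) (K + c.ℓ * (if b then 2 else -1)) = some z5 ∧
      z5.pos = (b, ph 5) ∧ z5.w.o = Z.w.o ∧ z.w.o.pos = Z.pos := by
  obtain ⟨J, X, m, T, e, f⟩ := exists_tr H t b 6 _ z hz hp
  have a := T.J_eq
  have v0 := T.val 0 (by omega)
  have v5 := T.val 5 (by omega)
  have j6 := a 6 (by omega) (by omega)
  rw [e] at j6
  cases b
  · have j0 : J 0 = K := by simp [off] at j6; linarith
    have j5 : J 5 = K - c.ℓ := by rw [a 5 (by omega) (by omega)]; simp [off, j0]; ring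
    obtain ⟨u, hu, hu2, hu3⟩ := T.contact (φ := 0) (by omega) (by omega) rfl
    simp only [zero_mul, add_zero, j0, Bool.false_eq_true, if_false, mul_one] at v0 hu
    refine ⟨_, X 5, dec_eq v0 hu T.sng.p hu2, ?_, T.sng.pos 5 (by omega), ?_, ?_⟩
    · rw [j5] at v5; simpa [← sub_eq_add_neg] using v5
    · exact (T.sng.read0 (by omega)).1
    · rw [← f]; exact (T.sng.read0 (by omega)).2
  · have j0 : J 0 = K + c.ℓ := by simp [off] at j6; linarith
    have j5 : J 5 = K + c.ℓ * 2 := by rw [a 5 (by omega) (by omega)]; simp [off, j0]; ring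
    have j3 : J 3 = K + c.ℓ := by rw [a 3 (by omega) (by omega)]; simp [off, j0]
    have j2 : J 2 = K + c.ℓ := by rw [a 2 (by omega) (by omega)]; simp [off, j0]
    obtain ⟨u3, hu, hu2, hu3⟩ := T.contact (φ := 3) (by omega) (by omega) rfl
    obtain ⟨u2, hw, hw2, hw3⟩ := T.contact (φ := 2) (by omega) (by omega) rfl
    simp only [zero_mul, add_zero, j0, j3, j2, if_true, mul_neg, mul_one, add_neg_cancel_right] at v0 hu hw
    obtain ⟨J', Y, m', T', e', f'⟩ := exists_tr H t false 3 _ u3 hu hu2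
    have a' := T'.J_eq
    have k3 := a' 3 (by omega) (by omega)
    simp [off, e'] at k3
    have k2 := a' 2 (by omega) (by omega)
    simp [off, ← k3] at k2
    have w0 := T'.val 0 (by omega)
    have w2 := T'.val 2 (by omega)
    simp only [zero_mul, add_zero, ← k3, k2] at w0 w2
    rw [w2, Option.some.injEq] at hw
    rw [← f'] at hu3
    rw [← hw] at hw3
    have hr := T.sng.read1 (by omega) T'.sng hw3 hu3
    refine ⟨_, X 5, dec_eq w0 v0 T'.sng.p T.sng.p, ?_, T.sng.pos 5 (by omega), hr.1, ?_⟩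
    · rw [j5] at v5; simpa using v5
    · rw [← f]; exact hr.2

end SimCA
end

section
namespace SimCA

variable {L : Type} {M : Mealy L} {A : Alg L} {c : Sc} {P : ℕ → ℤ → ℕ → ℤ → Prop}
variable {η : ℕ → ℤ → Option (Q L A.Γ)}

theorem Tr.path' (tr : PTrans P)
    {t n : ℕ} {b : Bool} {J : ℕ → ℤ} {X : ℕ → Q L A.Γ} {m : ℕ → Option (V L)}
    (h : Tr M A c P η t b n J X m) {d : ℤ} (hd : c.D d) {φ u : ℕ} {a e : ℤ} (h1 : φ < n)
    (he : e = J (φ + 1) + d)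
    (hp : P u a (t + φ * c.τ + c.τ) e) : P u a (t + n * c.τ) (J n + d) := by
  subst he
  rw [show t + φ * c.τ + c.τ = t + (φ + 1) * c.τ by ring] at hp
  by_cases h2 : φ + 1 < n
  · exact tr _ _ _ _ _ _ hp (h.path tr hd h2)
  · obtain rfl : n = φ + 1 := by omega
    exact hp

theorem dir_cases (d : Dir) : d.toInt = -1 ∨ d.toInt = 0 ∨ d.toInt = 1 := by
  cases d <;> simp [Dir.toInt]

theorem off_le {D : ℤ} (hD : D = -1 ∨ D = 0 ∨ D = 1) {φ : ℕ} (h : φ ≤ 27) :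
    off false D φ ≤ max 0 (4 * D) ∧ min 0 (4 * D) ≤ off true D φ := by
  unfold off
  rcases hD with rfl | rfl | rfl <;> interval_cases φ <;> simp

theorem sd_cases (p : Pos) : sd p = 1 ∨ sd p = -1 := by
  unfold sd; split_ifs <;> simp

theorem dirQ_nm {Γ : Type} {q : Q L Γ} (h : mvP q.pos = false) : (dirQ q).toInt = 0 := by
  simp [dirQ, dirW, h, Dir.toInt]

theorem msgM_b (p : Pos) (b : Bool) (hb : sd p = if b then 1 else -1)
    (m0 m1 mb : ℕ → Option (V L)) (hm : mb = if b then m1 else m0) :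
    msgM M p (m0 5) (m0 6) (m1 5) (m1 6) =
      if (mb 6).isSome ∧
      ((mb 6).getD (dflt M)).pos = flipP p ∧ mvP p = false then
    some ((mb 5).getD (dflt M)) else none := by
  subst hm
  unfold msgM
  rw [hb]
  cases b <;> simp

namespace PairT
variable {t : ℕ} {j D : ℤ} {J0 J1 : ℕ → ℤ} {X0 X1 : ℕ → Q L A.Γ} {m0 m1 : ℕ → Option (V L)}

theorem see6 (h : PairT M A c P η t j D J0 J1 X0 X1 m0 m1) (b : Bool) {φ : ℕ}
    (hφ : φ = 5 ∨ φ = 6) {v : V L} (hv : (if b then m1 else m0) φ = some v) :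
    ∃ z, η (t + φ * c.τ) (j + c.ℓ * (if b then 3 else -2)) = some z ∧ z.pos = (!b, ph φ) ∧
      v = z.w.o := by
  have h27 : φ < 27 := by omega
  have hex : exN φ = true := by rcases hφ with rfl | rfl <;> rfl
  cases b
  · obtain ⟨-, z, h1, h2, h3⟩ := (h.t0.link φ h27).see v hv
    rw [h.t0.sng.pos φ h27.le] at h1 h2
    refine ⟨z, ?_, h2, h3⟩
    rw [h.j0 φ h27.le] at h1
    unfold sd at h1
    rw [exP_ph _ h27, hex] at h1
    rw [← h1]; congr 1
    rcases hφ with rfl | rfl <;> simp [off] <;> ring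
  · obtain ⟨-, z, h1, h2, h3⟩ := (h.t1.link φ h27).see v hv
    rw [h.t1.sng.pos φ h27.le] at h1 h2
    refine ⟨z, ?_, h2, h3⟩
    rw [h.j1 φ h27.le] at h1
    unfold sd at h1
    rw [exP_ph _ h27, hex] at h1
    rw [← h1]; congr 1
    rcases hφ with rfl | rfl <;> simp [off] <;> ring

theorem uns6 (h : PairT M A c P η t j D J0 J1 X0 X1 m0 m1) (b : Bool) {φ : ℕ}
    (hφ : φ = 5 ∨ φ = 6) (hv : (if b then m1 else m0) φ = none)
    {z y : Q L A.Γ} (hz : η (t + φ * c.τ) (j + c.ℓ * (if b then 3 else -2)) = some z)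
    (hp : z.pos = (!b, ph φ))
    (hy : η (t + (φ + 1) * c.τ) (j + c.ℓ * (if b then 3 else -2)) = some y) :
    y.pos ≠ (!b, ph (φ + 1)) := by
  have h27 : φ < 27 := by omega
  have hex : exN φ = true := by rcases hφ with rfl | rfl <;> rfl
  have hmv : mvN φ = false := by rcases hφ with rfl | rfl <;> rfl
  have hnx : nextP z.pos = (!b, ph (φ + 1)) := by rw [hp]; simp [nextP, ph_succ]
  rw [← hnx]
  rw [show t + (φ + 1) * c.τ = t + φ * c.τ + c.τ by ring] at hy
  cases b
  · have hu := (h.t0.link φ h27).uns hv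
    rw [h.t0.sng.pos φ h27.le] at hu
    have e : J0 φ + c.ℓ * sd (false, ph φ) = j + c.ℓ * (if false then 3 else -2) := by
      rw [h.j0 φ h27.le]
      unfold sd
      rw [exP_ph _ h27, hex]
      rcases hφ with rfl | rfl <;> simp [off] <;> ring
    rw [e] at hu
    exact hu (by rw [mvP_ph _ h27, hmv]) z hz hp y hy
  · have hu := (h.t1.link φ h27).uns hv
    rw [h.t1.sng.pos φ h27.le] at hu
    have e : J1 φ + c.ℓ * sd (true, ph φ) = j + c.ℓ * (if true then 3 else -2) := by
      rw [h.j1 φ h27.le]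
      unfold sd
      rw [exP_ph _ h27, hex]
      rcases hφ with rfl | rfl <;> simp [off] <;> ring
    rw [e] at hu
    exact hu (by rw [mvP_ph _ h27, hmv]) z hz hp y hy

/-- particle `b` of the pair in the exchange phases -/
theorem at6 (h : PairT M A c P η t j D J0 J1 X0 X1 m0 m1) (b : Bool) {φ : ℕ}
    (hφ : φ = 6 ∨ φ = 7) :
    η (t + φ * c.τ) (j + c.ℓ * (if b then 2 else -1)) = some ((if b then X1 else X0) φ) ∧
    ((if b then X1 else X0) φ).pos = (b, ph φ) := by
  have h27 : φ ≤ 27 := by omega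
  cases b
  · refine ⟨?_, h.t0.sng.pos φ h27⟩
    have := h.t0.val φ h27
    rw [h.j0 φ h27] at this
    simp only [Bool.false_eq_true, if_false]
    rw [← this]; congr 1
    rcases hφ with rfl | rfl <;> simp [off]
  · refine ⟨?_, h.t1.sng.pos φ h27⟩
    have := h.t1.val φ h27
    rw [h.j1 φ h27] at this
    simp only [if_true]
    rw [← this]; congr 1
    rcases hφ with rfl | rfl <;> simp [off] <;> ring

theorem o6 (h : PairT M A c P η t j D J0 J1 X0 X1 m0 m1) (b : Bool) :
    ((if b then X1 else X0) 6).w.o.pos = (X0 0).s.pos := by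
  cases b
  · exact (h.ch.segC0 (by omega)).2.2.2.1
  · exact (h.ch.segC1 (by omega)).2.2.1

theorem posEnd (h : PairT M A c P η t j D J0 J1 X0 X1 m0 m1) :
    (mac M A (X0 27) (X1 27)).pos = nextP (X0 0).s.pos :=
  step_pos h.ch.macStep

theorem D0 (h : PairT M A c P η t j D J0 J1 X0 X1 m0 m1) (hm : mvP (X0 0).s.pos = false) :
    D = 0 := by
  rw [h.hD]; exact dirQ_nm hm

end PairT

theorem Hist.decode (ok : c.Ok) (tr : PTrans P)
    (H : Hist M A c P η) : Hist M (up M A) c.up P (dec M A c η) := by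
  intro t i y hy
  obtain ⟨j, D, J0, J1, X0, X1, m0, m1, h, hi, rfl⟩ := exists_pair H t i y hy
  have hDc : D = -1 ∨ D = 0 ∨ D = 1 := by rw [h.hD]; exact dir_cases _
  have j00 : J0 0 = j := by rw [h.j0 0 (by omega)]; simp [off]
  have j10 : J1 0 = j + c.ℓ := by rw [h.j1 0 (by omega)]; simp [off]
  have j027 : J0 27 = i := by rw [h.j0 27 (by omega), hi]; simp [off]; ring
  have j127 : J1 27 = i + c.ℓ := by rw [h.j1 27 (by omega), hi]; simp [off]; ring
  have hsrc : dec M A c η t j = some (mac M A (X0 0) (X1 0)) := by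
    refine dec_eq ?_ ?_ h.t0.sng.p h.t1.sng.p
    · simpa [j00] using h.t0.val 0 (by omega)
    · simpa [j10] using h.t1.val 0 (by omega)
  obtain ⟨b, hb⟩ : ∃ b : Bool, sd (X0 0).s.pos = if b then 1 else -1 := by
    rcases sd_cases (X0 0).s.pos with h1 | h1
    · exact ⟨true, h1⟩
    · exact ⟨false, h1⟩
  have hK : ∀ K, K = j + 4 * c.ℓ * sd (X0 0).s.pos →
      j + c.ℓ * (if b then 3 else -2) = K + c.ℓ * (if !b then 2 else -1) := by
    rintro K rfl
    rw [hb]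
    cases b <;> simp <;> ring
  obtain ⟨mb, hmb⟩ : ∃ mb : ℕ → Option (V L), mb = if b then m1 else m0 := ⟨_, rfl⟩
  refine ⟨j, mac M A (X0 0) (X1 0), _, hsrc, ?_, h.ch.macStep, ?_, ?_, ?_, ?_, ?_⟩
  · rw [hi, h.hD]; rfl
  · intro v hv
    rw [msgM_b _ b hb m0 m1 mb hmb] at hv
    split_ifs at hv with hc
    obtain ⟨c1, c2, c3⟩ := hc
    simp only [Option.some.injEq] at hv
    obtain ⟨v6, hv6⟩ := Option.isSome_iff_exists.1 c1
    rw [hv6] at c2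
    obtain ⟨z6, hz1, hz2, hz3⟩ := h.see6 b (Or.inr rfl) (hmb ▸ hv6)
    have hK' := hK _ rfl
    rw [hK'] at hz1
    obtain ⟨Z, z5, d1, d2, d3, d4, d5⟩ := nbr H t (!b) _ z6 hz1 hz2
    refine ⟨c3, Z, d1, ?_, ?_⟩
    · rw [← d5, ← hz3]; exact c2
    · cases h5 : mb 5 with
      | none =>
        exact absurd hz2 (h.uns6 b (Or.inl rfl) (hmb ▸ h5) (by rw [hK']; exact d2) d3
          (by rw [hK']; exact hz1))
      | some v5 =>
        obtain ⟨z', e1, e2, e3⟩ := h.see6 b (Or.inl rfl) (hmb ▸ h5)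
        rw [hK', d2, Option.some.injEq] at e1
        rw [← hv, h5, ← d4, e1]; exact e3
  · intro hn hm Z hZ hZp y' hy' hyp
    obtain ⟨j', D', J0', J1', X0', X1', m0', m1', h', hi', rfl⟩ := exists_pair H t _ y' hy'
    have hp' : (X0' 0).s.pos = flipP (X0 0).s.pos := by
      rw [h'.posEnd] at hyp
      rw [nextP_inj hyp]; exact hZp
    have hD' := h'.D0 (by rw [hp']; exact hm)
    rw [hD', mul_zero, add_zero] at hi'
    have hK' := hK j' hi'.symm
    obtain ⟨a6, a6'⟩ := h'.at6 (!b) (Or.inl rfl)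
    obtain ⟨a7, a7'⟩ := h'.at6 (!b) (Or.inr rfl)
    rw [← hK'] at a6 a7
    rw [msgM_b _ b hb m0 m1 mb hmb] at hn
    split_ifs at hn with hc
    apply hc
    cases h6 : mb 6 with
    | none => exact absurd a7' (h.uns6 b (Or.inr rfl) (hmb ▸ h6) a6 a6' a7)
    | some v6 =>
      obtain ⟨z', e1, e2, e3⟩ := h.see6 b (Or.inr rfl) (hmb ▸ h6)
      rw [a6, Option.some.injEq] at e1
      refine ⟨rfl, ?_, hm⟩
      rw [Option.getD_some, e3, ← e1, h'.o6, hp']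
  · intro d hd
    rcases hd with hd | hd
    · have := h.t0.path tr hd (φ := 0) (by omega)
      rw [j00, j027] at this
      simpa [Sc.up] using this
    · have := h.t1.path tr hd (φ := 0) (by omega)
      rw [j10, j127] at this
      simpa [Sc.up, add_assoc] using this
  · intro u hu1 hu2
    obtain ⟨φ, hφ, f1, f2⟩ : ∃ φ, φ < 27 ∧ t + φ * c.τ ≤ u ∧ u ≤ t + φ * c.τ + c.τ := by
      have hτ := ok.τ
      change u ≤ t + 27 * c.τ at hu2
      by_cases hu3 : u = t + 27 * c.τ
      · exact ⟨26, by omega, by omega, by omega⟩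
      · refine ⟨(u - t) / c.τ, ?_, ?_, ?_⟩
        · rw [Nat.div_lt_iff_lt_mul hτ]; omega
        · have := Nat.div_mul_le_self (u - t) c.τ; omega
        · have := Nat.lt_div_mul_add (a := u - t) hτ; omega
    obtain ⟨a, -, ha, -, ha2, -⟩ := (h.t0.link φ hφ).ext u f1 f2
    obtain ⟨-, b', -, hb', -, hb2⟩ := (h.t1.link φ hφ).ext u f1 f2
    have hℓ := ok.ℓ
    refine ⟨a, b', ?_, ?_, ?_, ?_⟩
    · have := h.t0.path' tr ok.D0 hφ (by ring) ha
      rw [j027, add_zero] at this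
      exact this
    · have := h.t1.path' tr ok.Dh hφ rfl hb'
      rw [j127] at this
      simp only [Sc.up]
      rw [show i + (c.h + c.ℓ) = i + c.ℓ + c.h by ring]
      exact this
    · refine ha2.trans ?_
      have hm : ∀ ψ ≤ 27, J0 ψ ≤ max i j := by
        intro ψ hψ
        rw [h.j0 ψ hψ]
        have := (off_le hDc hψ).1
        rcases hDc with rfl | rfl | rfl
        · norm_num at this; exact le_max_of_le_right (by nlinarith)
        · norm_num at this; exact le_max_of_le_right (by nlinarith)
        · norm_num at this; exact le_max_of_le_left (by nlinarith)
      exact max_le (hm _ (by omega)) (hm _ (by omega))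
    · refine le_trans ?_ hb2
      have hm : ∀ ψ ≤ 27, min i j + c.ℓ ≤ J1 ψ := by
        intro ψ hψ
        rw [h.j1 ψ hψ]
        have := (off_le hDc hψ).2
        rcases hDc with rfl | rfl | rfl
        · norm_num at this; have := min_le_left i j; nlinarith
        · norm_num at this; have := min_le_right i j; nlinarith
        · norm_num at this; have := min_le_right i j; nlinarith
      have := le_min (hm (φ + 1) (by omega)) (hm φ (by omega))
      simp only [Sc.up]
      linarith
  · intro v hv hs y' hy' hyp
    rw [msgM_b _ b hb m0 m1 mb hmb] at hv
    split_ifs at hv with hc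
    obtain ⟨c1, c2, c3⟩ := hc
    obtain rfl : b = true := by
      cases b
      · change sd (X0 0).s.pos = 1 at hs
        rw [hs] at hb; simp at hb
      · rfl
    simp only [if_true] at hmb
    subst hmb
    obtain ⟨v6, hv6⟩ := Option.isSome_iff_exists.1 c1
    obtain ⟨j', D', J0', J1', X0', X1', m0', m1', h', hi', rfl⟩ := exists_pair H t _ y' hy'
    have hp' : (X0' 0).s.pos = flipP (X0 0).s.pos := by
      rw [h'.posEnd, h.posEnd] at hyp
      apply nextP_inj
      rw [hyp]; rfl
    have hD' := h'.D0 (by rw [hp']; exact c3)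
    have hD := h.D0 c3
    rw [hD', mul_zero, add_zero] at hi'
    rw [hD, mul_zero, add_zero] at hi
    subst hi
    simp only [Sc.up] at hi'
    have j17 : J1 7 = i + c.ℓ * 2 := by rw [h.j1 7 (by omega)]; simp [off]; ring
    have a7 := (h'.at6 false (Or.inr rfl))
    simp only [Bool.false_eq_true, if_false] at a7
    obtain ⟨u, a, u1, u2, u3, u4⟩ := (h.t1.link 6 (by omega)).adj v6 hv6
      (by rw [h.t1.sng.pos 6 (by omega)]; rfl) (X0' 7)
      (by
        rw [show t + 6 * c.τ + c.τ = t + 7 * c.τ by ring]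
        rw [← a7.1]; congr 1; rw [j17, ← hi']; ring)
      (by rw [a7.2, h.t1.sng.pos 7 (by omega)]; rfl)
    refine ⟨u, a, by omega, ?_, ?_, ?_⟩
    · simp only [Sc.up]; omega
    · have := h.t1.path' tr ok.Dh (by omega) rfl u3
      rw [j127] at this
      simp only [Sc.up]
      rw [show i + (c.h + c.ℓ) = i + c.ℓ + c.h by ring]
      exact this
    · have := h'.t0.path' tr ok.D0 (φ := 6) (by omega) ?_ u4
      · rw [h'.j0 27 (by omega), hD', ← hi'] at this
        simpa [off, Sc.up] using this
      · rw [h'.j0 7 (by omega), j17, ← hi']; simp [off]; ring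

theorem Hist.not_hlt (H : Hist M A c P η) {t : ℕ} {i : ℤ} {y : Q L (up M A).Γ}
    (hy : dec M A c η (t + 27 * c.τ) i = some y) : M.hlt (A.run A.cur M.u0).2 = false := by
  obtain ⟨j, D, J0, J1, X0, X1, m0, m1, h, hi, rfl⟩ := exists_pair H t i y hy
  rw [← h.ch.hltVal (by omega)]
  obtain ⟨_, a, e⟩ := h.ch.act1_eq (φ := 2) (by omega) (by omega)
  simp only [act1] at a
  split_ifs at a with h1
  simpa using h1

end SimCA
end

section
namespace SimCA

variable {L : Type} {M : Mealy L} {A : Alg L}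

def drO {Γ : Type} (o : Option (Q L Γ)) : Option Dir := o.map dirQ

def isL {Γ : Type} (l c : Option (Q L Γ)) : Bool :=
  decide (drO l = some .p) && !decide (drO c = some .m)
def isC {Γ : Type} (c : Option (Q L Γ)) : Bool := decide (drO c = some .z)
def isR {Γ : Type} (c r : Option (Q L Γ)) : Bool :=
  decide (drO r = some .m) && !decide (drO c = some .p)

/-- message seen by a particle -/
def msg {Γ : Type} (l : Option (Q L Γ)) (x : Q L Γ) (r : Option (Q L Γ)) : Option (V L) :=
  if mvP x.pos then none else
    (if sd x.pos = 1 then r else l).bind fun z =>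
      if z.pos = flipP x.pos then some z.w.o else none

variable (M A) in
def rule (l c r : Option (Q L A.Γ)) : Option (Q L A.Γ) :=
  match isL l c, isC c, isR c r with
  | true, false, false => l.bind fun x => step M A x none
  | false, true, false => c.bind fun x => step M A x (msg l x r)
  | false, false, true => r.bind fun x => step M A x none
  | _, _, _ => none

variable (M A) in
def Orb (η : ℕ → ℤ → Option (Q L A.Γ)) : Prop :=
  ∀ t i, η (t + 1) i = rule M A (η t (i - 1)) (η t i) (η t (i + 1))

variable {η : ℕ → ℤ → Option (Q L A.Γ)}

def Par (η : ℕ → ℤ → Option (Q L A.Γ)) (t : ℕ) (j i : ℤ) : Prop :=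
  η (t + 1) i ≠ none ∧
    ((j = i - 1 ∧ isL (η t (i - 1)) (η t i) = true) ∨ (j = i ∧ isC (η t i) = true) ∨
      (j = i + 1 ∧ isR (η t i) (η t (i + 1)) = true))

inductive Path (η : ℕ → ℤ → Option (Q L A.Γ)) : ℕ → ℤ → ℕ → ℤ → Prop
  | refl {t i} : η t i ≠ none → Path η t i t i
  | step {u a t j i} : Path η u a t j → Par η t j i → Path η u a (t + 1) i

theorem Orb.cases (H : Orb M A η) {t : ℕ} {i : ℤ} (h : η (t + 1) i ≠ none) :
    (isL (η t (i - 1)) (η t i) = true ∧ isC (η t i) = false ∧ isR (η t i) (η t (i + 1)) = false) ∨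
    (isL (η t (i - 1)) (η t i) = false ∧ isC (η t i) = true ∧ isR (η t i) (η t (i + 1)) = false) ∨
    (isL (η t (i - 1)) (η t i) = false ∧ isC (η t i) = false ∧ isR (η t i) (η t (i + 1)) = true) := by
  rw [H t i] at h
  unfold rule at h
  split at h <;> simp_all

theorem drO_some {Γ : Type} {o : Option (Q L Γ)} {d : Dir} (h : drO o = some d) :
    ∃ x, o = some x ∧ dirQ x = d := by
  cases o <;> simp_all [drO]

theorem Par.unique (H : Orb M A η) {t : ℕ} {j j' i : ℤ} (h : Par η t j i) (h' : Par η t j' i) :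
    j = j' := by
  have hc := H.cases h.1
  obtain ⟨-, h⟩ := h
  obtain ⟨-, h'⟩ := h'
  rcases h with ⟨rfl, e⟩ | ⟨rfl, e⟩ | ⟨rfl, e⟩ <;>
  rcases h' with ⟨rfl, e'⟩ | ⟨rfl, e'⟩ | ⟨rfl, e'⟩ <;> simp_all

theorem Par.exists (H : Orb M A η) {t : ℕ} {i : ℤ} (h : η (t + 1) i ≠ none) :
    ∃ j, Par η t j i := by
  rcases H.cases h with h1 | h1 | h1
  · exact ⟨i - 1, h, Or.inl ⟨rfl, h1.1⟩⟩
  · exact ⟨i, h, Or.inr (Or.inl ⟨rfl, h1.2.1⟩)⟩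
  · exact ⟨i + 1, h, Or.inr (Or.inr ⟨rfl, h1.2.2⟩)⟩

theorem Par.src {t : ℕ} {j i : ℤ} (h : Par η t j i) : ∃ x, η t j = some x ∧
    i = j + (dirQ x).toInt := by
  obtain ⟨-, h⟩ := h
  rcases h with ⟨rfl, e⟩ | ⟨rfl, e⟩ | ⟨rfl, e⟩
  · simp only [isL, Bool.and_eq_true, decide_eq_true_eq] at e
    obtain ⟨x, h1, h2⟩ := drO_some e.1
    exact ⟨x, h1, by simp [h2, Dir.toInt]⟩
  · simp only [isC, decide_eq_true_eq] at e
    obtain ⟨x, h1, h2⟩ := drO_some e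
    exact ⟨x, h1, by simp [h2, Dir.toInt]⟩
  · simp only [isR, Bool.and_eq_true, decide_eq_true_eq] at e
    obtain ⟨x, h1, h2⟩ := drO_some e.1
    exact ⟨x, h1, by simp [h2, Dir.toInt]⟩

theorem Par.mono (H : Orb M A η) {t : ℕ} {j j' i i' : ℤ} (h : Par η t j i) (h' : Par η t j' i')
    (hj : j < j') : i < i' := by
  by_contra hc
  have hne : i ≠ i' := by
    rintro rfl
    exact hj.ne (h.unique H h')
  obtain ⟨x, h1, h2⟩ := h.src
  obtain ⟨x', h1', h2'⟩ := h'.src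
  have d1 := dir_cases (dirQ x)
  have d2 := dir_cases (dirQ x')
  -- the only possibility is a swap
  have e : j' = j + 1 ∧ i = j + 1 ∧ i' = j := by omega
  obtain ⟨rfl, rfl, rfl⟩ := e
  obtain ⟨-, h⟩ := h
  obtain ⟨-, h'⟩ := h'
  rcases h with ⟨e, h⟩ | ⟨e, h⟩ | ⟨e, h⟩
  · rcases h' with ⟨e', h'⟩ | ⟨e', h'⟩ | ⟨e', h'⟩
    · omega
    · omega
    · simp [isL, isR] at h h'
      exact h.2 h'.1
  · omega
  · omega

namespace Path
variable {u v t : ℕ} {a b i j : ℤ}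

theorem le (h : Path η u a t i) : u ≤ t := by
  induction h with
  | refl => exact le_rfl
  | step _ _ ih => omega

theorem alive (h : Path η u a t i) : η t i ≠ none := by
  cases h with
  | refl h => exact h
  | step _ h => exact h.1

theorem alive0 (h : Path η u a t i) : η u a ≠ none := by
  induction h with
  | refl h => exact h
  | step _ _ ih => exact ih

theorem speed (h : Path η u a t i) : |i - a| ≤ (t : ℤ) - u := by
  induction h with
  | refl => simp
  | step _ hp ih =>
    obtain ⟨x, -, h2⟩ := hp.src
    have := dir_cases (dirQ x)
    rw [abs_le] at *
    push_cast
    omega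

theorem trans {t' : ℕ} {i' : ℤ} (h : Path η u a t i) (h' : Path η t i t' i') :
    Path η u a t' i' := by
  induction h' with
  | refl => exact h
  | step _ hp ih => exact .step ih hp

theorem isTrans : PTrans (Path η) := fun _ _ _ _ _ _ h h' => h.trans h'

theorem eq_of_refl (h : Path η t a t i) : a = i := by
  cases h with
  | refl => rfl
  | step h1 h2 => have := h1.le; omega

theorem back (H : Orb M A η) (h : Path η u a t i) (h' : Path η u b t i) : a = b := by
  induction h with
  | refl => exact h'.eq_of_refl.symm
  | step h1 h2 ih =>
    cases h' with
    | refl => have := h1.le; omega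
    | step h3 h4 =>
      obtain rfl := h2.unique H h4
      exact ih h3

theorem exists_back (H : Orb M A η) (h : η t i ≠ none) (hu : u ≤ t) : ∃ a, Path η u a t i := by
  induction t generalizing i with
  | zero => obtain rfl : u = 0 := by omega
            exact ⟨i, .refl h⟩
  | succ t ih =>
    by_cases hu' : u = t + 1
    · subst hu'; exact ⟨i, .refl h⟩
    · obtain ⟨j, hj⟩ := Par.exists H h
      obtain ⟨x, hx, -⟩ := hj.src
      obtain ⟨a, ha⟩ := ih (i := j) (by rw [hx]; simp) (by omega)
      exact ⟨a, .step ha hj⟩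

theorem interp (h : Path η u a t i) (h1 : u ≤ v) (h2 : v ≤ t) :
    ∃ b, Path η u a v b ∧ Path η v b t i := by
  induction h with
  | refl ha => obtain rfl : v = _ := le_antisymm h2 h1
               exact ⟨_, .refl ha, .refl ha⟩
  | @step t j i hp hq ih =>
    by_cases hv : v = t + 1
    · subst hv; exact ⟨_, .step hp hq, .refl hq.1⟩
    · obtain ⟨b, h3, h4⟩ := ih (by omega)
      exact ⟨b, h3, .step h4 hq⟩

theorem mono (H : Orb M A η) (h : Path η u a t i) (h' : Path η u b t j) (hab : a < b) : i < j := by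
  induction h generalizing j with
  | refl => rw [← h'.eq_of_refl]; exact hab
  | step h1 h2 ih =>
    cases h' with
    | refl => have := h1.le; omega
    | step h3 h4 => exact h2.mono H h4 (ih h3)

theorem fwd (H : Orb M A η) (h : Path η u a t i) (h' : Path η u a t j) : i = j := by
  induction h generalizing j with
  | refl => exact h'.eq_of_refl
  | step h1 h2 ih =>
    cases h' with
    | refl => have := h1.le; omega
    | step h3 h4 =>
      obtain rfl := ih h3
      obtain ⟨x, e1, e2⟩ := h2.src
      obtain ⟨x', e3, e4⟩ := h4.src
      rw [e1, Option.some.injEq] at e3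
      subst e3
      omega

theorem lt_of (H : Orb M A η) (h : Path η u a t i) (h' : Path η u b t j) (hij : i < j) :
    a < b := by
  rcases lt_trichotomy a b with h1 | rfl | h1
  · exact h1
  · have := h.fwd H h'; omega
  · have := h'.mono H h h1; omega

theorem le_of (H : Orb M A η) (h : Path η u a t i) (h' : Path η u b t j) (hij : i ≤ j) :
    a ≤ b := by
  rcases hij.lt_or_eq with h1 | rfl
  · exact (h.lt_of H h' h1).le
  · exact (h.back H h').le

theorem mono_le (H : Orb M A η) (h : Path η u a t i) (h' : Path η u b t j) (hab : a ≤ b) :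
    i ≤ j := by
  rcases hab.lt_or_eq with h1 | rfl
  · exact (h.mono H h' h1).le
  · exact (h.fwd H h').le

/-- cancel a common initial segment -/
theorem cancel (H : Orb M A η) {s' : ℕ} {r' : ℤ} (h : Path η u a t i) (h' : Path η u a s' r')
    (hts : t ≤ s') : Path η t i s' r' := by
  obtain ⟨b, h1, h2⟩ := h'.interp h.le hts
  rw [h.fwd H h1]; exact h2

end Path

theorem msg_none {Γ : Type} {l r : Option (Q L Γ)} {x : Q L Γ} (h : mvP x.pos = true) :
    msg l x r = none := by simp [msg, h]

theorem mv_of_dir {Γ : Type} {x : Q L Γ} {d : Dir} (h : dirQ x = d) (hd : d ≠ .z) :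
    mvP x.pos = true := by
  by_contra hc
  simp [dirQ, dirW, hc] at h
  exact hd h.symm

theorem Par.step (H : Orb M A η) {t : ℕ} {j i : ℤ} (h : Par η t j i) : ∃ x y,
    η t j = some x ∧ i = j + (dirQ x).toInt ∧ η (t + 1) i = some y ∧
      step M A x (msg (η t (j - 1)) x (η t (j + 1))) = some y := by
  obtain ⟨x, h1, h2⟩ := h.src
  obtain ⟨y, hy⟩ := Option.ne_none_iff_exists'.1 h.1
  refine ⟨x, y, h1, h2, hy, ?_⟩
  have hc := H.cases h.1
  have e := H t i
  rw [hy] at e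
  obtain ⟨-, h⟩ := h
  rcases h with ⟨rfl, e'⟩ | ⟨rfl, e'⟩ | ⟨rfl, e'⟩
  · have hp : dirQ x = .p := by
      simp [isL, drO, h1] at e'; exact e'.1
    rw [msg_none (mv_of_dir hp (by simp))]
    rw [e'] at hc
    simp only [true_and, Bool.true_eq_false, false_and, or_false] at hc
    simp only [rule, e', hc.1, hc.2] at e
    rw [h1] at e
    exact e.symm
  · rw [e'] at hc
    simp only [true_and, Bool.true_eq_false, false_and, and_false, or_false, false_or] at hc
    simp only [rule, e', hc.1, hc.2] at e
    rw [h1] at e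
    exact e.symm
  · have hp : dirQ x = .m := by
      simp [isR, drO, h1] at e'; exact e'.1
    rw [msg_none (mv_of_dir hp (by simp))]
    rw [e'] at hc
    simp only [true_and, Bool.true_eq_false, false_and, and_false, or_false, false_or] at hc
    simp only [rule, e', hc.1, hc.2] at e
    rw [h1] at e
    exact e.symm

theorem msg_some {Γ : Type} {l r : Option (Q L Γ)} {x : Q L Γ} {v : V L}
    (h : msg l x r = some v) : mvP x.pos = false ∧ ∃ z,
      (if sd x.pos = 1 then r else l) = some z ∧ z.pos = flipP x.pos ∧ v = z.w.o := by
  unfold msg at h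
  split_ifs at h with h1 h2
  all_goals
    refine ⟨by simpa using h1, ?_⟩
    rw [Option.bind_eq_some_iff] at h
    obtain ⟨z, h3, h4⟩ := h
    split_ifs at h4 with h5
    simp only [Option.some.injEq] at h4
    exact ⟨z, by simp [h2, h3], h5, h4.symm⟩

theorem Orb.hist (H : Orb M A η) : Hist M A (scl 0) (Path η) η := by
  intro t i y hy
  change η (t + 1) i = some y at hy
  obtain ⟨j, hj⟩ := Par.exists H (t := t) (i := i) (by rw [hy]; simp)
  obtain ⟨x, y', h1, h2, h3, h4⟩ := hj.step H
  rw [hy, Option.some.injEq] at h3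
  subst h3
  have hp : Path η t j (t + 1) i := .step (.refl (by rw [h1]; simp)) hj
  have hside : (if sd x.pos = 1 then η t (j + 1) else η t (j - 1)) = η t (j + 1 * sd x.pos) := by
    rcases sd_cases x.pos with e | e <;> rw [e] <;> norm_num
    rfl
  refine ⟨j, x, _, h1, by simpa [scl] using h2, h4, ?_, ?_, ?_, ?_, ?_⟩
  · intro v hv
    obtain ⟨e1, z, e2, e3, e4⟩ := msg_some hv
    rw [hside] at e2
    exact ⟨e1, z, e2, e3, e4⟩
  · intro hn hm z hz hzp
    exfalso
    change η t (j + 1 * sd x.pos) = some z at hz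
    unfold msg at hn
    rw [hm, hside, hz] at hn
    simp [hzp] at hn
  · rintro d rfl
    simpa [scl] using hp
  · intro u hu1 hu2
    change u ≤ t + 1 at hu2
    by_cases hu : u = t
    · subst hu
      exact ⟨j, j, hp, by simpa [scl] using hp, le_max_right _ _, by simp [scl]⟩
    · obtain rfl : u = t + 1 := by omega
      have : Path η (t + 1) i (t + 1) i := .refl hj.1
      exact ⟨i, i, this, by simpa [scl] using this, le_max_left _ _, by simp [scl]⟩
  · intro v hv hs y' hy' hyp
    refine ⟨t + 1, i, by omega, by simp [scl], ?_, ?_⟩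
    · have : Path η (t + 1) i (t + 1) i := .refl hj.1
      simpa [scl] using this
    · change η (t + 1) (i + 1) = some y' at hy'
      exact .refl (by rw [hy']; simp)

end SimCA
end

section
namespace SimCA

variable {L : Type} {M : Mealy L} {A : Alg L} {c : Sc} {P : ℕ → ℤ → ℕ → ℤ → Prop}
variable {η : ℕ → ℤ → Option (Q L A.Γ)}

theorem Chain.seg19 {n : ℕ} {X0 X1 : ℕ → Q L A.Γ} {m0 m1 : ℕ → Option (V L)}
    (h : Chain M A n X0 X1 m0 m1) (hn : 19 ≤ n) :
    (X0 19).w.d = dirW (X0 0).s.pos (X0 0).s.w ∧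
    (X1 19).w.d = dirW (X0 0).s.pos (X0 0).s.w := by
  have hal := h.alive17 (by omega)
  rw [h.act_dead17 (by omega), eq_comm, Option.isSome_iff_exists] at hal
  obtain ⟨w1, hw1⟩ := hal
  obtain ⟨b1, b2, x, b3⟩ := h.seg17 (by omega)
  have hf := h.act_dead17 (by omega)
  unfold ex at b3
  rw [hw1] at b3
  simp only [Prod.mk.injEq] at b3
  obtain ⟨b3, b4⟩ := b3
  obtain ⟨_, a17, e17⟩ := h.act0_eq (φ := 17) (by omega) (by omega)
  obtain ⟨_, a18, e18⟩ := h.act0_eq (φ := 18) (by omega) (by omega)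
  obtain ⟨_, c18, f18⟩ := h.act1_eq (φ := 18) (by omega) (by omega)
  rw [h.c1 18 (by omega) rfl] at c18
  simp only [act0, act1, Option.some.injEq, hf, if_true, Option.getD_some] at a17 a18 c18
  subst a17 a18 c18
  norm_num at e17 e18 f18
  have d18 : (X0 18).w.d = dirW (X0 0).s.pos (X0 0).s.w := by simp [e17, fin, b3]
  have od18 : (X0 18).w.o.dr = dirW (X0 0).s.pos (X0 0).s.w := by simp [e17, fin, b3]
  exact ⟨by simp [e18, fin, d18], by simp [f18, fin, od18]⟩

theorem Sng.d22 {n : ℕ} {b : Bool} {X : ℕ → Q L A.Γ} {m : ℕ → Option (V L)}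
    (h : Sng M A b n X m) (hn : 22 ≤ n) : (X 22).w.d = (X 19).w.d := by
  have key : ∀ φ, 19 ≤ φ → φ < 22 → (X (φ + 1)).w.d = (X φ).w.d := by
    intro φ h1 h2
    cases b
    · obtain ⟨_, a, e⟩ := h.act_eq0 (φ := φ) (by omega) (by omega)
      interval_cases φ <;> simp only [act0, Option.some.injEq] at a <;> subst a <;> simp at e <;>
        simp only [e, fin] <;> split_ifs <;> rfl
    · obtain ⟨_, a, e⟩ := h.act_eq1 (φ := φ) (by omega) (by omega)
      interval_cases φ <;> simp only [act1, Option.some.injEq] at a <;> subst a <;> simp at e <;>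
        simp [e, fin]
  rw [key 21 (by omega) (by omega), key 20 (by omega) (by omega), key 19 (by omega) (by omega)]

def bit (b : Bool) : ℤ := if b then 1 else 0

/-- the composite particle seen from one of its constituents -/
theorem Tr.mac (H : Hist M A c P η) {t n : ℕ} {b : Bool} {J : ℕ → ℤ} {X : ℕ → Q L A.Γ}
    {m : ℕ → Option (V L)} (T : Tr M A c P η t b n J X m) (hn : 1 ≤ n) :
    ∃ Y, dec M A c η t (J 0 - bit b * c.ℓ) = some Y ∧
      (22 ≤ n → (X 22).w.d = dirQ Y) := by
  obtain ⟨z, hz1, hz2, hz3⟩ := T.contact (φ := 0) (by omega) (by omega) rfl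
  have v0 := T.val 0 (by omega)
  simp only [zero_mul, add_zero] at hz1 v0
  have hdec : ∃ Y, dec M A c η t (J 0 - bit b * c.ℓ) = some Y := by
    cases b
    · refine ⟨_, dec_eq (by simpa [bit] using v0) (by simpa [bit] using hz1) T.sng.p hz2⟩
    · refine ⟨_, dec_eq (x0 := z) (x1 := X 0) ?_ (by simpa [bit] using v0) hz2 T.sng.p⟩
      rw [← hz1]; congr 1; simp [bit]; ring
  obtain ⟨Y, hY⟩ := hdec
  refine ⟨Y, hY, fun h22 => ?_⟩
  have a := T.J_eq
  obtain ⟨z1, g1, g2, g3⟩ := T.contact (φ := 21) (by omega) (by omega) rfl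
  obtain ⟨J', X', m', T', e', f'⟩ := exists_tr H t (!b) 21 _ z1 g1 g2
  have a' := T'.J_eq
  have hJ : ∀ φ ≤ 21, ctN φ = true → J' φ = J φ + c.ℓ * (if b then -1 else 1) := by
    intro φ h1 h2
    have i1 := a φ (by omega) (by omega)
    have i2 := a 21 (by omega) (by omega)
    have i3 := a' φ (by omega) (by omega)
    have i4 := a' 21 (by omega) (by omega)
    have o21 : ∀ b D, off b D 21 = 0 := by intro b D; simp [off]
    rw [o21] at i2 i4
    have oφ : ∀ b D, off b D φ = 0 := by
      intro b D
      revert h2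
      interval_cases φ <;> simp [ctN, mvN, exN, off]
    rw [oφ] at i1 i3
    rw [e'] at i4
    linarith
  have c1 : ∀ φ < 21, ctN φ = true → m φ = some (X' φ).w.o := by
    intro φ h2 h3
    obtain ⟨z, k1, k2, k3⟩ := T.contact (φ := φ) (by omega) (by omega) h3
    have h4 := T'.val φ h2.le
    rw [hJ φ h2.le h3, k1, Option.some.injEq] at h4
    rw [k3, h4]
  have c2 : ∀ φ < 21, ctN φ = true → m' φ = some (X φ).w.o := by
    intro φ h2 h3
    obtain ⟨z, k1, k2, k3⟩ := T'.contact (φ := φ) (by omega) (by omega) h3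
    have h4 := T.val φ (by omega)
    rw [hJ φ h2.le h3, show J φ + c.ℓ * (if b = true then -1 else 1) +
      c.ℓ * (if (!b) = true then -1 else 1) = J φ by cases b <;> simp, h4,
      Option.some.injEq] at k1
    rw [k3, k1]
  have hJ0 := hJ 0 (by omega) rfl
  have w0 := T'.val 0 (by omega)
  simp only [zero_mul, add_zero] at w0
  rw [T.sng.d22 h22]
  cases b
  · have CH : Chain M A 21 X X' m m' := ⟨(T.sng.mono (by omega)).h, T'.sng.h, T.sng.p, T'.sng.p,
      c1, c2⟩
    rw [(CH.seg19 (by omega)).1]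
    have := dec_eq (M := M) (η := η) (c := c) (s := t) (r := J 0 - bit false * c.ℓ) (x0 := X 0)
      (x1 := X' 0) (by simpa [bit] using v0)
      (by rw [← w0, hJ0]; simp [bit]) T.sng.p T'.sng.p
    rw [hY, Option.some.injEq] at this
    rw [this]; rfl
  · have CH : Chain M A 21 X' X m' m := ⟨T'.sng.h, (T.sng.mono (by omega)).h, T'.sng.p, T.sng.p,
      c2, c1⟩
    rw [(CH.seg19 (by omega)).2]
    have := dec_eq (M := M) (η := η) (c := c) (s := t) (r := J 0 - bit true * c.ℓ) (x0 := X' 0)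
      (x1 := X 0) (by rw [← w0, hJ0]; congr 1; simp [bit]; ring)
      (by simpa [bit] using v0) T'.sng.p T.sng.p
    rw [hY, Option.some.injEq] at this
    rw [this]; rfl

/-- the sub-slot relation between a constituent and its composite particle -/
structure Slot (M : Mealy L) (A : Alg L) (c : Sc) (η : ℕ → ℤ → Option (Q L A.Γ))
    (s' : ℕ) (r' : ℤ) (y : Q L A.Γ) (s : ℕ) (r : ℤ) (Y : Q L (up M A).Γ) (b : Bool) (φ : ℕ) :
    Prop where
  hy : η s' r' = some y
  hY : dec M A c η s r = some Y
  h1 : 1 ≤ φ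
  h2 : φ ≤ 27
  ht : s' = s + φ * c.τ
  hr : r' = r + c.ℓ * (bit b + off b (dirQ Y).toInt φ)
  hd : (dirQ y).toInt = off b (dirQ Y).toInt (φ + 1) - off b (dirQ Y).toInt φ

theorem exists_slot (H : Hist M A c P η) {s' : ℕ} {r' : ℤ} {y : Q L A.Γ}
    (hy : η s' r' = some y) (hs : 27 * c.τ ≤ s') :
    ∃ s r Y b φ, Slot M A c η s' r' y s r Y b φ := by
  obtain ⟨b, φ, h1, h2, hp⟩ : ∃ b φ, 1 ≤ φ ∧ φ ≤ 27 ∧ y.pos = (b, ph φ) := by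
    obtain ⟨b, p⟩ := y.pos
    by_cases h0 : p = 0
    · exact ⟨b, 27, by omega, by omega, by subst h0; rfl⟩
    · refine ⟨b, p.1, ?_, by omega, ?_⟩
      · by_contra hc
        apply h0; ext; simp; omega
      · have : ph p.1 = p := by ext; rw [ph_val p.2]
        rw [this]
  obtain ⟨s, rfl⟩ : ∃ s, s' = s + φ * c.τ := ⟨s' - φ * c.τ, by
    have : φ * c.τ ≤ 27 * c.τ := Nat.mul_le_mul_right _ h2
    omega⟩
  obtain ⟨J, X, m, T, rfl, rfl⟩ := exists_tr H s b φ r' y hy hp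
  obtain ⟨Y, hY, hd⟩ := T.mac H h1
  have ho : ∀ ψ, φ ≤ ψ → ψ ≤ φ + 1 → off b (X 22).w.d.toInt ψ = off b (dirQ Y).toInt ψ := by
    intro ψ g1 g2
    by_cases h22 : 22 ≤ φ
    · rw [hd h22]
    · have : ψ ≤ 22 := by omega
      simp only [off]
      split_ifs <;> first | rfl | omega
  refine ⟨s, J 0 - bit b * c.ℓ, Y, b, φ, hy, hY, h1, h2, rfl, ?_, ?_⟩
  · rw [T.J_eq φ le_rfl h2, ho φ le_rfl (by omega)]; ring
  · by_cases h27 : φ = 27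
    · subst h27
      rw [dirQ_nm]
      · simp [off]
      · rw [hp]; rfl
    · rw [T.sng.dir le_rfl (by omega), ho φ le_rfl (by omega), ho (φ + 1) (by omega) le_rfl]

end SimCA
end

section
namespace SimCA

variable {L : Type} {M : Mealy L} {A : Alg L}

def algK (M : Mealy L) (A : Alg L) : ℕ → Alg L
  | 0 => A
  | k + 1 => up M (algK M A k)

noncomputable def etaK (M : Mealy L) (A : Alg L) (η : ℕ → ℤ → Option (Q L A.Γ)) :
    (k : ℕ) → ℕ → ℤ → Option (Q L (algK M A k).Γ)
  | 0 => η
  | k + 1 => dec M (algK M A k) (scl k) (etaK M A η k)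

variable {η : ℕ → ℤ → Option (Q L A.Γ)}

theorem Orb.histK (H : Orb M A η) (k : ℕ) :
    Hist M (algK M A k) (scl k) (Path η) (etaK M A η k) := by
  induction k with
  | zero => exact H.hist
  | succ k ih => exact ih.decode (scl_ok k) Path.isTrans

theorem member (k : ℕ) {s : ℕ} {r d : ℤ} {y : Q L (algK M A k).Γ}
    (h : etaK M A η k s r = some y) (hd : (scl k).D d) : η s (r + d) ≠ none := by
  induction k generalizing r d with
  | zero => obtain rfl : d = 0 := hd
            change η s r = some y at h
            rw [add_zero, h]; exact Option.some_ne_none _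
  | succ k ih =>
    obtain ⟨x0, x1, h0, h1, -⟩ := of_dec h
    rcases hd with hd | hd
    · exact ih h0 hd
    · have := ih h1 hd
      simpa using this

/-- tracing back several steps on one level -/
theorem trace (H : Orb M A η) (k n : ℕ) {s : ℕ} {r : ℤ} {y : Q L (algK M A k).Γ}
    (h : etaK M A η k (s + n * (scl k).τ) r = some y) :
    ∃ r' x, etaK M A η k s r' = some x ∧ nextP^[n] x.pos = y.pos ∧
      ∀ d, (scl k).D d → Path η s (r' + d) (s + n * (scl k).τ) (r + d) := by
  induction n generalizing r y with
  | zero =>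
    refine ⟨r, y, by simpa using h, rfl, fun d hd => ?_⟩
    have := member k h hd
    simp only [zero_mul, add_zero] at this ⊢
    exact .refl this
  | succ n ih =>
    rw [show s + (n + 1) * (scl k).τ = s + n * (scl k).τ + (scl k).τ by ring] at h ⊢
    obtain ⟨j, x, m, hl⟩ := H.histK k _ _ _ h
    obtain ⟨r', x', h1, h2, h3⟩ := ih hl.src
    refine ⟨r', x', h1, ?_, fun d hd => (h3 d hd).trans (hl.mem d hd)⟩
    rw [Function.iterate_succ_apply', h2, step_pos hl.stp]

theorem nextP_iter (n : ℕ) (p : Pos) : nextP^[n] p = (p.1, p.2 + ph n) := by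
  induction n with
  | zero => simp [ph]
  | succ n ih => rw [Function.iterate_succ_apply', ih]; simp [nextP, ph_succ, add_assoc]

theorem ph_zero {n : ℕ} (h : ph n = 0) : 27 ∣ n := by
  have := congrArg Fin.val h
  simp [ph] at this
  omega

theorem uniq (H : Orb M A η) (k : ℕ) {s s' : ℕ} {r r' d d' : ℤ} {x y : Q L (algK M A k).Γ}
    (h : etaK M A η k s r = some x) (h' : etaK M A η k s' r' = some y) (hd : (scl k).D d)
    (hd' : (scl k).D d') (hp : Path η s (r + d) s' (r' + d')) :
    d = d' ∧ ∃ n, s' = s + n * (scl k).τ ∧ nextP^[n] x.pos = y.pos := by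
  induction k generalizing s s' r r' d d' with
  | zero =>
    obtain rfl : d = 0 := hd
    obtain rfl : d' = 0 := hd'
    refine ⟨rfl, s' - s, ?_, ?_⟩
    · have := hp.le; simp [scl]; omega
    · obtain ⟨n, rfl⟩ := Nat.exists_eq_add_of_le hp.le
      obtain ⟨r1, x1, h1, h2, h3⟩ := trace H 0 n (s := s) (r := r') (by simpa [scl] using h')
      have := h3 0 rfl
      simp only [scl, mul_one] at this
      have e := this.back H hp
      simp only [add_zero] at e
      rw [e, h, Option.some.injEq] at h1
      rw [h1]; simpa using h2
  | succ k ih =>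
    have key : ∀ {s r d x}, etaK M A η (k + 1) s r = some x → (scl (k + 1)).D d → ∃ b e z,
        etaK M A η k s (r + bit b * (scl k).ℓ) = some z ∧ z.pos = (b, 0) ∧ (scl k).D e ∧
        d = bit b * (scl k).ℓ + e := by
      intro s r d x h hd
      obtain ⟨x0, x1, h0, h1, p0, p1, -⟩ := of_dec h
      rcases hd with hd | hd
      · exact ⟨false, d, x0, by simpa [bit] using h0, p0, hd, by simp [bit]⟩
      · exact ⟨true, d - (scl k).ℓ, x1, by simpa [bit] using h1, p1, hd, by simp [bit]⟩
    obtain ⟨b, e, z, g1, g2, g3, g4⟩ := key h hd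
    obtain ⟨b', e', z', g1', g2', g3', g4'⟩ := key h' hd'
    obtain ⟨rfl, n, hn, hpos⟩ := ih g1 g1' g3 g3' (by
      rw [g4, g4'] at hp
      simpa [add_assoc] using hp)
    rw [nextP_iter, g2, g2', Prod.mk.injEq, zero_add] at hpos
    obtain ⟨rfl, hpos⟩ := hpos
    obtain ⟨n', rfl⟩ := ph_zero hpos
    have hdd : d = d' := by rw [g4, g4']
    subst hdd
    have hs' : s' = s + n' * (scl (k + 1)).τ := by
      rw [hn]; simp [scl, Sc.up]; ring
    refine ⟨rfl, n', hs', ?_⟩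
    subst hs'
    obtain ⟨r1, x1, h1, h2, h3⟩ := trace H (k + 1) n' h'
    have e := (h3 d hd).back H hp
    have e' : r1 = r := by linarith
    rw [e', h, Option.some.injEq] at h1
    rw [h1]; exact h2

theorem D_bound (k : ℕ) {d : ℤ} (hd : (scl k).D d) : 0 ≤ d ∧ d ≤ (scl k).h := by
  induction k generalizing d with
  | zero => obtain rfl : d = 0 := hd
            simp [scl]
  | succ k ih =>
    have ok := scl_ok k
    have := ok.ℓ
    have := ok.h
    rcases hd with hd | hd
    · have := ih hd
      simp [scl, Sc.up]; omega
    · have := ih hd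
      simp [scl, Sc.up]; omega

/-- the last phase before a composite particle is formed -/
theorem last_phase (H : Orb M A η) (k : ℕ) {s : ℕ} {r : ℤ} {b : Bool} {y : Q L (algK M A k).Γ}
    (h : etaK M A η k s r = some y) (hp : y.pos = (b, 0)) (hs : (scl k).τ ≤ s) :
    ∃ t x m, s = t + (scl k).τ ∧
      Link M (algK M A k) (scl k) (Path η) (etaK M A η k) t r r x y m ∧ x.pos = (b, ph 26) ∧
      m.isSome := by
  obtain ⟨t, rfl⟩ : ∃ t, s = t + (scl k).τ := ⟨s - (scl k).τ, by omega⟩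
  obtain ⟨j, x, m, hl⟩ := H.histK k _ _ _ h
  have hx : x.pos = (b, ph 26) := nextP_inj (by rw [← step_pos hl.stp, hp]; rfl)
  have hm := hl.mov
  rw [dirQ_nm (by rw [hx]; rfl)] at hm
  simp only [mul_zero, add_zero] at hm
  subst hm
  refine ⟨t, x, m, rfl, hl, hx, ?_⟩
  have := hl.stp
  unfold step act at this
  rw [hx] at this
  by_contra hc
  have hc' : m.isNone = true := by simpa using hc
  rw [if_pos (by rw [hc']; rfl)] at this
  simp at this

/-- at the time of formation all alive sites inside a block are its members -/
theorem own (H : Orb M A η) (k : ℕ) {s : ℕ} {r i : ℤ} {y : Q L (algK M A k).Γ}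
    (h : etaK M A η k s r = some y) (hs : (scl k).τ ≤ s) (hi : η s i ≠ none) (h1 : r ≤ i)
    (h2 : i ≤ r + (scl k).h) : (scl k).D (i - r) := by
  induction k generalizing r with
  | zero => simp [scl] at h2 ⊢; omega
  | succ k ih =>
    obtain ⟨x0, x1, e0, e1, p0, p1, -⟩ := of_dec h
    have hτ : (scl k).τ ≤ s := by simp [scl, Sc.up] at hs; omega
    by_cases c0 : i ≤ r + (scl k).h
    · exact Or.inl (ih e0 hτ h1 c0)
    by_cases c1 : r + (scl k).ℓ ≤ i
    · right
      have := ih e1 hτ c1 (by simp [scl, Sc.up] at h2; linarith)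
      rwa [show i - r - (scl k).ℓ = i - (r + (scl k).ℓ) by ring]
    exfalso
    obtain ⟨t, x, m, rfl, hl, hx, hm⟩ := last_phase H k e0 p0 hτ
    obtain ⟨v, hv⟩ := Option.isSome_iff_exists.1 hm
    obtain ⟨u, a, u1, u2, u3, u4⟩ := hl.adj v hv (by rw [hx]; rfl) x1 e1 (by rw [p1, p0]; rfl)
    obtain ⟨a', ha'⟩ := Path.exists_back H hi u2
    have := u3.lt_of H ha' (by omega)
    have := ha'.lt_of H u4 (by omega)
    omega

/-- ownership at earlier times -/
theorem own_back (H : Orb M A η) (k : ℕ) {s u : ℕ} {r i a b : ℤ} {y : Q L (algK M A k).Γ}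
    (h : etaK M A η k s r = some y) (hs : 2 * (scl k).τ ≤ s) (hu : s ≤ u + (scl k).τ)
    (ha : Path η u a s r) (hb : Path η u b s (r + (scl k).h))
    (hi : η u i ≠ none) (h1 : a ≤ i) (h2 : i ≤ b) : ∃ d, (scl k).D d ∧ Path η u i s (r + d) := by
  obtain ⟨t, rfl⟩ : ∃ t, s = t + (scl k).τ := ⟨s - (scl k).τ, by omega⟩
  obtain ⟨j, x, m, hl⟩ := H.histK k _ _ _ h
  have m0 := hl.mem 0 (scl_ok k).D0
  have mh := hl.mem _ (scl_ok k).Dh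
  simp only [add_zero] at m0
  have htu : t ≤ u := by omega
  obtain ⟨a0, a1, a2⟩ := m0.interp htu ha.le
  obtain ⟨b0, b1, b2⟩ := mh.interp htu hb.le
  rw [a2.back H ha] at a1
  rw [b2.back H hb] at b1
  obtain ⟨i0, hi0⟩ := Path.exists_back H hi htu
  have k1 := a1.le_of H hi0 h1
  have k2 := hi0.le_of H b1 h2
  have hD := own H k hl.src (by omega) hi0.alive0 k1 k2
  have hp := hl.mem _ hD
  rw [show j + (i0 - j) = i0 by ring] at hp
  refine ⟨_, hD, hi0.cancel H hp (ha.le)⟩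

/-- extents of a block during its last phase -/
theorem extent (H : Orb M A η) (k : ℕ) {s u : ℕ} {r : ℤ} {y : Q L (algK M A (k + 1)).Γ}
    (h : etaK M A η (k + 1) s r = some y) (hs : (scl k).τ ≤ s) (hu : s ≤ u + (scl k).τ)
    (hu' : u ≤ s) : ∃ a b, Path η u a s r ∧ Path η u b s (r + (scl (k + 1)).h) ∧ a ≤ r ∧
      r + (scl (k + 1)).h ≤ b := by
  obtain ⟨x0, x1, e0, e1, p0, p1, -⟩ := of_dec h
  obtain ⟨t, x, m, e, hl, hx, hm⟩ := last_phase H k e0 p0 hs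
  obtain ⟨t', x', m', e', hl', hx', hm'⟩ := last_phase H k e1 p1 hs
  obtain rfl : t = t' := by omega
  subst e
  obtain ⟨a, -, g1, -, g2, -⟩ := hl.ext u (by omega) hu'
  obtain ⟨-, b, -, g3, -, g4⟩ := hl'.ext u (by omega) hu'
  refine ⟨a, b, g1, ?_, by simpa using g2, ?_⟩
  · rw [show r + (scl (k + 1)).h = r + (scl k).ℓ + (scl k).h by simp [scl, Sc.up]; ring]
    exact g3
  · simp at g4
    simp [scl, Sc.up]; linarith

theorem spacing (H : Orb M A η) (k : ℕ) {s s' : ℕ} {r r' : ℤ} {y y' : Q L (algK M A (k + 1)).Γ}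
    (h : etaK M A η (k + 1) s r = some y) (h' : etaK M A η (k + 1) s' r' = some y')
    (hs : 2 * (scl (k + 1)).τ ≤ s) (hss : s ≤ s') (hs' : s' ≤ s + (scl k).τ)
    (hr : |r - r'| ≤ (scl (k + 1)).h) : s = s' ∧ r = r' := by
  have hτ := (scl_ok k).τ
  have hττ : (scl (k + 1)).τ = 27 * (scl k).τ := rfl
  obtain ⟨a, b, a1, a2, a3, a4⟩ := extent H k h (u := s) (by omega) (by omega) (by omega)
  obtain ⟨a', b', a1', a2', a3', a4'⟩ := extent H k h' (u := s) (by omega) (by omega) (by omega)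
  have fin : ∀ d d', (scl (k + 1)).D d → (scl (k + 1)).D d' → Path η s (r + d) s' (r' + d') →
      s = s' ∧ r = r' := by
    intro d d' hd hd' hp
    obtain ⟨rfl, n, hn, -⟩ := uniq H (k + 1) h h' hd hd' hp
    have : n = 0 := by
      by_contra hc
      have : 1 * (scl (k + 1)).τ ≤ n * (scl (k + 1)).τ := Nat.mul_le_mul_right _ (by omega)
      omega
    subst this
    simp only [zero_mul, add_zero] at hn
    subst hn
    have := hp.eq_of_refl
    exact ⟨rfl, by linarith⟩
  have D0 := (scl_ok (k + 1)).D0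
  have := a1.eq_of_refl
  have := a2.eq_of_refl
  rw [abs_le] at hr
  by_cases hc : a' ≤ a
  · obtain ⟨d, hd, hp⟩ := own_back H (k + 1) h' (by omega) (by omega) a1' a2' a1.alive0 hc
      (by omega)
    exact fin 0 d D0 hd (by simpa [a1.eq_of_refl] using hp)
  · obtain ⟨d, hd, hp⟩ := own_back H (k + 1) h (by omega) (by omega) a1 a2 a1'.alive0 (i := a')
      (by omega) (by omega)
    exact fin d 0 hd D0 (hp.cancel H (by simpa using a1') hss)

end SimCA
end

section
namespace SimCA

variable {L : Type} {M : Mealy L} {A : Alg L} {η : ℕ → ℤ → Option (Q L A.Γ)}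

def cell (k : ℕ) (x : ℤ) : ℤ := (3 * x + (scl k).ℓ - 1) / (3 * (scl k).ℓ)

theorem cell_succ (k : ℕ) (x : ℤ) : cell (k + 1) x = (cell k x + 1) / 4 := by
  have h := (scl_ok k).ℓ
  unfold cell
  have e : (scl (k + 1)).ℓ = 4 * (scl k).ℓ := rfl
  rw [e, show (3 : ℤ) * (4 * (scl k).ℓ) = (3 * (scl k).ℓ) * 4 by ring,
    ← Int.ediv_ediv_of_nonneg (by omega)]
  congr 1
  rw [show 3 * x + 4 * (scl k).ℓ - 1 = 3 * x + (scl k).ℓ - 1 + 1 * (3 * (scl k).ℓ) by ring,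
    Int.add_mul_ediv_right _ _ (by omega)]

theorem cell_sub (k : ℕ) (x e : ℤ) : cell k (x - (scl k).ℓ * e) = cell k x - e := by
  have h := (scl_ok k).ℓ
  unfold cell
  rw [show 3 * (x - (scl k).ℓ * e) + (scl k).ℓ - 1 =
    3 * x + (scl k).ℓ - 1 + (-e) * (3 * (scl k).ℓ) by ring,
    Int.add_mul_ediv_right _ _ (by omega)]
  ring

variable (M A η) in
def Root : (k : ℕ) → ℕ → ℤ → ℕ → ℤ → Q L (algK M A k).Γ → Prop
  | 0, t, i, s, r, Y => t = s ∧ i = r ∧ η s r = some Y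
  | k + 1, t, i, s, r, Y => ∃ s' r' y b φ, Root k t i s' r' y ∧
      Slot M (algK M A k) (scl k) (etaK M A η k) s' r' y s r Y b φ

theorem Root.val : ∀ {k t i s r} {Y : Q L (algK M A k).Γ}, Root M A η k t i s r Y →
    etaK M A η k s r = some Y
  | 0, _, _, _, _, _, h => h.2.2
  | _ + 1, _, _, _, _, _, ⟨_, _, _, _, _, _, h⟩ => h.hY

def cov (b : Bool) (D γ : ℤ) (φ : ℕ) : Prop :=
  γ = bit b + off b D φ ∨ γ = bit b + off b D (φ + 1)

instance (b : Bool) (D γ : ℤ) (φ : ℕ) : Decidable (cov b D γ φ) :=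
  inferInstanceAs (Decidable (_ ∨ _))

theorem cov_cell {b : Bool} {D γ : ℤ} {φ : ℕ} (hD : D = -1 ∨ D = 0 ∨ D = 1) (h : φ ≤ 27)
    (hc : cov b D γ φ) : (γ + 1) / 4 = 0 ∨ (γ + 1) / 4 = D := by
  have key : ∀ ψ ≤ 28, (bit b + off b D ψ + 1) / 4 = 0 ∨ (bit b + off b D ψ + 1) / 4 = D := by
    intro ψ hψ
    unfold off bit
    rcases hD with rfl | rfl | rfl <;> cases b <;> interval_cases ψ <;> simp
  rcases hc with rfl | rfl
  · exact key φ (by omega)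
  · exact key (φ + 1) (by omega)

theorem cov_range {b : Bool} {D γ : ℤ} {φ : ℕ} (hD : D = -1 ∨ D = 0 ∨ D = 1)
    (hc : cov b D γ φ) : -6 ≤ γ ∧ γ ≤ 6 := by
  have key : ∀ ψ, -6 ≤ bit b + off b D ψ ∧ bit b + off b D ψ ≤ 6 := by
    intro ψ
    unfold off bit
    split_ifs <;> rcases hD with rfl | rfl | rfl <;> omega
  rcases hc with rfl | rfl
  · exact key φ
  · exact key (φ + 1)

theorem Slot.cov {c : Sc} {s' r' y s r Y b φ} (h : Slot M A c η s' r' y s r Y b φ) {γ : ℤ}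
    (hg : γ - (bit b + off b (dirQ Y).toInt φ) = 0 ∨
      γ - (bit b + off b (dirQ Y).toInt φ) = (dirQ y).toInt) :
    cov b (dirQ Y).toInt γ φ := by
  have := h.hd
  rcases hg with h | h
  · left; linarith
  · right; linarith

def slots (D γ : ℤ) : Finset (Bool × ℕ) :=
  ((Finset.univ : Finset Bool) ×ˢ Finset.Icc 1 27).filter fun p => cov p.1 D γ p.2

theorem slots_card {D γ : ℤ} (hD : D = -1 ∨ D = 0 ∨ D = 1) : (slots D γ).card ≤ 26 := by
  by_cases hγ : -6 ≤ γ ∧ γ ≤ 6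
  · obtain ⟨h1, h2⟩ := hγ
    rcases hD with rfl | rfl | rfl <;> interval_cases γ <;> decide
  · have : slots D γ = ∅ := by
      unfold slots
      rw [Finset.filter_eq_empty_iff]
      intro p _ hc
      exact hγ (cov_range hD hc)
    rw [this]; simp

theorem Root.cell {k t i s r} {Y : Q L (algK M A k).Γ} (h : Root M A η k t i s r Y) :
    cell k (i - r) = 0 ∨ cell k (i - r) = (dirQ Y).toInt := by
  induction k generalizing s r with
  | zero =>
    obtain ⟨rfl, rfl, -⟩ := h
    left; simp [SimCA.cell, scl]
  | succ k ih =>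
    obtain ⟨s', r', y, b, φ, h1, h2⟩ := h
    rw [cell_succ]
    apply cov_cell (dir_cases _) h2.h2 (b := b)
    have := ih h1
    rw [h2.hr, ← sub_sub, cell_sub] at this
    exact h2.cov this

theorem Root.slots {k t i s r} {Y : Q L (algK M A (k + 1)).Γ} {s' r' y b φ}
    (h1 : Root M A η k t i s' r' y)
    (h2 : Slot M (algK M A k) (scl k) (etaK M A η k) s' r' y s r Y b φ) :
    (b, φ) ∈ slots (dirQ Y).toInt (SimCA.cell k (i - r)) := by
  unfold SimCA.slots
  simp only [Finset.mem_filter, Finset.mem_product, Finset.mem_univ, Finset.mem_Icc, true_and]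
  refine ⟨⟨h2.h1, h2.h2⟩, ?_⟩
  have := h1.cell
  rw [h2.hr, ← sub_sub, cell_sub] at this
  exact h2.cov this

theorem root_count (k : ℕ) (i : ℤ) (s : ℕ) (r : ℤ) : ∃ F : Finset ℕ, F.card ≤ 26 ^ k ∧
    ∀ t Y, Root M A η k t i s r Y → t ∈ F := by
  induction k generalizing s r with
  | zero => exact ⟨{s}, by simp, fun t Y h => by simp [h.1]⟩
  | succ k ih =>
    cases hY : etaK M A η (k + 1) s r with
    | none => exact ⟨∅, by simp, fun t Y h => by rw [h.val] at hY; simp at hY⟩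
    | some Y =>
      choose F hF1 hF2 using ih
      refine ⟨(slots (dirQ Y).toInt (cell k (i - r))).biUnion fun p =>
        F (s + p.2 * (scl k).τ) (r + (scl k).ℓ * (bit p.1 + off p.1 (dirQ Y).toInt p.2)), ?_, ?_⟩
      · refine (Finset.card_biUnion_le_card_mul _ _ (26 ^ k) fun p _ => hF1 _ _).trans ?_
        rw [pow_succ, mul_comm]
        exact Nat.mul_le_mul_left _ (slots_card (dir_cases _))
      · intro t Y' h
        have e : Y' = Y := by
          have := h.val
          rw [hY] at this
          exact (Option.some.inj this).symm
        subst e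
        obtain ⟨s', r', y, b, φ, h1, h2⟩ := h
        rw [Finset.mem_biUnion]
        refine ⟨(b, φ), Root.slots h1 h2, ?_⟩
        have := hF2 _ _ _ _ h1
        rw [h2.ht, h2.hr] at this
        exact this

theorem exists_root (H : Orb M A η) (k : ℕ) {t : ℕ} {i : ℤ} (h : η t i ≠ none)
    (ht : 2 * (scl k).τ ≤ t) : ∃ s r Y, Root M A η k t i s r Y ∧ s ≤ t ∧
      t ≤ s + 2 * (scl k).τ := by
  induction k with
  | zero =>
    obtain ⟨y, hy⟩ := Option.ne_none_iff_exists'.1 h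
    exact ⟨t, i, y, ⟨rfl, rfl, hy⟩, le_rfl, by omega⟩
  | succ k ih =>
    have e : (scl (k + 1)).τ = 27 * (scl k).τ := rfl
    obtain ⟨s', r', y, h1, h2, h3⟩ := ih (by omega)
    obtain ⟨s, r, Y, b, φ, hs⟩ := exists_slot (H.histK k) h1.val (by omega)
    refine ⟨s, r, Y, ⟨s', r', y, b, φ, h1, hs⟩, ?_, ?_⟩
    · have := hs.ht; omega
    · have := hs.ht
      have : φ * (scl k).τ ≤ 27 * (scl k).τ := Nat.mul_le_mul_right _ hs.h2
      omega

theorem scl_tau (k : ℕ) : (scl k).τ = 27 ^ k := by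
  induction k with
  | zero => rfl
  | succ k ih => rw [pow_succ, ← ih, mul_comm]; rfl

/-- the vertical density bound -/
theorem vbound (H : Orb M A η) (k : ℕ) (i : ℤ) :
    ((Finset.Ico (5 * 27 ^ (k + 1)) (6 * 27 ^ (k + 1))).filter
      fun t => (η t i).isSome = true).card ≤ 1134 * 26 ^ (k + 1) := by
  classical
  have e : (scl (k + 1)).τ = 27 * (scl k).τ := rfl
  have hτ := (scl_ok k).τ
  have ok := scl_ok (k + 1)
  have hℓ := ok.ℓ
  have hh := ok.h
  have h3 := ok.h3
  rw [← scl_tau]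
  set T := (scl (k + 1)).τ with hT
  set ℓ := (scl (k + 1)).ℓ with hl
  set h := (scl (k + 1)).h with hhd
  have ex : ∀ t, ∃ p : ℕ × ℤ, t ∈ (Finset.Ico (5 * T) (6 * T)).filter
      (fun t => (η t i).isSome = true) → (∃ Y, Root M A η (k + 1) t i p.1 p.2 Y) ∧
      3 * T ≤ p.1 ∧ p.1 < 6 * T := by
    intro t
    by_cases ht : t ∈ (Finset.Ico (5 * T) (6 * T)).filter (fun t => (η t i).isSome = true)
    · have ht' := ht
      rw [Finset.mem_filter, Finset.mem_Ico] at ht'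
      obtain ⟨s, r, Y, h1, h2, h3⟩ := exists_root H (k + 1) (t := t) (i := i)
        (by rw [← Option.isSome_iff_ne_none]; exact ht'.2) (by omega)
      exact ⟨(s, r), fun _ => ⟨⟨Y, h1⟩, by show 3 * T ≤ s; omega,
        by show s < 6 * T; omega⟩⟩
    · exact ⟨(0, 0), fun h => absurd h ht⟩
  choose p hp using ex
  let f : ℕ → ℕ × ℤ := fun t => ((p t).1 / (scl k).τ, (p t).2 / (h + 1))
  have himg : (((Finset.Ico (5 * T) (6 * T)).filter
      fun t => (η t i).isSome = true).image f).card ≤ 1134 := by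
    have : ((Finset.Ico (5 * T) (6 * T)).filter fun t => (η t i).isSome = true).image f ⊆
        Finset.Ico 81 162 ×ˢ Finset.Ico ((i - 2 * ℓ) / (h + 1)) ((i - 2 * ℓ) / (h + 1) + 14) := by
      rw [Finset.image_subset_iff]
      intro t ht
      have h2 := (hp t ht).2.1
      have h3' := (hp t ht).2.2
      have h1 := (hp t ht).1.choose_spec
      generalize (hp t ht).1.choose = Y at h1
      simp only [Finset.mem_product, Finset.mem_Ico, f]
      have hc := h1.cell
      have hd := dir_cases (dirQ Y)
      have hcc : -1 ≤ cell (k + 1) (i - (p t).2) ∧ cell (k + 1) (i - (p t).2) < 2 := by omega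
      unfold cell at hcc
      rw [← hl, Int.le_ediv_iff_mul_le (by omega), Int.ediv_lt_iff_lt_mul (by omega)] at hcc
      refine ⟨⟨?_, ?_⟩, ?_, ?_⟩
      · rw [Nat.le_div_iff_mul_le hτ]; omega
      · rw [Nat.div_lt_iff_lt_mul hτ]; omega
      · exact Int.ediv_le_ediv (by omega) (by omega)
      · rw [Int.ediv_lt_iff_lt_mul (by omega)]
        have := Int.lt_ediv_add_one_mul_self (i - 2 * ℓ) (show 0 < h + 1 by omega)
        nlinarith
    refine (Finset.card_le_card this).trans ?_
    simp
  have := Finset.card_le_mul_card_image (f := f) ((Finset.Ico (5 * T) (6 * T)).filter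
      fun t => (η t i).isSome = true) (26 ^ (k + 1)) ?_
  · refine this.trans ?_
    rw [mul_comm]
    exact Nat.mul_le_mul_right _ himg
  · intro q hq
    rw [Finset.mem_image] at hq
    obtain ⟨t0, ht0, rfl⟩ := hq
    obtain ⟨F, hF1, hF2⟩ := root_count (M := M) (A := A) (η := η) (k + 1) i (p t0).1 (p t0).2
    refine (Finset.card_le_card ?_).trans hF1
    intro t ht
    rw [Finset.mem_filter] at ht
    obtain ⟨⟨Y0, a1⟩, a2, a3⟩ := hp t0 ht0
    obtain ⟨⟨Y, b1⟩, b2, b3⟩ := hp t ht.1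
    have hf := ht.2
    simp only [f, Prod.mk.injEq] at hf
    obtain ⟨f1, f2⟩ := hf
    have hr : |(p t).2 - (p t0).2| ≤ h := by
      have g1 := Int.ediv_mul_le (p t).2 (show h + 1 ≠ 0 by omega)
      have g2 := Int.ediv_mul_le (p t0).2 (show h + 1 ≠ 0 by omega)
      have g3 := Int.lt_ediv_add_one_mul_self (p t).2 (show 0 < h + 1 by omega)
      have g4 := Int.lt_ediv_add_one_mul_self (p t0).2 (show 0 < h + 1 by omega)
      rw [f2] at g1 g3
      rw [abs_le]
      constructor <;> nlinarith
    have w1 := Nat.div_mul_le_self (p t).1 (scl k).τ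
    have w2 := Nat.div_mul_le_self (p t0).1 (scl k).τ
    have w3 := Nat.lt_div_mul_add (a := (p t).1) hτ
    have w4 := Nat.lt_div_mul_add (a := (p t0).1) hτ
    rw [f1] at w1 w3
    have heq : (p t).1 = (p t0).1 ∧ (p t).2 = (p t0).2 := by
      rcases le_total (p t).1 (p t0).1 with hle | hle
      · exact spacing H k b1.val a1.val (by omega) hle (by omega) hr
      · have := spacing H k a1.val b1.val (by omega) hle (by omega) (by rw [abs_sub_comm]; exact hr)
        exact ⟨this.1.symm, this.2.symm⟩
    rw [heq.1, heq.2] at b1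
    exact hF2 t Y b1

end SimCA
end

section
namespace SimCA

variable {L : Type} {M : Mealy L} {A : Alg L}

/-- the automaton `f` on numbers codes the rule of the particle system -/
structure Cod (M : Mealy L) (A : Alg L) {N : ℕ}
    (f : Fin (N + 1) × Fin (N + 1) × Fin (N + 1) → Fin (N + 1))
    (e : Fin (N + 1) → Option (Q L A.Γ)) (en : Option (Q L A.Γ) → Fin (N + 1)) : Prop where
  ee : ∀ x, e (en x) = x
  en0 : en none = 0
  hf : ∀ a b c, f (a, b, c) = en (rule M A (e a) (e b) (e c))

theorem hdens {η : ℕ → ℤ → Option (Q L A.Γ)} (H : Orb M A η) (k m : ℕ) :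
    27 ^ (k + 1) * ((Finset.Icc (-(m : ℤ)) m).filter
      fun i => (η (6 * 27 ^ (k + 1)) i).isSome = true).card ≤
      (2 * m + 2 * 27 ^ (k + 1) + 1) * (1134 * 26 ^ (k + 1)) := by
  classical
  obtain ⟨T, hT⟩ : ∃ T, T = 27 ^ (k + 1) := ⟨_, rfl⟩
  have hv := vbound H k
  rw [← hT] at hv ⊢
  obtain ⟨C, hC⟩ : ∃ C, C = 1134 * 26 ^ (k + 1) := ⟨_, rfl⟩
  rw [← hC] at hv ⊢
  have key : ∀ t ∈ Finset.Ico (5 * T) (6 * T), ((Finset.Icc (-(m : ℤ)) m).filter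
      fun i => (η (6 * T) i).isSome = true).card ≤
      ((Finset.Icc (-(m : ℤ) - T) (m + T)).filter fun i => (η t i).isSome = true).card := by
    intro t ht
    rw [Finset.mem_Ico] at ht
    have ex : ∀ i, ∃ a, (η (6 * T) i).isSome = true → Path η t a (6 * T) i := by
      intro i
      by_cases h : (η (6 * T) i).isSome = true
      · obtain ⟨a, ha⟩ := Path.exists_back H (u := t) (t := 6 * T) (i := i)
          (by rw [← Option.isSome_iff_ne_none]; exact h) (by omega)
        exact ⟨a, fun _ => ha⟩
      · exact ⟨0, fun h' => (h h').elim⟩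
    choose g hg using ex
    refine Finset.card_le_card_of_injOn g ?_ ?_
    · intro i hi
      simp only [Finset.coe_filter, Finset.mem_Icc, Set.mem_ofPred_eq] at hi ⊢
      have hp := hg i hi.2
      have := hp.speed
      rw [abs_le] at this
      refine ⟨?_, ?_⟩
      · push_cast at this; omega
      · rw [Option.isSome_iff_ne_none]; exact hp.alive0
    · intro i hi j hj hij
      simp only [Finset.coe_filter, Finset.mem_Icc, Set.mem_ofPred_eq] at hi hj
      have h1 := hg i hi.2
      have h2 := hg j hj.2
      rw [← hij] at h2
      exact h1.fwd H h2
  have s1 := Finset.sum_le_sum key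
  rw [Finset.sum_const, Nat.card_Ico, show 6 * T - 5 * T = T by omega, smul_eq_mul] at s1
  refine s1.trans ?_
  simp_rw [Finset.card_filter]
  rw [Finset.sum_comm]
  simp_rw [← Finset.card_filter]
  refine (Finset.sum_le_sum fun i _ => hv i).trans ?_
  rw [Finset.sum_const, Int.card_Icc, smul_eq_mul]
  apply Nat.mul_le_mul_right
  omega

namespace Cod

variable {N : ℕ} {f : Fin (N + 1) × Fin (N + 1) × Fin (N + 1) → Fin (N + 1)}
  {e : Fin (N + 1) → Option (Q L A.Γ)} {en : Option (Q L A.Γ) → Fin (N + 1)}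

theorem orb (h : Cod M A f e en) (x : ℤ → Fin (N + 1)) :
    Orb M A fun t i => e ((caOfRule f)^[t] x i) := by
  intro t i
  simp only [Function.iterate_succ_apply', caOfRule, h.hf, h.ee]

theorem ne_zero (h : Cod M A f e en) (x : ℤ → Fin (N + 1)) {t : ℕ} (ht : 0 < t) (i : ℤ) :
    (caOfRule f)^[t] x i ≠ 0 → (e ((caOfRule f)^[t] x i)).isSome = true := by
  obtain ⟨t, rfl⟩ : ∃ s, t = s + 1 := ⟨t - 1, by omega⟩
  intro h'
  rw [Option.isSome_iff_ne_none]
  intro h0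
  apply h'
  simp only [Function.iterate_succ_apply', caOfRule, h.hf, h.ee] at h0 ⊢
  rw [h0, h.en0]

theorem e0 (h : Cod M A f e en) : e 0 = none := by rw [← h.en0, h.ee]

theorem f0 (h : Cod M A f e en) : f (0, 0, 0) = 0 := by
  rw [h.hf, h.e0]; exact h.en0

theorem small (ε : ℝ) (hε : 0 < ε) : ∃ k : ℕ, 2268 * 26 ^ (k + 1) < ε * (27 : ℝ) ^ (k + 1) := by
  obtain ⟨k, hk⟩ := exists_pow_lt_of_lt_one (show 0 < ε / 2268 by positivity)
    (show (26 / 27 : ℝ) < 1 by norm_num)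
  refine ⟨k, ?_⟩
  rw [div_pow, div_lt_div_iff₀ (by positivity) (by positivity)] at hk
  rw [pow_succ, pow_succ]
  have : (0 : ℝ) < 27 ^ k := by positivity
  nlinarith [mul_pos hε this]

theorem AND (h : Cod M A f e en) (ε : ℝ) (hε : 0 < ε) : ∃ k : ℕ, ∀ x : ℤ → Fin (N + 1),
    besicovitchDist ((caOfRule f)^[k] x) (fun _ => 0) < ε := by
  obtain ⟨k, hk⟩ := small ε hε
  refine ⟨6 * 27 ^ (k + 1), fun x => ?_⟩
  refine lt_of_le_of_lt ?_ ((div_lt_iff₀ (by positivity)).2 hk)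
  unfold besicovitchDist
  refine limsup_le_of_le ?_ ?_
  · refine isCoboundedUnder_le_of_le atTop (x := 0) fun m => by positivity
  · filter_upwards [eventually_ge_atTop (27 ^ (k + 1))] with m hm
    have h1 := hdens (h.orb x) k m
    have h2 : ((Finset.Icc (-(m : ℤ)) m).filter
        fun i => (caOfRule f)^[6 * 27 ^ (k + 1)] x i ≠ 0).card ≤
      ((Finset.Icc (-(m : ℤ)) m).filter
        fun i => (e ((caOfRule f)^[6 * 27 ^ (k + 1)] x i)).isSome = true).card := by
      apply Finset.card_le_card
      intro i hi
      rw [Finset.mem_filter] at hi ⊢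
      exact ⟨hi.1, h.ne_zero x (by positivity) i hi.2⟩
    rw [div_le_div_iff₀ (by positivity) (by positivity)]
    have h3 := (Nat.mul_le_mul_left (27 ^ (k + 1)) h2).trans h1
    have h4 : ((2 * m + 2 * 27 ^ (k + 1) + 1) * (1134 * 26 ^ (k + 1)) : ℕ) ≤
        2268 * 26 ^ (k + 1) * (2 * m + 1) := by
      have : (0 : ℕ) < 26 ^ (k + 1) := by positivity
      nlinarith
    have h5 := h3.trans h4
    rw [mul_comm]
    exact_mod_cast h5

theorem meas (f : Fin (N + 1) × Fin (N + 1) × Fin (N + 1) → Fin (N + 1)) :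
    Measurable (caOfRule f) := by
  rw [measurable_pi_iff]
  intro i
  have h1 : Measurable f := measurable_of_countable f
  exact h1.comp ((measurable_pi_apply _).prodMk
    ((measurable_pi_apply _).prodMk (measurable_pi_apply _)))

theorem UE (h : Cod M A f e en) : ∃! μ : Measure (ℤ → Fin (N + 1)), IsProbabilityMeasure μ ∧
    ∀ B : Set (ℤ → Fin (N + 1)), MeasurableSet B → μ (caOfRule f ⁻¹' B) = μ B := by
  have hfix : caOfRule f (fun _ => 0) = fun _ => 0 := by
    funext i; exact h.f0
  refine ⟨Measure.dirac fun _ => 0, ⟨inferInstance, fun B hB => ?_⟩, ?_⟩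
  · rw [Measure.dirac_apply' _ hB, Measure.dirac_apply' _ (meas f hB)]
    have : ((fun _ => 0) ∈ caOfRule f ⁻¹' B) ↔ (fun _ => 0) ∈ B := by
      rw [Set.mem_preimage, hfix]
    by_cases h0 : (fun _ => 0) ∈ B
    · rw [Set.indicator_of_mem h0, Set.indicator_of_mem (this.2 h0)]
    · rw [Set.indicator_of_notMem h0, Set.indicator_of_notMem (fun h => h0 (this.1 h))]
  · rintro μ ⟨hp, hi⟩
    have inv : ∀ t (B : Set (ℤ → Fin (N + 1))), MeasurableSet B →
        μ ((caOfRule f)^[t] ⁻¹' B) = μ B := by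
      intro t
      induction t with
      | zero => intro B _; rfl
      | succ t ih =>
        intro B hB
        rw [Function.iterate_succ, Set.preimage_comp,
          hi _ (((meas f).iterate t) hB), ih B hB]
    have z : ∀ i, μ {x | x i ≠ 0} = 0 := by
      intro i
      have mB : MeasurableSet {x : ℤ → Fin (N + 1) | x i ≠ 0} :=
        (measurable_pi_apply i) (MeasurableSet.of_discrete (s := {a | a ≠ 0}))
      have bd : ∀ k : ℕ, (27 : ENNReal) ^ (k + 1) * μ {x | x i ≠ 0} ≤ 1134 * 26 ^ (k + 1) := by
        intro k
        have s : ∑ t ∈ Finset.Ico (5 * 27 ^ (k + 1)) (6 * 27 ^ (k + 1)),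
            ∫⁻ x, ((caOfRule f)^[t] ⁻¹' {x | x i ≠ 0}).indicator 1 x ∂μ =
            (27 : ENNReal) ^ (k + 1) * μ {x | x i ≠ 0} := by
          rw [Finset.sum_congr rfl fun t _ => by
            rw [lintegral_indicator_one (((meas f).iterate t) mB), inv t _ mB]]
          rw [Finset.sum_const, Nat.card_Ico, nsmul_eq_mul, ← Nat.sub_mul]
          push_cast
          ring
        rw [← s, ← lintegral_finsetSum _ fun t _ =>
          measurable_one.indicator (((meas f).iterate t) mB)]
        calc _ ≤ ∫⁻ _ : ℤ → Fin (N + 1), (1134 * 26 ^ (k + 1) : ENNReal) ∂μ := by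
              apply lintegral_mono
              intro x
              have hv := vbound (h.orb x) k i
              have : ∑ t ∈ Finset.Ico (5 * 27 ^ (k + 1)) (6 * 27 ^ (k + 1)),
                  ((caOfRule f)^[t] ⁻¹' {x | x i ≠ 0}).indicator (1 : (ℤ → Fin (N + 1)) → ENNReal) x ≤
                  (((Finset.Ico (5 * 27 ^ (k + 1)) (6 * 27 ^ (k + 1))).filter
                    fun t => (e ((caOfRule f)^[t] x i)).isSome = true).card : ENNReal) := by
                rw [Finset.card_filter, Nat.cast_sum]
                apply Finset.sum_le_sum
                intro t ht
                rw [Finset.mem_Ico] at ht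
                have : 0 < 27 ^ (k + 1) := by positivity
                by_cases hx : (caOfRule f)^[t] x i ≠ 0
                · rw [if_pos (h.ne_zero x (by omega) i hx)]
                  simp [Set.indicator, hx]
                · simp only [Set.indicator, Set.mem_preimage, Set.mem_ofPred_eq, if_neg hx]
                  exact zero_le
              refine this.trans ?_
              have hv' := (Nat.cast_le (α := ENNReal)).2 hv
              push_cast at hv'
              exact hv'
          _ = _ := by simp
      by_contra hne
      have hlt : μ {x | x i ≠ 0} ≠ ⊤ := measure_ne_top _ _
      obtain ⟨k, hk⟩ := small (μ {x | x i ≠ 0}).toReal (ENNReal.toReal_pos hne hlt)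
      have := ENNReal.toReal_mono (by finiteness) (bd k)
      simp only [ENNReal.toReal_mul, ENNReal.toReal_pow] at this
      norm_num at this
      have p1 : (0 : ℝ) < 26 ^ (k + 1) := by positivity
      norm_num at hk
      nlinarith
    have hz : μ {x | x ≠ fun _ => 0} = 0 := by
      have : {x : ℤ → Fin (N + 1) | x ≠ fun _ => 0} = ⋃ i, {x | x i ≠ 0} := by
        ext x
        simp [funext_iff]
      rw [this, measure_iUnion_null_iff]
      exact z
    have ae : ∀ᵐ x ∂μ, x = fun _ => 0 := hz
    ext B hB
    rw [Measure.dirac_apply' _ hB]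
    by_cases h0 : (fun _ => 0) ∈ B
    · rw [Set.indicator_of_mem h0]
      rw [Pi.one_apply, ← measure_univ (μ := μ)]
      apply measure_congr
      filter_upwards [ae] with x hx
      have : x ∈ B := by rw [hx]; exact h0
      exact propext ⟨fun _ => trivial, fun _ => this⟩
    · rw [Set.indicator_of_notMem h0]
      refine measure_mono_null ?_ hz
      intro x hx h'
      rw [h'] at hx
      exact h0 hx

theorem nil (h : Cod M A f e en) :
    (∃ k : ℕ, ∀ x : ℤ → Fin (N + 1), (caOfRule f)^[k] x = fun _ => 0) ↔
    ∃ k, ∀ η : ℕ → ℤ → Option (Q L A.Γ), Orb M A η → ∀ i, η k i = none := by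
  constructor
  · rintro ⟨k, hk⟩
    refine ⟨k, fun η H i => ?_⟩
    have : ∀ t i, η t i = e ((caOfRule f)^[t] (fun i => en (η 0 i)) i) := by
      intro t
      induction t with
      | zero => intro i; simp [h.ee]
      | succ t ih =>
        intro i
        rw [H t i, ih, ih, ih]
        simp only [Function.iterate_succ_apply', caOfRule, h.hf, h.ee]
    rw [this, hk, h.e0]
  · rintro ⟨k, hk⟩
    refine ⟨k + 1, fun x => ?_⟩
    funext i
    by_contra hne
    have h1 := h.ne_zero x (t := k + 1) (by omega) i hne
    have h2 := hk (fun t i => e ((caOfRule f)^[t] (caOfRule f x) i)) (h.orb _) i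
    rw [← Function.iterate_succ_apply] at h2
    rw [h2] at h1
    simp at h1

end Cod

end SimCA
end

section
namespace SimCA

variable {L : Type} {M : Mealy L} {A : Alg L} {η : ℕ → ℤ → Option (Q L A.Γ)}

variable (M A) in
def hltK (k : ℕ) : Bool := M.hlt ((algK M A k).run (algK M A k).cur M.u0).2

theorem nil_of_hlt {k : ℕ} (hk : hltK M A k = true) :
    ∃ T, ∀ η : ℕ → ℤ → Option (Q L A.Γ), Orb M A η → ∀ i, η T i = none := by
  refine ⟨3 * (scl (k + 1)).τ, fun η H i => ?_⟩
  by_contra hne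
  obtain ⟨s, r, Y, h1, h2, h3⟩ := exists_root H (k + 1) hne (by omega)
  have hv := h1.val
  have e : (scl (k + 1)).τ = 27 * (scl k).τ := rfl
  obtain ⟨u, rfl⟩ : ∃ u, s = u + 27 * (scl k).τ := ⟨s - 27 * (scl k).τ, by omega⟩
  have := (H.histK k).not_hlt hv
  unfold hltK at hk
  rw [hk] at this
  exact absurd this (by simp)

end SimCA
end

section
namespace SimCA

variable {L : Type} {M : Mealy L} {A : Alg L} {ι : Type}

/-- message received by a particle in a particle configuration -/
noncomputable def msgC {Γ : Type} (c : ι → ℤ × Q L Γ) (i : ι) : Option (V L) :=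
  open Classical in
  if mvP (c i).2.pos then none else
    if h : ∃ j, (c j).1 = (c i).1 + sd (c i).2.pos ∧ (c j).2.pos = flipP (c i).2.pos then
      some (c h.choose).2.w.o else none

variable (M A) in
noncomputable def nx (c : ι → ℤ × Q L A.Γ) : ι → ℤ × Q L A.Γ := fun i =>
  ((c i).1 + (dirQ (c i).2).toInt, (step M A (c i).2 (msgC c i)).getD (c i).2)

variable (M A) in
structure Good (c : ι → ℤ × Q L A.Γ) : Prop where
  inj : ∀ i j, (c i).1 = (c j).1 → i = j
  inj' : ∀ i j, (nx M A c i).1 = (nx M A c j).1 → i = j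
  cross : ∀ i j, (dirQ (c i).2).toInt = 1 → (dirQ (c j).2).toInt = -1 → (c j).1 ≠ (c i).1 + 1
  ok : ∀ i, step M A (c i).2 (msgC c i) = some (nx M A c i).2

theorem msgC_some {Γ : Type} {c : ι → ℤ × Q L Γ} (inj : ∀ i j, (c i).1 = (c j).1 → i = j)
    {i j : ι} (h1 : (c j).1 = (c i).1 + sd (c i).2.pos) (h2 : (c j).2.pos = flipP (c i).2.pos)
    (h3 : mvP (c i).2.pos = false) : msgC c i = some (c j).2.w.o := by
  have h : ∃ j, (c j).1 = (c i).1 + sd (c i).2.pos ∧ (c j).2.pos = flipP (c i).2.pos :=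
    ⟨j, h1, h2⟩
  unfold msgC
  rw [h3, dif_pos h]
  simp only [Bool.false_eq_true, if_false]
  rw [inj h.choose j (by rw [h.choose_spec.1, h1])]

theorem msgC_none {Γ : Type} {c : ι → ℤ × Q L Γ}
    {i : ι} (h : ∀ j, (c j).1 = (c i).1 + sd (c i).2.pos → (c j).2.pos = flipP (c i).2.pos → False) :
    msgC c i = none := by
  unfold msgC
  split_ifs with h1 h2
  · rfl
  · obtain ⟨j, h2, h3⟩ := h2
    exact (h j h2 h3).elim
  · rfl

theorem msgC_mv {Γ : Type} {c : ι → ℤ × Q L Γ} {i : ι} (h : mvP (c i).2.pos = true) :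
    msgC c i = none := by
  unfold msgC; rw [if_pos h]

/-- a row of the automaton shows the configuration -/
def Shows (c : ι → ℤ × Q L A.Γ) (ρ : ℤ → Option (Q L A.Γ)) : Prop :=
  ∀ a y, ρ a = some y ↔ ∃ i, c i = (a, y)

theorem toInt_eq (d : Dir) : (d.toInt = 1 ↔ d = .p) ∧ (d.toInt = -1 ↔ d = .m) ∧
    (d.toInt = 0 ↔ d = .z) := by
  cases d <;> simp [Dir.toInt]

theorem Good.msg {c : ι → ℤ × Q L A.Γ} (h : Good M A c) {ρ : ℤ → Option (Q L A.Γ)}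
    (s : Shows c ρ) (i : ι) : msg (ρ ((c i).1 - 1)) (c i).2 (ρ ((c i).1 + 1)) = msgC c i := by
  unfold SimCA.msg
  have e : (if sd (c i).2.pos = 1 then ρ ((c i).1 + 1) else ρ ((c i).1 - 1)) =
      ρ ((c i).1 + sd (c i).2.pos) := by
    rcases sd_cases (c i).2.pos with h | h <;> rw [h] <;> simp [sub_eq_add_neg]
  rw [e]
  split_ifs with h1
  · rw [msgC_mv h1]
  · cases hr : ρ ((c i).1 + sd (c i).2.pos) with
    | none =>
      rw [msgC_none]; · rfl
      intro j h3 h4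
      have := (s (c j).1 (c j).2).2 ⟨j, rfl⟩
      rw [h3, hr] at this
      simp at this
    | some z =>
      obtain ⟨j, hj⟩ := (s _ _).1 hr
      simp only [Option.bind_some]
      split_ifs with h2
      · rw [msgC_some h.inj (i := i) (j := j)]
        · rw [hj]
        · rw [hj]
        · rw [hj, h2]
        · simpa using h1
      · rw [msgC_none]
        intro k h3 h4
        obtain rfl := h.inj k j (by rw [h3, hj])
        rw [hj] at h4
        exact h2 h4

theorem Shows.drO {c : ι → ℤ × Q L A.Γ} {ρ : ℤ → Option (Q L A.Γ)}
    (s : Shows c ρ) (a : ℤ) (d : Dir) :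
    drO (ρ a) = some d ↔ ∃ i, (c i).1 = a ∧ dirQ (c i).2 = d := by
  unfold SimCA.drO
  rw [Option.map_eq_some_iff]
  constructor
  · rintro ⟨y, h1, h2⟩
    obtain ⟨i, hi⟩ := (s _ _).1 h1
    exact ⟨i, by rw [hi], by rw [hi, h2]⟩
  · rintro ⟨i, h1, h2⟩
    exact ⟨(c i).2, (s _ _).2 ⟨i, by rw [← h1]⟩, h2⟩

theorem mvP_of_dir {Γ : Type} {q : Q L Γ} (h : dirQ q ≠ .z) : mvP q.pos = true := by
  unfold dirQ dirW at h
  split_ifs at h with h1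
  · exact h1
  · simp at h

theorem Good.shows {c : ι → ℤ × Q L A.Γ} (h : Good M A c) {ρ : ℤ → Option (Q L A.Γ)}
    (s : Shows c ρ) :
    Shows (nx M A c) (fun a => rule M A (ρ (a - 1)) (ρ a) (ρ (a + 1))) := by
  have hL : ∀ a, isL (ρ (a - 1)) (ρ a) = true ↔ ∃ i, (c i).1 = a - 1 ∧ dirQ (c i).2 = .p := by
    intro a
    unfold isL
    simp only [Bool.and_eq_true, decide_eq_true_eq, Bool.not_eq_true', decide_eq_false_iff_not]
    rw [s.drO, s.drO]
    constructor
    · exact fun h => h.1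
    · rintro ⟨i, h1, h2⟩
      refine ⟨⟨i, h1, h2⟩, ?_⟩
      rintro ⟨j, h3, h4⟩
      exact h.cross i j (by rw [h2]; rfl) (by rw [h4]; rfl) (by omega)
  have hR : ∀ a, isR (ρ a) (ρ (a + 1)) = true ↔ ∃ i, (c i).1 = a + 1 ∧ dirQ (c i).2 = .m := by
    intro a
    unfold isR
    simp only [Bool.and_eq_true, decide_eq_true_eq, Bool.not_eq_true', decide_eq_false_iff_not]
    rw [s.drO, s.drO]
    constructor
    · exact fun h => h.1
    · rintro ⟨i, h1, h2⟩
      refine ⟨⟨i, h1, h2⟩, ?_⟩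
      rintro ⟨j, h3, h4⟩
      exact h.cross j i (by rw [h4]; rfl) (by rw [h2]; rfl) (by omega)
  have hC : ∀ a, isC (ρ a) = true ↔ ∃ i, (c i).1 = a ∧ dirQ (c i).2 = .z := by
    intro a
    unfold isC
    rw [decide_eq_true_eq, s.drO]
  have n1 : ∀ i, (nx M A c i).1 = (c i).1 + (dirQ (c i).2).toInt := fun i => rfl
  have excl : ∀ a i, (nx M A c i).1 = a → (isL (ρ (a - 1)) (ρ a) = true ↔ dirQ (c i).2 = .p) ∧
      (isR (ρ a) (ρ (a + 1)) = true ↔ dirQ (c i).2 = .m) ∧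
      (isC (ρ a) = true ↔ dirQ (c i).2 = .z) := by
    intro a i hi
    rw [hL, hR, hC]
    refine ⟨⟨?_, ?_⟩, ⟨?_, ?_⟩, ⟨?_, ?_⟩⟩
    · rintro ⟨j, h1, h2⟩
      rw [h.inj' i j (by rw [hi, n1, h1, h2]; simp [Dir.toInt]), h2]
    · intro h2; exact ⟨i, by rw [← hi, n1, h2]; simp [Dir.toInt], h2⟩
    · rintro ⟨j, h1, h2⟩
      rw [h.inj' i j (by rw [hi, n1, h1, h2]; simp [Dir.toInt]), h2]
    · intro h2; exact ⟨i, by rw [← hi, n1, h2]; simp [Dir.toInt], h2⟩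
    · rintro ⟨j, h1, h2⟩
      rw [h.inj' i j (by rw [hi, n1, h1, h2]; simp [Dir.toInt]), h2]
    · intro h2; exact ⟨i, by rw [← hi, n1, h2]; simp [Dir.toInt], h2⟩
  have val : ∀ i, rule M A (ρ ((nx M A c i).1 - 1)) (ρ (nx M A c i).1) (ρ ((nx M A c i).1 + 1)) =
      some (nx M A c i).2 := by
    intro i
    obtain ⟨e1, e2, e3⟩ := excl _ i rfl
    have ff : ∀ {b : Bool} {P : Prop}, (b = true ↔ P) → ¬ P → b = false :=
      fun h1 h2 => Bool.eq_false_iff.2 fun h => h2 (h1.1 h)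
    have hs := (s (c i).1 (c i).2).2 ⟨i, rfl⟩
    have hok := h.ok i
    unfold rule
    cases hd : dirQ (c i).2 with
    | m =>
      have f : (nx M A c i).1 + 1 = (c i).1 := by rw [n1, hd]; simp [Dir.toInt]
      rw [hd] at e1 e2 e3
      rw [ff e1 (by simp), e2.2 rfl,
        ff e3 (by simp)]
      simp only
      rw [f, hs, ← hok, msgC_mv (mvP_of_dir (by rw [hd]; simp))]
      rfl
    | z =>
      have f : (nx M A c i).1 = (c i).1 := by rw [n1, hd]; simp [Dir.toInt]
      rw [hd] at e1 e2 e3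
      rw [ff e1 (by simp), e3.2 rfl,
        ff e2 (by simp)]
      simp only
      rw [f, hs]
      rw [Option.bind_some, h.msg s, hok]
    | p =>
      have f : (nx M A c i).1 - 1 = (c i).1 := by rw [n1, hd]; simp [Dir.toInt]
      rw [hd] at e1 e2 e3
      rw [ff e2 (by simp), e1.2 rfl,
        ff e3 (by simp)]
      simp only
      rw [f, hs, ← hok, msgC_mv (mvP_of_dir (by rw [hd]; simp))]
      rfl
  intro a y
  constructor
  · intro hy
    have : ∃ i, (nx M A c i).1 = a := by
      by_contra hne
      push Not at hne
      have z1 : isL (ρ (a - 1)) (ρ a) = false := by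
        rw [Bool.eq_false_iff]; intro h; obtain ⟨i, h1, h2⟩ := (hL a).1 h
        exact hne i (by rw [n1, h1, h2]; simp [Dir.toInt])
      have z2 : isR (ρ a) (ρ (a + 1)) = false := by
        rw [Bool.eq_false_iff]; intro h; obtain ⟨i, h1, h2⟩ := (hR a).1 h
        exact hne i (by rw [n1, h1, h2]; simp [Dir.toInt])
      have z3 : isC (ρ a) = false := by
        rw [Bool.eq_false_iff]; intro h; obtain ⟨i, h1, h2⟩ := (hC a).1 h
        exact hne i (by rw [n1, h1, h2]; simp [Dir.toInt])
      simp only [rule, z1, z2, z3] at hy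
      simp at hy
    obtain ⟨i, rfl⟩ := this
    have := val i
    exact ⟨i, by rw [Option.some.inj (hy.symm.trans this)]⟩
  · rintro ⟨i, hi⟩
    have := val i
    rw [hi] at this
    exact this

/-- a configuration that evolves without losses yields a living orbit -/
theorem orb_of_good (c : ι → ℤ × Q L A.Γ) (inj : ∀ i j, (c i).1 = (c j).1 → i = j) (i : ι) (T : ℕ)
    (h : ∀ t < T, Good M A ((nx M A)^[t] c)) :
    ∃ η : ℕ → ℤ → Option (Q L A.Γ), Orb M A η ∧ ∃ a, η T a ≠ none := by
  classical
  let F : (ℤ → Option (Q L A.Γ)) → ℤ → Option (Q L A.Γ) :=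
    fun ρ a => rule M A (ρ (a - 1)) (ρ a) (ρ (a + 1))
  let ρ0 : ℤ → Option (Q L A.Γ) := fun a => if h : ∃ i, (c i).1 = a then some (c h.choose).2 else none
  have s0 : Shows c ρ0 := by
    intro a y
    simp only [ρ0]
    constructor
    · intro h
      split_ifs at h with h1
      exact ⟨h1.choose, Prod.ext h1.choose_spec (Option.some.inj h)⟩
    · rintro ⟨i, hi⟩
      have h1 : ∃ i, (c i).1 = a := ⟨i, by rw [hi]⟩
      rw [dif_pos h1, inj h1.choose i (by rw [h1.choose_spec, hi]), hi]
  have s : ∀ t ≤ T, Shows ((nx M A)^[t] c) (F^[t] ρ0) := by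
    intro t
    induction t with
    | zero => intro _; exact s0
    | succ t ih =>
      intro ht
      rw [Function.iterate_succ_apply', Function.iterate_succ_apply']
      exact (h t (by omega)).shows (ih (by omega))
  refine ⟨fun t => F^[t] ρ0, ?_, ((nx M A)^[T] c i).1, ?_⟩
  · intro t a
    simp only [Function.iterate_succ_apply']
    rfl
  · have := (s T le_rfl ((nx M A)^[T] c i).1 ((nx M A)^[T] c i).2).2 ⟨i, rfl⟩
    simp only [this]
    simp

end SimCA
end

section
namespace SimCA

variable {L : Type} {M : Mealy L} {A : Alg L} {ι : Type}

theorem geo {J J' D D' : ℤ} (hD : D = -1 ∨ D = 0 ∨ D = 1) (hD' : D' = -1 ∨ D' = 0 ∨ D' = 1)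
    (h0 : J ≠ J') (h1 : J + D ≠ J' + D') (hx : D = 1 → D' = -1 → J' ≠ J + 1)
    (hx' : D' = 1 → D = -1 → J ≠ J' + 1) {φ : ℕ} (hφ : φ ≤ 27) (b b' : Bool) :
    4 * J + bit b + off b D φ ≠ 4 * J' + bit b' + off b' D' φ ∧
    (φ < 27 → off b D (φ + 1) - off b D φ = 1 → off b' D' (φ + 1) - off b' D' φ = -1 →
      4 * J' + bit b' + off b' D' φ ≠ 4 * J + bit b + off b D φ + 1) := by
  have hc : φ ≤ 3 ∨ φ = 4 ∨ (5 ≤ φ ∧ φ ≤ 12) ∨ φ = 13 ∨ (14 ≤ φ ∧ φ ≤ 21) ∨ φ = 22 ∨ φ = 23 ∨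
      φ = 24 ∨ φ = 25 ∨ φ = 26 ∨ φ = 27 := by omega
  have e1 : ∀ b D, φ ≤ 3 → off b D φ = 0 ∧ off b D (φ + 1) = 0 := by
    intro b D h; unfold off; rw [if_pos (by omega), if_pos (by omega)]; simp
  have e2 : ∀ b D, 5 ≤ φ ∧ φ ≤ 12 → off b D φ = (if b then 1 else -1) ∧
      off b D (φ + 1) = (if b then 1 else -1) := by
    intro b D h; unfold off
    rw [if_neg (show ¬ φ ≤ 4 by omega), if_pos (show φ ≤ 13 by omega),
      if_neg (show ¬ φ + 1 ≤ 4 by omega), if_pos (show φ + 1 ≤ 13 by omega)]; simp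
  have e3 : ∀ b D, 14 ≤ φ ∧ φ ≤ 21 → off b D φ = 0 ∧ off b D (φ + 1) = 0 := by
    intro b D h; unfold off
    rw [if_neg (show ¬ φ ≤ 4 by omega), if_neg (show ¬ φ ≤ 13 by omega),
      if_pos (show φ ≤ 22 by omega), if_neg (show ¬ φ + 1 ≤ 4 by omega),
      if_neg (show ¬ φ + 1 ≤ 13 by omega), if_pos (show φ + 1 ≤ 22 by omega)]; simp
  have o22 : ∀ b D, off b D 22 = 0 := fun b D => rfl
  have o23 : ∀ b D, off b D 23 = D := fun b D => by simp [off]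
  have o24 : ∀ b D, off b D 24 = 2 * D := fun b D => by simp [off]; ring
  have o25 : ∀ b D, off b D 25 = 3 * D := fun b D => by simp [off]; ring
  have o26 : ∀ b D, off b D 26 = 4 * D := fun b D => by simp [off]; ring
  have o27 : ∀ b D, off b D 27 = 4 * D := fun b D => by simp [off]
  have hb : bit false = 0 := rfl
  have hb' : bit true = 1 := rfl
  rcases hc with h | rfl | h | rfl | h | rfl | rfl | rfl | rfl | rfl | rfl
  · rw [(e1 b D h).1, (e1 b D h).2, (e1 b' D' h).1]
    cases b <;> cases b' <;> simp [bit] <;> omega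
  · cases b <;> cases b' <;> simp [bit, off] <;> omega
  · rw [(e2 b D h).1, (e2 b D h).2, (e2 b' D' h).1]
    cases b <;> cases b' <;> simp [bit] <;> omega
  · cases b <;> cases b' <;> simp [bit, off] <;> omega
  · rw [(e3 b D h).1, (e3 b D h).2, (e3 b' D' h).1]
    cases b <;> cases b' <;> simp [bit] <;> omega
  all_goals
    norm_num only [o22, o23, o24, o25, o26, o27]
    cases b <;> cases b' <;> simp only [hb, hb'] <;> omega

end SimCA
end

section
namespace SimCA

variable {L : Type} {M : Mealy L} {A : Alg L} {ι : Type}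

variable (M A) in
/-- `c` represents the composite configuration `C` -/
structure Exp (c : ι × Bool → ℤ × Q L A.Γ) (C : ι → ℤ × Q L (up M A).Γ) : Prop where
  pos : ∀ i b, (c (i, b)).1 = 4 * (C i).1 + bit b
  ph : ∀ i b, (c (i, b)).2.pos = (b, 0)
  mac : ∀ i, mac M A (c (i, false)).2 (c (i, true)).2 = (C i).2

variable (M A) in
noncomputable def trX (c : ι × Bool → ℤ × Q L A.Γ) (i : ι) (b : Bool) (φ : ℕ) : Q L A.Γ :=
  ((nx M A)^[φ] c (i, b)).2
variable (M A) in
noncomputable def trP (c : ι × Bool → ℤ × Q L A.Γ) (i : ι) (b : Bool) (φ : ℕ) : ℤ :=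
  ((nx M A)^[φ] c (i, b)).1
variable (M A) in
noncomputable def trM (c : ι × Bool → ℤ × Q L A.Γ) (i : ι) (b : Bool) (φ : ℕ) : Option (V L) :=
  msgC ((nx M A)^[φ] c) (i, b)

variable (M A) in
structure Run (c : ι × Bool → ℤ × Q L A.Γ) (C : ι → ℤ × Q L (up M A).Γ) (n : ℕ) : Prop where
  st : ∀ φ < n, ∀ i b, step M A (trX M A c i b φ) (trM M A c i b φ) = some (trX M A c i b (φ + 1))
  ps : ∀ φ ≤ n, ∀ i b, trP M A c i b φ = 4 * (C i).1 + bit b + off b (dirQ (C i).2).toInt φ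

theorem act0_none {n : ℕ} {m : Option (V L)} {w : Wk L} (h : act0 M n m w = none) :
    (n = 17 ∧ w.x.f = false) ∨ (n = 26 ∧ (m.getD (dflt M)).dr ≠ w.d) := by
  unfold act0 at h
  split at h <;> simp_all

theorem act1_none {n : ℕ} {m : Option (V L)} {w : Wk L} (h : act1 M n m w = none) :
    (n = 2 ∧ M.hlt w.x.l = true) ∨ (n = 26 ∧ (m.getD (dflt M)).dr ≠ w.d) := by
  unfold act1 at h
  split at h <;> simp_all

theorem off_bb {φ : ℕ} (b : Bool) (D : ℤ) (hφ : φ ≤ 27) :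
    bit b + off b D φ ≠ bit (!b) + off (!b) D φ := by
  unfold off bit
  split_ifs <;> simp_all

theorem off_ct2 {φ : ℕ} (b : Bool) (D : ℤ) (hφ : φ < 27) (h : ctN φ = true) :
    bit (!b) + off (!b) D φ = bit b + off b D φ + sd (b, ph φ) := by
  unfold sd
  rw [exP_ph b hφ]
  unfold off bit
  have : ¬ (4 < φ ∧ φ ≤ 13) := by
    rintro ⟨h1, h2⟩
    interval_cases φ <;> simp [ctN, mvN, exN] at h
  have : exN φ = false := by
    unfold ctN at h; simp at h; exact h.2
  rw [this]
  split_ifs <;> first | omega | simp_all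

theorem off_indep {φ : ℕ} (b : Bool) (D D' : ℤ) (hφ : φ ≤ 22) : off b D φ = off b D' φ := by
  unfold off
  split_ifs <;> first | rfl | omega

namespace Run
variable {c : ι × Bool → ℤ × Q L A.Γ} {C : ι → ℤ × Q L (up M A).Γ} {n : ℕ}

theorem sng (R : Run M A c C n) (E : Exp M A c C) (i : ι) (b : Bool) :
    Sng M A b n (trX M A c i b) (trM M A c i b) :=
  ⟨fun φ hφ => R.st φ hφ i b, E.ph i b⟩

theorem inj (R : Run M A c C n) (G : Good M (up M A) C) (hn : n ≤ 27) {φ : ℕ} (hφ : φ ≤ n)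
    (x y : ι × Bool) (h : ((nx M A)^[φ] c x).1 = ((nx M A)^[φ] c y).1) : x = y := by
  obtain ⟨i, b⟩ := x
  obtain ⟨j, b'⟩ := y
  have h1 := R.ps φ hφ i b
  have h2 := R.ps φ hφ j b'
  unfold trP at h1 h2
  rw [h1, h2] at h
  by_cases hij : i = j
  · subst hij
    by_cases hb : b' = b
    · rw [hb]
    · exfalso
      have : b' = !b := by cases b <;> cases b' <;> simp_all
      subst this
      exact off_bb b (dirQ (C i).2).toInt (show φ ≤ 27 by omega) (by linarith)
  · exfalso
    refine (geo (dir_cases _) (dir_cases _) (fun e => hij (G.inj _ _ e))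
      (fun e => hij (G.inj' _ _ e)) (G.cross i j) (G.cross j i) (by omega) b b').1 h

theorem msg_ct (R : Run M A c C n) (E : Exp M A c C) (G : Good M (up M A) C) (hn : n ≤ 27) {φ : ℕ}
    (hφ : φ ≤ n) (h27 : φ < 27) (hc : ctN φ = true) (i : ι) (b : Bool) :
    trM M A c i b φ = some (trX M A c i (!b) φ).w.o := by
  have p1 := (R.sng E i b).pos φ hφ
  have p2 := (R.sng E i (!b)).pos φ hφ
  have q1 := R.ps φ hφ i b
  have q2 := R.ps φ hφ i (!b)
  unfold trX at p1 p2
  unfold trP at q1 q2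
  refine msgC_some (R.inj G hn hφ) ?_ ?_ ?_
  · rw [q1, q2, p1]
    have := off_ct2 b (dirQ (C i).2).toInt h27 hc
    linarith
  · rw [p1, p2]; rfl
  · rw [p1, mvP_ph _ h27]
    unfold ctN at hc
    simp at hc
    exact hc.1

theorem chain (R : Run M A c C n) (E : Exp M A c C) (G : Good M (up M A) C) (hn : n ≤ 27) (i : ι) :
    Chain M A n (trX M A c i false) (trX M A c i true) (trM M A c i false) (trM M A c i true) where
  h0 := fun φ hφ => R.st φ hφ i false
  h1 := fun φ hφ => R.st φ hφ i true
  p0 := E.ph i false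
  p1 := E.ph i true
  c0 := fun φ hφ hc => R.msg_ct E G hn hφ.le (by omega) hc i false
  c1 := fun φ hφ hc => R.msg_ct E G hn hφ.le (by omega) hc i true

theorem mpos (E : Exp M A c C) (i : ι) : (trX M A c i false 0).s.pos = (C i).2.pos := by
  rw [← E.mac i]; rfl
theorem mw (E : Exp M A c C) (i : ι) : (trX M A c i false 0).s.w = (C i).2.w := by
  rw [← E.mac i]; rfl

theorem sd_ex {φ : ℕ} (b : Bool) (h : φ = 5 ∨ φ = 6) : sd (b, ph φ) = if b then 1 else -1 := by
  rcases h with rfl | rfl <;> cases b <;> rfl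

/-- messages during the exchange -/
theorem msg_ex (R : Run M A c C n) (E : Exp M A c C) (G : Good M (up M A) C) (hn : n ≤ 27)
    {φ : ℕ} (h56 : φ = 5 ∨ φ = 6) (hφ : φ ≤ n) (i j : ι) (b : Bool)
    (hj : (C j).1 = (C i).1 + if b then 1 else -1) :
    trM M A c i b φ = some (trX M A c j (!b) φ).w.o := by
  have p1 := (R.sng E i b).pos φ hφ
  have p2 := (R.sng E j (!b)).pos φ hφ
  have q1 := R.ps φ hφ i b
  have q2 := R.ps φ hφ j (!b)
  unfold trX at p1 p2
  unfold trP at q1 q2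
  refine msgC_some (R.inj G hn hφ) ?_ ?_ ?_
  · rw [q1, q2, p1, hj, sd_ex b h56]
    rcases h56 with rfl | rfl <;> cases b <;> simp [off, bit] <;> ring
  · rw [p1, p2]; rfl
  · rw [p1, mvP_ph _ (by omega)]
    rcases h56 with rfl | rfl <;> rfl

theorem msg_ex_none (R : Run M A c C n) (E : Exp M A c C)
    {φ : ℕ} (h56 : φ = 5 ∨ φ = 6) (hφ : φ ≤ n) (i : ι) (b : Bool)
    (hj : ∀ j, (C j).1 ≠ (C i).1 + if b then 1 else -1) :
    trM M A c i b φ = none := by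
  have p1 := (R.sng E i b).pos φ hφ
  have q1 := R.ps φ hφ i b
  unfold trX at p1
  unfold trP at q1
  refine msgC_none ?_
  rintro ⟨j, b'⟩ h1 h2
  have p2 := (R.sng E j b').pos φ hφ
  have q2 := R.ps φ hφ j b'
  unfold trX at p2
  unfold trP at q2
  rw [p1, p2] at h2
  simp only [flipP, Prod.mk.injEq, and_true] at h2
  subst h2
  rw [q1, q2, p1, sd_ex b h56] at h1
  apply hj j
  rcases h56 with rfl | rfl <;> cases b <;> simp [off, bit] at h1 ⊢ <;> omega

theorem read56 (R : Run M A c C n) (E : Exp M A c C) (G : Good M (up M A) C) (hn : n ≤ 27)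
    (h14 : 14 ≤ n) (i : ι) (b : Bool) :
    (trX M A c i b 5).w.o = (C i).2.w.o ∧ (trX M A c i b 6).w.o.pos = (C i).2.pos := by
  have h := R.chain E G hn i
  rw [← mpos E, ← mw E]
  cases b
  · exact ⟨(h.segC0 h14).2.2.1, (h.segC0 h14).2.2.2.1⟩
  · exact ⟨(h.segC1 h14).2.1, (h.segC1 h14).2.2.1⟩

theorem mac_msg (R : Run M A c C n) (E : Exp M A c C) (G : Good M (up M A) C) (hn : n ≤ 27)
    (h14 : 14 ≤ n) (i : ι) :
    msgM M (trX M A c i false 0).s.pos (trM M A c i false 5) (trM M A c i false 6)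
      (trM M A c i true 5) (trM M A c i true 6) = msgC C i := by
  rw [mpos E]
  obtain ⟨b, hb⟩ : ∃ b : Bool, sd (C i).2.pos = if b then 1 else -1 := by
    rcases sd_cases (C i).2.pos with h1 | h1
    · exact ⟨true, h1⟩
    · exact ⟨false, h1⟩
  rw [msgM_b _ b hb (trM M A c i false) (trM M A c i true) (trM M A c i b) (by cases b <;> rfl)]
  by_cases hj : ∃ j, (C j).1 = (C i).1 + if b then 1 else -1
  · obtain ⟨j, hj⟩ := hj
    rw [R.msg_ex E G hn (Or.inl rfl) (by omega) i j b hj,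
      R.msg_ex E G hn (Or.inr rfl) (by omega) i j b hj]
    simp only [Option.isSome_some, Option.getD_some, true_and]
    rw [(R.read56 E G hn h14 j (!b)).1, (R.read56 E G hn h14 j (!b)).2]
    split_ifs with hc
    · exact (msgC_some G.inj (by rw [hj, hb]) hc.1 hc.2).symm
    · by_cases hm : mvP (C i).2.pos = true
      · rw [msgC_mv hm]
      · rw [msgC_none]
        intro k h1 h2
        obtain rfl := G.inj k j (by rw [h1, hj, hb])
        exact hc ⟨h2, by simpa using hm⟩
  · push Not at hj
    rw [R.msg_ex_none E (Or.inr rfl) (by omega) i b hj]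
    rw [if_neg (by simp), msgC_none]
    intro j h1 _
    exact hj j (by rw [h1, hb])

theorem succ (R : Run M A c C n) (E : Exp M A c C) (G : Good M (up M A) C) (hn : n < 27)
    (hh : M.hlt (A.run A.cur M.u0).2 = false) : Run M A c C (n + 1) := by
  have hst : ∀ i b, step M A (trX M A c i b n) (trM M A c i b n) =
      some (trX M A c i b (n + 1)) := by
    intro i b
    have key : step M A (trX M A c i b n) (trM M A c i b n) ≠ none := by
      intro hs
      unfold step at hs
      rw [Option.map_eq_none_iff] at hs
      have hch := R.chain E G hn.le i
      have d26 : n = 26 → ((trM M A c i b n).getD (dflt M)).dr = (trX M A c i b n).w.d := by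
        intro e
        rw [R.msg_ct E G hn.le le_rfl hn (by rw [e]; rfl), Option.getD_some]
        obtain ⟨w1, -, -, f1, f2, f3, f4⟩ := hch.seg22 (by omega)
        have g1 := (R.sng E i b).dconst (φ := n) le_rfl (by omega) (by omega)
        have g2 := (R.sng E i (!b)).dconst (φ := n) le_rfl (by omega) (by omega)
        rw [g1.1, g2.2]
        clear g1 g2 hs hch e
        cases b
        · rw [Bool.not_false, f1, f4]
        · rw [Bool.not_true, f2, f3]
      unfold act at hs
      rw [(R.sng E i b).pos n le_rfl] at hs
      split_ifs at hs with h1 h2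
      · have hc : ctN n = true := by
          simp only [ctP, mvP_ph _ hn, exP_ph _ hn, Bool.and_eq_true] at h1
          unfold ctN
          rw [h1.1.1, h1.1.2]; rfl
        rw [R.msg_ct E G hn.le le_rfl hn hc] at h1
        simp at h1
      · simp only at h2
        subst h2
        simp only [ph_val hn] at hs
        rcases act1_none hs with ⟨e, h3⟩ | ⟨e, h3⟩
        · subst e
          rw [hch.hltVal le_rfl, hh] at h3
          simp at h3
        · exact h3 (d26 e)
      · simp only [Bool.not_eq_true] at h2
        subst h2
        simp only [ph_val hn] at hs
        rcases act0_none hs with ⟨e, h3⟩ | ⟨e, h3⟩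
        · subst e
          rw [hch.alive17 le_rfl, R.mac_msg E G (by omega) (by omega), mpos E, mw E] at h3
          have := G.ok i
          unfold step at this
          rw [Option.map_eq_some_iff] at this
          obtain ⟨w, hw, -⟩ := this
          rw [hw] at h3
          simp at h3
        · exact h3 (d26 e)
    obtain ⟨y, hy⟩ := Option.ne_none_iff_exists'.1 key
    rw [hy]
    unfold trX trM at *
    rw [Function.iterate_succ_apply']
    simp only [nx, hy, Option.getD_some]
  refine ⟨fun φ hφ i b => ?_, fun φ hφ i b => ?_⟩
  · by_cases e : φ = n
    · subst e; exact hst i b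
    · exact R.st φ (by omega) i b
  · by_cases e : φ = n + 1
    · subst e
      have h1 := R.ps n le_rfl i b
      have h2 := (R.sng E i b).dir (φ := n) le_rfl hn
      have h3 : trP M A c i b (n + 1) = trP M A c i b n + (dirQ (trX M A c i b n)).toInt := by
        unfold trP trX
        rw [Function.iterate_succ_apply']
        rfl
      rw [h3, h2, h1]
      by_cases h22 : n < 22
      · rw [off_indep b (trX M A c i b 22).w.d.toInt (dirQ (C i).2).toInt (show n + 1 ≤ 22 by omega),
          off_indep b (trX M A c i b 22).w.d.toInt (dirQ (C i).2).toInt (show n ≤ 22 by omega)]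
        ring
      · obtain ⟨w1, -, -, f1, f2, -⟩ := (R.chain E G hn.le i).seg22 (by omega)
        have : (trX M A c i b 22).w.d = dirQ (C i).2 := by
          unfold dirQ
          rw [← mpos E, ← mw E]
          cases b
          · exact f1
          · exact f2
        rw [this]
        ring
    · exact R.ps φ (by omega) i b

theorem all (E : Exp M A c C) (G : Good M (up M A) C)
    (hh : M.hlt (A.run A.cur M.u0).2 = false) : ∀ n ≤ 27, Run M A c C n := by
  intro n
  induction n with
  | zero =>
    intro _
    refine ⟨fun φ hφ => by omega, fun φ hφ i b => ?_⟩
    obtain rfl : φ = 0 := by omega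
    have := E.pos i b
    simp only [trP, off, Function.iterate_zero, id]
    simp [this]
  | succ n ih => intro hn; exact (ih (by omega)).succ E G (by omega) hh

theorem good (R : Run M A c C 27) (E : Exp M A c C) (G : Good M (up M A) C) {φ : ℕ} (hφ : φ < 27) :
    Good M A ((nx M A)^[φ] c) where
  inj := R.inj G le_rfl hφ.le
  inj' := by
    have := R.inj G le_rfl (φ := φ + 1) (by omega)
    rw [Function.iterate_succ_apply'] at this
    exact this
  ok := by
    rintro ⟨i, b⟩
    have := R.st φ hφ i b
    unfold trX trM at this
    rw [Function.iterate_succ_apply'] at this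
    exact this
  cross := by
    rintro ⟨i, b⟩ ⟨j, b'⟩ h1 h2 h3
    have e1 : ∀ i b, (dirQ ((nx M A)^[φ] c (i, b)).2).toInt =
        off b (dirQ (C i).2).toInt (φ + 1) - off b (dirQ (C i).2).toInt φ := by
      intro i b
      have a1 := R.ps φ hφ.le i b
      have a2 := R.ps (φ + 1) (by omega) i b
      have a3 : trP M A c i b (φ + 1) = trP M A c i b φ + (dirQ (trX M A c i b φ)).toInt := by
        unfold trP trX
        rw [Function.iterate_succ_apply']
        rfl
      change (dirQ (trX M A c i b φ)).toInt = _
      linarith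
    have q1 := R.ps φ hφ.le i b
    have q2 := R.ps φ hφ.le j b'
    unfold trP at q1 q2
    rw [q1, q2] at h3
    rw [e1] at h1 h2
    by_cases hij : i = j
    · subst hij
      have : b' = !b := by
        by_contra hb
        have : b' = b := by cases b <;> cases b' <;> simp_all
        subst this; omega
      subst this
      have hc : φ = 4 ∨ φ = 13 ∨ (φ ≠ 4 ∧ φ ≠ 13) := by omega
      rcases hc with rfl | rfl | ⟨n1, n2⟩
      · clear q1 q2 e1
        cases b
        · simp [off, bit] at h1
        · simp only [off, bit] at h3
          norm_num at h3
          omega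
      · clear q1 q2 e1
        cases b
        · simp only [off, bit] at h3
          norm_num at h3
          omega
        · simp [off, bit] at h1
      · have : off b (dirQ (C i).2).toInt (φ + 1) - off b (dirQ (C i).2).toInt φ =
            off (!b) (dirQ (C i).2).toInt (φ + 1) - off (!b) (dirQ (C i).2).toInt φ := by
          unfold off
          split_ifs <;> first | omega | rfl
        omega
    · exact (geo (dir_cases _) (dir_cases _) (fun e => hij (G.inj _ _ e))
        (fun e => hij (G.inj' _ _ e)) (G.cross i j) (G.cross j i) (by omega) b b').2 hφ h1 h2 h3

theorem exp (R : Run M A c C 27) (E : Exp M A c C) (G : Good M (up M A) C) :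
    Exp M A ((nx M A)^[27] c) (nx M (up M A) C) where
  pos := fun i b => by
    have := R.ps 27 le_rfl i b
    unfold trP at this
    rw [this]
    simp only [nx, off]
    norm_num
    ring
  ph := fun i b => (R.sng E i b).pos 27 le_rfl
  mac := fun i => by
    have h := (R.chain E G le_rfl i).macStep
    rw [R.mac_msg E G le_rfl (by omega)] at h
    have e : SimCA.mac M A (trX M A c i false 0) (trX M A c i true 0) = (C i).2 := E.mac i
    rw [e, G.ok i] at h
    exact (Option.some.inj h).symm

end Run

end SimCA
end

section
namespace SimCA

variable {L : Type} {M : Mealy L} {A : Alg L} {ι : Type}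

/-- a default worker -/
def wk0 (M : Mealy L) : Wk L :=
  ⟨dflt M, dflt M, dflt M, dflt M, dflt M, dflt M, dflt M, dflt M, .nop, .nop, .z⟩

theorem exists_exp (C : ι → ℤ × Q L (up M A).Γ) : ∃ c : ι × Bool → ℤ × Q L A.Γ, Exp M A c C := by
  refine ⟨fun x => (4 * (C x.1).1 + bit x.2, ⟨(x.2, 0), wk0 M,
    if x.2 then (C x.1).2.s else ⟨(C x.1).2.pos, (C x.1).2.w, (C x.1).2.g.2⟩, (C x.1).2.g.1⟩), ?_⟩
  exact ⟨fun i b => rfl, fun i b => rfl, fun i => rfl⟩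

theorem descend1 (hh : M.hlt (A.run A.cur M.u0).2 = false) (C : ι → ℤ × Q L (up M A).Γ) (n : ℕ)
    (h : ∀ t < n, Good M (up M A) ((nx M (up M A))^[t] C)) :
    ∃ c : ι × Bool → ℤ × Q L A.Γ, ∀ t < 27 * n, Good M A ((nx M A)^[t] c) := by
  obtain ⟨c, hc⟩ := exists_exp C
  refine ⟨c, ?_⟩
  have key : ∀ m ≤ n, Exp M A ((nx M A)^[27 * m] c) ((nx M (up M A))^[m] C) := by
    intro m
    induction m with
    | zero => intro _; exact hc
    | succ m ih =>
      intro hm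
      have E := ih (by omega)
      have G := h m (by omega)
      have R := Run.all E G hh 27 le_rfl
      have := R.exp E G
      rw [← Function.iterate_add_apply] at this
      rw [Function.iterate_succ_apply']
      rw [show 27 * (m + 1) = 27 + 27 * m by ring]
      exact this
  intro t ht
  have E := key (t / 27) (by omega)
  have G := h (t / 27) (by omega)
  have R := Run.all E G hh 27 le_rfl
  have := R.good E G (φ := t % 27) (by omega)
  rw [← Function.iterate_add_apply] at this
  rwa [show t % 27 + 27 * (t / 27) = t by omega] at this

theorem descend (hh : ∀ k, hltK M A k = false) (k : ℕ) : ∀ (ι : Type) (_ : Nonempty ι)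
    (C : ι → ℤ × Q L (algK M A k).Γ) (n : ℕ)
    (_ : ∀ t < n, Good M (algK M A k) ((nx M (algK M A k))^[t] C)),
    ∃ (ι' : Type) (_ : Nonempty ι') (c : ι' → ℤ × Q L A.Γ),
      ∀ t < 27 ^ k * n, Good M A ((nx M A)^[t] c) := by
  induction k with
  | zero => intro ι hι C n h; exact ⟨ι, hι, C, fun t ht => h t (by simpa using ht)⟩
  | succ k ih =>
    intro ι hι C n h
    obtain ⟨c, hc⟩ := descend1 (A := algK M A k) (hh k) C n h
    obtain ⟨ι', h', c', hc'⟩ := ih (ι × Bool) inferInstance c (27 * n) hc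
    refine ⟨ι', h', c', fun t ht => hc' t ?_⟩
    rw [pow_succ] at ht
    linarith

theorem not_nil (hh : ∀ k, hltK M A k = false) (T : ℕ) :
    ∃ η : ℕ → ℤ → Option (Q L A.Γ), Orb M A η ∧ ∃ a, η T a ≠ none := by
  let k := T
  let q : Q L (algK M A k).Γ := ⟨(false, 5), wk0 M, ⟨(false, 0), wk0 M, M.b0⟩, (algK M A k).cur⟩
  let C : Unit → ℤ × Q L (algK M A k).Γ := fun _ => (0, q)
  have hG : Good M (algK M A k) C := by
    refine ⟨fun _ _ _ => rfl, fun _ _ _ => rfl, ?_, ?_⟩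
    · intro _ _ h
      have : (dirQ (C PUnit.unit).2).toInt = 0 := rfl
      change (dirQ (C PUnit.unit).2).toInt = 1 at h
      rw [this] at h
      exact absurd h (by decide)
    · intro i
      obtain ⟨y, hy⟩ : ∃ y, step M (algK M A k) (C i).2 (msgC C i) = some y := ⟨_, rfl⟩
      rw [hy]
      simp only [nx, hy, Option.getD_some]
  obtain ⟨ι', ⟨i⟩, c, hc⟩ := descend hh k Unit ⟨()⟩ C 1 (by
    intro t ht
    obtain rfl : t = 0 := by omega
    exact hG)
  have h27 : T < 27 ^ k := Nat.lt_pow_self (by omega)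
  exact orb_of_good c (hc 0 (by positivity)).inj i T fun t ht => hc t (by omega)

theorem nil_iff : (∃ T, ∀ η : ℕ → ℤ → Option (Q L A.Γ), Orb M A η → ∀ i, η T i = none) ↔
    ∃ k, hltK M A k = true := by
  constructor
  · rintro ⟨T, hT⟩
    by_contra h
    push Not at h
    obtain ⟨η, H, a, ha⟩ := not_nil (M := M) (A := A) (fun k => by simpa using h k) T
    exact ha (hT η H a)
  · rintro ⟨k, hk⟩
    exact nil_of_hlt hk

end SimCA
end

section
namespace SimCA
open Turing

def bitG : Bool → PartrecToTM2.Γ'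
  | true => .bit1
  | false => .bit0

theorem trPosNum_bits (n : PosNum) : PartrecToTM2.trPosNum n = (n : ℕ).bits.map bitG := by
  induction n with
  | one => simp [PartrecToTM2.trPosNum, bitG]
  | bit0 n ih =>
    have hn : (n : ℕ) ≠ 0 := (PosNum.cast_pos n).ne'
    rw [PartrecToTM2.trPosNum, ih, PosNum.cast_bit0, ← two_mul, Nat.bit0_bits _ hn]
    rfl
  | bit1 n ih =>
    rw [PartrecToTM2.trPosNum, ih, PosNum.cast_bit1, ← two_mul, Nat.bit1_bits]
    rfl

theorem trNat_bits (n : ℕ) : PartrecToTM2.trNat n = n.bits.map bitG := by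
  unfold PartrecToTM2.trNat
  have h := Num.to_of_nat n
  generalize (n : Num) = m at h
  cases m with
  | zero => subst h; rfl
  | pos m => subst h; exact trPosNum_bits m

theorem exists_code : ∃ c : ToPartrec.Code, ∀ p : ℕ,
    (c.eval [p]).Dom ↔ ((Denumerable.ofNat Nat.Partrec.Code p).eval 0).Dom := by
  have h1 : Partrec fun p : ℕ => (Denumerable.ofNat Nat.Partrec.Code p).eval 0 := by
    exact Nat.Partrec.Code.eval_part.comp (Computable.ofNat _) (Computable.const 0)
  obtain ⟨c, hc⟩ := ToPartrec.Code.exists_code (Nat.Partrec'.part_iff₁.2 h1)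
  refine ⟨c, fun p => ?_⟩
  have := hc (p ::ᵥ List.Vector.nil)
  rw [show ([p] : List ℕ) = (p ::ᵥ List.Vector.nil : List.Vector ℕ 1).1 from rfl, this]
  rfl

/-- the input tape on number `p` -/
def inp {Γ : Type} (g : Γ × Γ × Γ) (p : ℕ) : List Γ :=
  g.1 :: (p.bits.reverse.map fun b => if b then g.2.2 else g.2.1)

theorem exists_TM : ∃ (Γ Λ : Type) (_ : Inhabited Γ) (_ : Finite Γ) (_ : Inhabited Λ) (_ : Finite Λ)
    (N : TM0.Machine Γ Λ) (g : Γ × Γ × Γ), ∀ p : ℕ,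
    (StateTransition.eval (TM0.step N) (TM0.init (inp g p))).Dom ↔
      ((Denumerable.ofNat Nat.Partrec.Code p).eval 0).Dom := by
  classical
  obtain ⟨c, hc⟩ := exists_code
  letI i1 : Inhabited PartrecToTM2.Λ' := ⟨PartrecToTM2.trNormal c .halt⟩
  letI i2 : Inhabited (Option PartrecToTM2.Γ') := ⟨none⟩
  let S2 := PartrecToTM2.codeSupp c .halt
  have s2 : TM2.Supports PartrecToTM2.tr S2 := PartrecToTM2.tr_supports c .halt
  let M1 := TM2to1.tr PartrecToTM2.tr
  have s1 : TM1.Supports M1 (TM2to1.trSupp PartrecToTM2.tr S2) := TM2to1.tr_supports _ s2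
  let N := TM1to0.tr M1
  have s0 : TM0.Supports N ↑(TM1to0.trStmts M1 (TM2to1.trSupp PartrecToTM2.tr S2)) :=
    TM1to0.tr_supports M1 s1
  let T := TM1to0.trStmts M1 (TM2to1.trSupp PartrecToTM2.tr S2)
  let U : PartrecToTM2.Γ' → (∀ k : PartrecToTM2.K', Option PartrecToTM2.Γ') :=
    fun a => Function.update (fun _ => none) .main (some a)
  letI i3 : Inhabited T := ⟨⟨default, s0.1⟩⟩
  let g₁ : PointedMap (TM1to0.Λ' M1) T :=
    ⟨fun q => if h : q ∈ T then ⟨q, h⟩ else default, by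
      have : (default : TM1to0.Λ' M1) ∈ T := s0.1
      simp only [this, dif_pos]; rfl⟩
  let id1 : PointedMap (TM2to1.Γ' PartrecToTM2.K' fun _ => PartrecToTM2.Γ')
    (TM2to1.Γ' PartrecToTM2.K' fun _ => PartrecToTM2.Γ') := ⟨id, rfl⟩
  have resp := TM0.Machine.map_respects N id1 id1 g₁ (fun q : T => q.1) s0 (fun _ => rfl)
    (fun q hq => by
      have : q ∈ T := hq
      simp [g₁, this])
  have hfin : Finite (TM2to1.Γ' PartrecToTM2.K' fun _ => PartrecToTM2.Γ') := by
    letI : Fintype PartrecToTM2.K' := ⟨{.main, .rev, .aux, .stack}, by intro x; cases x <;> simp⟩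
    letI : Fintype PartrecToTM2.Γ' := ⟨{.consₗ, .cons, .bit0, .bit1}, by intro x; cases x <;> simp⟩
    have := (TM2to1.Γ'.fintype (K := PartrecToTM2.K') (Γ := fun _ => PartrecToTM2.Γ'))
    exact Finite.of_fintype _
  refine ⟨TM2to1.Γ' PartrecToTM2.K' fun _ => PartrecToTM2.Γ', T, inferInstance,
    hfin, inferInstance, inferInstance, N.map id1 id1 g₁ (fun q : T => q.1),
    ((true, U .cons), (false, U .bit0), (false, U .bit1)), fun p => ?_⟩
  rw [← hc]
  have e1 : (StateTransition.eval (TM2.step PartrecToTM2.tr) (PartrecToTM2.init c [p])).Dom ↔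
      (c.eval [p]).Dom := by
    rw [PartrecToTM2.tr_eval]; rfl
  rw [← e1]
  have e2 : PartrecToTM2.init c [p] = TM2.init PartrecToTM2.K'.main (PartrecToTM2.trList [p]) := by
    unfold PartrecToTM2.init TM2.init
    congr 1
    funext k
    cases k <;> rfl
  have e3 := TM2to1.tr_eval_dom PartrecToTM2.tr PartrecToTM2.K'.main (PartrecToTM2.trList [p])
  rw [e2]
  change _ ↔ (TM2.eval PartrecToTM2.tr PartrecToTM2.K'.main (PartrecToTM2.trList [p])).Dom
  rw [← e3, ← TM1to0.tr_eval]
  change _ ↔ (StateTransition.eval (TM0.step N) _).Dom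
  refine StateTransition.tr_eval_dom resp ⟨s0.1, ?_⟩
  rw [TM0.map_init]
  congr 1
  simp only [PartrecToTM2.trList, trNat_bits, TM2to1.trInit, inp]
  simp only [List.reverse_append, List.reverse_cons, List.reverse_nil, List.nil_append,
    List.cons_append, List.map_cons, List.headI, List.tail]
  have : (id1 : _ → _) = id := rfl
  rw [this, List.map_id]
  change (true, U PartrecToTM2.Γ'.cons) :: List.map (fun a => (false, U a)) _ = _
  congr 1
  rw [← List.map_reverse, List.map_map]
  refine List.map_congr_left fun b _ => ?_
  cases b <;> rfl

end SimCA
end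

section
namespace SimCA
open Turing

section TM
variable {Γ Λ : Type} [Inhabited Γ] [Inhabited Λ] (N : TM0.Machine Γ Λ)

abbrev Cell (Γ Λ : Type) := Γ × Option Λ

/-- one step of the machine with head position -/
def stp (x : TM0.Cfg Γ Λ × ℤ) : TM0.Cfg Γ Λ × ℤ :=
  match N x.1.q x.1.Tape.head with
  | none => x
  | some (q, .move .left) => (⟨q, x.1.Tape.move .left⟩, x.2 - 1)
  | some (q, .move .right) => (⟨q, x.1.Tape.move .right⟩, x.2 + 1)
  | some (q, .write a) => (⟨q, x.1.Tape.write a⟩, x.2)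

open Classical in
noncomputable def cellOf (x : TM0.Cfg Γ Λ × ℤ) (i : ℤ) : Cell Γ Λ :=
  (x.1.Tape.nth (i - x.2), if i = x.2 then some x.1.q else none)

/-- the local rule of the tape automaton -/
def G (a b c : Cell Γ Λ) : Cell Γ Λ :=
  match b.2 with
  | some q =>
    match N q b.1 with
    | none => b
    | some (_, .move _) => (b.1, none)
    | some (q', .write x) => (x, some q')
  | none =>
    match a.2.bind fun q => N q a.1 with
    | some (q', .move .right) => (b.1, some q')
    | _ =>
      match c.2.bind fun q => N q c.1 with
      | some (q', .move .left) => (b.1, some q')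
      | _ => b

def hd (a : Cell Γ Λ) : Bool :=
  match a.2 with
  | some q => (N q a.1).isNone
  | none => false

theorem cellOf_stp (x : TM0.Cfg Γ Λ × ℤ) (i : ℤ) :
    cellOf (stp N x) i = G N (cellOf x (i - 1)) (cellOf x i) (cellOf x (i + 1)) := by
  obtain ⟨⟨q, T⟩, h⟩ := x
  have hT : T.nth 0 = T.head := T.nth_zero
  have hmL : ∀ j, (T.move Turing.Dir.left).nth j = T.nth (j - 1) := fun j => Tape.move_left_nth T j
  have hmR : ∀ j, (T.move Turing.Dir.right).nth j = T.nth (j + 1) := fun j => Tape.move_right_nth T j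
  have hw : ∀ a j, (T.write a).nth j = if j = 0 then a else T.nth j :=
    fun a j => Tape.write_nth a T
  unfold stp
  rcases hN : N q T.head with _ | ⟨q', d | a⟩
  · simp only [hN, cellOf]
    by_cases h1 : i = h
    · simp [G, h1, hT, hN]
    · by_cases h2 : i - 1 = h
      · have : i + 1 ≠ h := by omega
        simp [G, h1, h2, hT, hN, this]
      · by_cases h3 : i + 1 = h
        · simp [G, h1, h2, hT, hN, h3]
        · simp [G, h1, h2, h3]
  · cases d
    · simp only [hN, cellOf, hmL]
      rw [show i - (h - 1) - 1 = i - h by ring]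
      by_cases h1 : i = h
      · have : h ≠ h - 1 := by omega
        simp [G, h1, hT, hN, this]
      · by_cases h2 : i - 1 = h
        · have : i + 1 ≠ h := by omega
          have : i ≠ h - 1 := by omega
          simp [G, h1, h2, hT, hN, *]
        · by_cases h3 : i + 1 = h
          · have : i = h - 1 := by omega
            simp only [G, if_neg h1, if_neg h2, if_pos h3, if_pos this, h3, sub_self, hT, if_true,
              Option.bind_some, Option.bind_none, hN]
          · have : i ≠ h - 1 := by omega
            simp [G, h1, h2, h3, this]
    · simp only [hN, cellOf, hmR]
      rw [show i - (h + 1) + 1 = i - h by ring]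
      by_cases h1 : i = h
      · have : h ≠ h + 1 := by omega
        simp [G, h1, hT, hN]
      · by_cases h2 : i - 1 = h
        · have : i = h + 1 := by omega
          simp only [G, if_neg h1, if_pos h2, if_pos this, h2, sub_self, hT, if_true,
              Option.bind_some, Option.bind_none, hN]
        · have : i ≠ h + 1 := by omega
          by_cases h3 : i + 1 = h
          · simp [G, h1, h2, hT, hN, h3, this]
          · simp [G, h1, h2, h3, this]
  · simp only [hN, cellOf, hw]
    by_cases h1 : i = h
    · simp [G, h1, hT, hN]
    · have h0 : i - h ≠ 0 := by omega
      by_cases h2 : i - 1 = h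
      · have : i + 1 ≠ h := by omega
        simp [G, h1, h2, hT, hN, this, h0]
      · by_cases h3 : i + 1 = h
        · simp [G, h1, h2, hT, hN, h3, h0]
        · simp [G, h1, h2, h3, h0]

/-- the space-time diagram -/
noncomputable def stt (l : List Γ) (n : ℕ) : TM0.Cfg Γ Λ × ℤ := (stp N)^[n] (TM0.init l, 0)

theorem stt_head (l : List Γ) (n : ℕ) : -(n : ℤ) ≤ (stt N l n).2 ∧ (stt N l n).2 ≤ n := by
  induction n with
  | zero => simp [stt]
  | succ n ih =>
    unfold stt at *
    rw [Function.iterate_succ_apply']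
    generalize (stp N)^[n] (TM0.init l, 0) = x at ih
    unfold stp
    split <;> push_cast <;> (try simp only) <;> omega

theorem nth_init (l : List Γ) (i : ℤ) :
    (TM0.init l : TM0.Cfg Γ Λ).Tape.nth i = if 0 ≤ i then l.getI i.toNat else default := by
  unfold TM0.init Tape.mk₁ Tape.mk₂
  split_ifs with h
  · obtain ⟨n, rfl⟩ := Int.eq_ofNat_of_zero_le h
    rw [Tape.mk'_nth_nat, ListBlank.nth_mk]; rfl
  · obtain ⟨n, rfl⟩ := Int.eq_negSucc_of_lt_zero (not_le.1 h)
    show (ListBlank.mk ([] : List Γ)).nth n = default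
    rw [ListBlank.nth_mk]; rfl

theorem cellOf_far (l : List Γ) (n : ℕ) (i : ℤ) (hi : i < -n ∨ (n : ℤ) < i) :
    cellOf (stt N l n) i = (if 0 ≤ i then l.getI i.toNat else default, none) := by
  induction n generalizing i with
  | zero =>
    rw [← nth_init (Λ := Λ)]
    have : i ≠ 0 := by omega
    simp [cellOf, stt, this]
  | succ n ih =>
    have h1 := ih (i - 1) (by omega)
    have h2 := ih i (by omega)
    have h3 := ih (i + 1) (by omega)
    have : stt N l (n + 1) = stp N (stt N l n) := by
      unfold stt; rw [Function.iterate_succ_apply']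
    rw [this, cellOf_stp, h1, h2, h3]
    simp [G]

theorem step_iff (x : TM0.Cfg Γ Λ × ℤ) :
    (TM0.step N x.1 = none ∧ N x.1.q x.1.Tape.head = none ∧ stp N x = x) ∨
    (TM0.step N x.1 = some (stp N x).1 ∧ N x.1.q x.1.Tape.head ≠ none) := by
  obtain ⟨⟨q, T⟩, h⟩ := x
  rcases hN : N q T.head with _ | ⟨q', (_ | _) | a⟩ <;> simp [TM0.step, stp, hN]

theorem halt_iff (l : List Γ) : (StateTransition.eval (TM0.step N) (TM0.init l)).Dom ↔
    ∃ n, N (stt N l n).1.q (stt N l n).1.Tape.head = none := by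
  constructor
  · intro h
    obtain ⟨h1, h2⟩ := StateTransition.mem_eval.1 (Part.get_mem h)
    generalize Part.get _ h = b at h1 h2
    have : ∃ n, (stt N l n).1 = b := by
      clear h2
      induction h1 with
      | refl => exact ⟨0, rfl⟩
      | tail _ h3 ih =>
        obtain ⟨n, hn⟩ := ih
        refine ⟨n + 1, ?_⟩
        rcases step_iff N (stt N l n) with ⟨h4, _⟩ | ⟨h4, _⟩
        · rw [hn, h3] at h4; simp at h4
        · rw [hn, h3] at h4
          have := Option.some.inj h4
          rw [this]
          unfold stt; rw [Function.iterate_succ_apply']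
    obtain ⟨n, hn⟩ := this
    refine ⟨n, ?_⟩
    rcases step_iff N (stt N l n) with ⟨h4, h5, _⟩ | ⟨h4, _⟩
    · exact h5
    · rw [hn, h2] at h4; simp at h4
  · rintro ⟨n, hn⟩
    have key : ∀ n, StateTransition.Reaches (TM0.step N) (TM0.init l) (stt N l n).1 := by
      intro n
      induction n with
      | zero => exact Relation.ReflTransGen.refl
      | succ n ih =>
        have e : stt N l (n + 1) = stp N (stt N l n) := by
          unfold stt; rw [Function.iterate_succ_apply']
        rcases step_iff N (stt N l n) with ⟨h4, h5, h6⟩ | ⟨h4, _⟩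
        · rw [e, h6]; exact ih
        · rw [e]; exact ih.tail h4
    rcases step_iff N (stt N l n) with ⟨h4, h5, h6⟩ | ⟨h4, h5⟩
    · have : (stt N l n).1 ∈ StateTransition.eval (TM0.step N) (TM0.init l) :=
        StateTransition.mem_eval.2 ⟨key n, h4⟩
      exact Part.dom_iff_mem.2 ⟨_, this⟩
    · exact absurd hn h5

end TM
end SimCA
end

section
namespace SimCA
open Turing

/-- the trivial ground algebra -/
def A0 (L : Type) : Alg L := ⟨Unit, fun _ l => ((), l), ()⟩

section Gen
variable {L : Type} (M : Mealy L)

/-- the letters stored on the levels -/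
def gl : (k : ℕ) → (algK M (A0 L) k).Γ → ℕ → L
  | 0, _, _ => M.b0
  | k + 1, g, j => if j = k then g.2 else gl k g.1 j

/-- the carry -/
def crr (l : L) (w : ℕ → L) : ℕ → L
  | 0 => l
  | j + 1 => M.d2 (w j) (crr l w j)

theorem crr_congr (l : L) (w w' : ℕ → L) (k : ℕ) (h : ∀ j < k, w j = w' j) :
    crr M l w k = crr M l w' k := by
  induction k with
  | zero => rfl
  | succ k ih => simp only [crr]; rw [h k (by omega), ih fun j hj => h j (by omega)]

theorem run_cr (k : ℕ) (g : (algK M (A0 L) k).Γ) (l : L) :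
    ((algK M (A0 L) k).run g l).2 = crr M l (gl M k g) k := by
  induction k with
  | zero => rfl
  | succ k ih =>
    change M.d2 g.2 ((algK M (A0 L) k).run g.1 l).2 = _
    rw [ih]
    simp only [crr, gl, if_true]
    congr 1
    exact crr_congr _ _ _ _ _ fun j hj => by rw [if_neg (by omega)]

theorem run_gl (k : ℕ) (g : (algK M (A0 L) k).Γ) (l : L) (j : ℕ) (hj : j < k) :
    gl M k ((algK M (A0 L) k).run g l).1 j = M.d1 (gl M k g j) (crr M l (gl M k g) j) := by
  induction k with
  | zero => omega
  | succ k ih =>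
    have e : crr M l (gl M (k + 1) g) j = crr M l (gl M k g.1) j :=
      crr_congr _ _ _ _ _ fun i hi => by simp only [gl]; rw [if_neg (by omega)]
    rw [e]
    by_cases h : j = k
    · subst h
      simp only [gl, if_true]
      change M.d1 g.2 ((algK M (A0 L) j).run g.1 l).2 = _
      rw [run_cr]
    · simp only [gl, if_neg h]
      exact ih g.1 (by omega)

/-- the stored word of the current state -/
def Wd (k : ℕ) : ℕ → L := gl M k (algK M (A0 L) k).cur

theorem Wd_succ (k j : ℕ) (hj : j ≤ k) : Wd M (k + 1) j =
    M.d1 (if j = k then M.b0 else Wd M k j) (crr M M.u0 (Wd M k) j) := by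
  by_cases h : j = k
  · subst h
    simp only [Wd, gl, if_true]
    change M.d1 M.b0 ((algK M (A0 L) j).run _ M.u0).2 = _
    rw [run_cr]
  · rw [if_neg h]
    simp only [Wd, gl, if_neg h]
    exact run_gl _ _ _ _ _ (by omega)

theorem hltK_eq (k : ℕ) : hltK M (A0 L) k = M.hlt (crr M M.u0 (Wd M k) k) := by
  unfold hltK; rw [run_cr]; rfl

end Gen

section Spec
variable {Γ Λ : Type} [Inhabited Γ] [Inhabited Λ] (N : TM0.Machine Γ Λ)

abbrev Fx (Γ Λ : Type) := Option (Option (Bool × Cell Γ Λ × Cell Γ Λ))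

def Hf (v : Fx Γ Λ) : Bool :=
  match v with
  | some (some (f, _, _)) => f
  | _ => false

def HH (a b c d : Cell Γ Λ) : Fx Γ Λ := some (some (false, G N a b c, G N b c d))

def F1 (z v : Fx Γ Λ) (i0 i1 : Γ) : Fx Γ Λ :=
  match z, v with
  | none, some none => some (some (false, (default, none), (i0, some default)))
  | none, some (some (_, a, b)) => HH N a b (i0, none) (i1, none)
  | some (some (_, c, d)), some none => HH N (default, none) (default, none) c d
  | some (some (_, c, d)), some (some (_, a, b)) => HH N a b c d
  | _, _ => none

def F2 (z v : Fx Γ Λ) : Fx Γ Λ :=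
  match z with
  | some (some (_, c, d)) => some (some (Hf v || hd N c || hd N d, c, d))
  | _ => none

structure Spec {L : Type} (M : Mealy L) (fx : L → Fx Γ Λ) (ct : L → ℕ) (m : ℕ)
    (ini : ℕ → Γ) : Prop where
  fb : fx M.b0 = none
  fu : fx M.u0 = some none
  cu : ct M.u0 = 0
  f1 : ∀ z v, fx (M.d1 z v) = F1 N (fx z) (fx v) (ini (ct v)) (ini (ct v + 1))
  c1 : ∀ z v, ct (M.d1 z v) = min (ct v + 1) m
  f2 : ∀ z v, fx (M.d2 z v) = F2 N (fx z) (fx v)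
  c2 : ∀ z v, ct (M.d2 z v) = ct z
  h : ∀ x, M.hlt x = Hf (fx x)

variable {L : Type} {M : Mealy L} {fx : L → Fx Γ Λ} {ct : L → ℕ} {m : ℕ} {l : List Γ}

theorem hd_cellOf (x : TM0.Cfg Γ Λ × ℤ) (i : ℤ) : hd N (cellOf x i) = true ↔
    i = x.2 ∧ N x.1.q x.1.Tape.head = none := by
  unfold hd cellOf
  by_cases h : i = x.2
  · simp [h]
  · simp [h]

variable {N}

theorem Spec.carry (H : Spec N M fx ct m fun c => l.getI c) (k : ℕ) (w : ℕ → L)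
    (hw : ∀ j < k + 1, fx (w j) = some (some (false, cellOf (stt N l k) (2 * j - (k + 1)),
      cellOf (stt N l k) (2 * j - (k + 1) + 1)))) (j : ℕ) (hj : j < k + 1) :
    ∃ b, fx (crr M M.u0 w (j + 1)) = some (some (b, cellOf (stt N l k) (2 * j - (k + 1)),
      cellOf (stt N l k) (2 * j - (k + 1) + 1))) ∧
      (b = true ↔ ∃ i : ℤ, -(k + 1) ≤ i ∧ i ≤ 2 * j - k ∧
        hd N (cellOf (stt N l k) i) = true) := by
  induction j with
  | zero =>
    refine ⟨Hf (some none : Fx Γ Λ) || hd N (cellOf (stt N l k) (2 * (0 : ℕ) - (k + 1))) ||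
      hd N (cellOf (stt N l k) (2 * (0 : ℕ) - (k + 1) + 1)), ?_, ?_⟩
    · simp only [crr]
      rw [H.f2, hw 0 (by omega), H.fu]
      simp only [F2]
    · simp only [Hf, Bool.false_or, Bool.or_eq_true]
      constructor
      · rintro (h | h)
        · exact ⟨_, by simp, by simp, h⟩
        · exact ⟨_, by simp, by simp, h⟩
      · rintro ⟨i, h1, h2, h3⟩
        have : i = 2 * ((0 : ℕ) : ℤ) - (k + 1) ∨ i = 2 * ((0 : ℕ) : ℤ) - (k + 1) + 1 := by
          omega
        rcases this with h | h
        · left; rw [← h]; exact h3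
        · right; rw [← h]; exact h3
  | succ j ih =>
    obtain ⟨b, h1, h2⟩ := ih (by omega)
    refine ⟨b || hd N (cellOf (stt N l k) (2 * (j + 1 : ℕ) - (k + 1))) ||
      hd N (cellOf (stt N l k) (2 * (j + 1 : ℕ) - (k + 1) + 1)), ?_, ?_⟩
    · rw [crr, H.f2, hw (j + 1) hj, h1]
      simp only [F2, Hf]
    · simp only [Hf, Bool.or_eq_true]
      rw [h2]
      constructor
      · rintro ((⟨i, h3, h4, h5⟩ | h) | h)
        · exact ⟨i, h3, by push_cast; omega, h5⟩
        · exact ⟨_, by push_cast; omega, by push_cast; omega, h⟩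
        · exact ⟨_, by push_cast; omega, by push_cast; omega, h⟩
      · rintro ⟨i, h3, h4, h5⟩
        have : i ≤ 2 * (j : ℤ) - k ∨ i = 2 * ((j + 1 : ℕ) : ℤ) - (k + 1) ∨
            i = 2 * ((j + 1 : ℕ) : ℤ) - (k + 1) + 1 := by
          push_cast at h4 ⊢; omega
        rcases this with h | h | h
        · left; left; exact ⟨i, h3, h, h5⟩
        · left; right; rw [← h]; exact h5
        · right; rw [← h]; exact h5

theorem stt_succ (k : ℕ) : stt N l (k + 1) = stp N (stt N l k) := by
  unfold stt; rw [Function.iterate_succ_apply']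

theorem Spec.inv (H : Spec N M fx ct m fun c => l.getI c) (hm : l.length ≤ m) (k : ℕ) :
    (∀ j < k + 1, fx (Wd M (k + 1) j) = some (some (false,
      cellOf (stt N l k) (2 * j - (k + 1)), cellOf (stt N l k) (2 * j - (k + 1) + 1)))) ∧
    ct (Wd M (k + 1) k) = min (k + 1) m := by
  induction k with
  | zero =>
    constructor
    · intro j hj
      obtain rfl : j = 0 := by omega
      rw [Wd_succ _ _ _ le_rfl, if_pos rfl, H.f1, H.fb]
      simp only [crr]
      rw [H.fu, H.cu]
      have e := nth_init (Λ := Λ) l 0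
      rw [Tape.nth_zero] at e
      simp [F1, cellOf, stt, nth_init, e]
      rfl
    · rw [Wd_succ _ _ _ le_rfl, H.c1]
      simp only [crr]
      rw [H.cu]
  | succ k ih =>
    obtain ⟨ih1, ih2⟩ := ih
    have hc := H.carry k _ ih1
    have ex : ∀ c : ℕ, l.getI (min (k + 1) m + c) = l.getI (k + 1 + c) := by
      intro c
      rcases le_total (k + 1) m with h | h
      · rw [min_eq_left h]
      · rw [min_eq_right h, List.getI_eq_default _ (by omega),
          List.getI_eq_default _ (by omega)]
    have hcell : ∀ i : ℤ, cellOf (stt N l (k + 1)) i = G N (cellOf (stt N l k) (i - 1))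
        (cellOf (stt N l k) i) (cellOf (stt N l k) (i + 1)) := by
      intro i; rw [stt_succ, cellOf_stp]
    constructor
    · intro j hj
      rw [Wd_succ _ _ _ (by omega), H.f1, hcell, hcell]
      by_cases h : j = k + 1
      · subst h
        rw [if_pos rfl, H.fb]
        obtain ⟨b, h1, -⟩ := hc k (by omega)
        rw [h1]
        have e : ct (crr M M.u0 (Wd M (k + 1)) (k + 1)) = min (k + 1) m := by
          simp only [crr]; rw [H.c2, ih2]
        rw [e]
        have e0 := ex 0
        rw [add_zero, add_zero] at e0
        rw [e0, ex 1]
        have f0 := cellOf_far N l k (k + 1 : ℕ) (by right; push_cast; omega)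
        have f1 := cellOf_far N l k (k + 1 + 1 : ℕ) (by right; push_cast; omega)
        rw [if_pos (by positivity), Int.toNat_natCast] at f0 f1
        simp only [F1, HH]
        rw [← f0, ← f1]
        push_cast
        ring_nf
      · rw [if_neg h, ih1 j (by omega)]
        rcases j with _ | j
        · simp only [crr]
          rw [H.fu]
          have f0 := cellOf_far N l k (-k - 3) (by left; omega)
          have f1 := cellOf_far N l k (-k - 2) (by left; omega)
          rw [if_neg (by omega)] at f0 f1
          simp only [F1, HH]
          have g0 : cellOf (stt N l k) (-k - 3) = cellOf (stt N l k) (-k - 2) := by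
            rw [f0, f1]
          rw [← f1]
          nth_rw 1 [← g0]
          push_cast
          ring_nf
        · obtain ⟨b, h1, -⟩ := hc j (by omega)
          rw [h1]
          simp only [F1, HH]
          push_cast
          ring_nf
    · rw [Wd_succ _ _ _ le_rfl, H.c1]
      simp only [crr]
      rw [H.c2, ih2]
      omega

theorem Spec.hlt_iff (H : Spec N M fx ct m fun c => l.getI c) (hm : l.length ≤ m) :
    (∃ k, hltK M (A0 L) k = true) ↔
      (StateTransition.eval (TM0.step N) (TM0.init l)).Dom := by
  rw [halt_iff]
  have key : ∀ k, hltK M (A0 L) (k + 1) = true ↔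
      N (stt N l k).1.q (stt N l k).1.Tape.head = none := by
    intro k
    rw [hltK_eq, H.h]
    obtain ⟨b, h1, h2⟩ := H.carry k _ (H.inv hm k).1 k (by omega)
    rw [h1]
    change b = true ↔ _
    rw [h2]
    simp only [hd_cellOf]
    have := stt_head N l k
    constructor
    · rintro ⟨i, -, -, -, h⟩; exact h
    · intro h; exact ⟨_, by omega, by omega, rfl, h⟩
  constructor
  · rintro ⟨k, hk⟩
    rcases k with _ | k
    · rw [hltK_eq, H.h] at hk
      simp only [crr] at hk
      rw [H.fu] at hk
      simp [Hf] at hk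
    · exact ⟨k, (key k).1 hk⟩
  · rintro ⟨k, hk⟩; exact ⟨k + 1, (key k).2 hk⟩

end Spec
end SimCA
end

section
namespace SimCA

variable {L L' : Type}

def V.mp (φ : L' → L) (v : V L') : V L := ⟨v.pos, v.op, v.dr, v.f, φ v.l⟩
def Wk.mp (φ : L' → L) (w : Wk L') : Wk L :=
  ⟨w.x.mp φ, w.o.mp φ, w.mO.mp φ, w.mP.mp φ, w.rO.mp φ, w.rP.mp φ, w.qO.mp φ, w.qP.mp φ,
    w.op, w.k, w.d⟩
def S.mp (φ : L' → L) (s : S L') : S L := ⟨s.pos, s.w.mp φ, φ s.z⟩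
def Q.mp (φ : L' → L) (q : Q L' Unit) : Q L Unit := ⟨q.pos, q.w.mp φ, q.s.mp φ, ()⟩

/-- letter maps compatible with the operations -/
structure LHom (M' : Mealy L') (M : Mealy L) (φ : L' → L) : Prop where
  b0 : φ M'.b0 = M.b0
  u0 : φ M'.u0 = M.u0
  d1 : ∀ x y, φ (M'.d1 x y) = M.d1 (φ x) (φ y)
  d2 : ∀ x y, φ (M'.d2 x y) = M.d2 (φ x) (φ y)

variable {M' : Mealy L'} {M : Mealy L} {φ : L' → L}

theorem LHom.dflt (H : LHom M' M φ) : (dflt M').mp φ = dflt M := by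
  simp [SimCA.dflt, V.mp, H.b0]

theorem LHom.getD (H : LHom M' M φ) (m : Option (V L')) :
    (m.map (V.mp φ)).getD (SimCA.dflt M) = (m.getD (SimCA.dflt M')).mp φ := by
  cases m <;> simp [H.dflt]

theorem selO_mp (w : Wk L') : selO (w.mp φ) = (selO w).mp φ := by
  unfold selO
  change (if sd w.x.pos = 1 then _ else _) = _
  split_ifs <;> rfl

theorem selV_mp (w : Wk L') : selV (w.mp φ) = selV w := by
  unfold selV selP
  change ((if sd w.x.pos = 1 then _ else _ : V L).f && decide ((if sd w.x.pos = 1 then _ else _ : V L).pos = flipP w.x.pos) && !mvP w.x.pos) = _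
  split_ifs <;> rfl

theorem act0_mp (H : LHom M' M φ) (n : ℕ) (m : Option (V L')) (w : Wk L') :
    act0 M n (m.map (V.mp φ)) (w.mp φ) = (act0 M' n m w).map (Wk.mp φ) := by
  unfold act0
  split
  all_goals try rfl
  · simp only [H.getD]; rfl
  · simp only [H.getD]; rw [Option.isSome_map]; rfl
  · simp only [H.getD]; rfl
  · simp only [H.getD]; rfl
  · rw [selV_mp, selO_mp]; rfl
  · change (if w.x.f = true then _ else _) = _
    split_ifs <;> rfl
  · change some (if w.k = .run then _ else if w.k = .cur then _ else _) = _
    split_ifs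
    · rfl
    · simp only [← H.u0]; rfl
    · rfl
  · change some (if isG w.k then _ else _) = _
    split_ifs
    · rfl
    · simp only [H.getD]; rfl
  · simp only [H.getD]
    change (if (m.getD (dflt M')).dr = w.d then _ else _) = _
    split_ifs <;> rfl

theorem act1_mp (H : LHom M' M φ) (n : ℕ) (m : Option (V L')) (w : Wk L')
    (hh : M.hlt (φ w.x.l) = M'.hlt w.x.l) :
    act1 M n (m.map (V.mp φ)) (w.mp φ) = (act1 M' n m w).map (Wk.mp φ) := by
  unfold act1
  split
  all_goals try rfl
  · simp only [← H.u0]; rfl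
  · change (if M.hlt (φ w.x.l) = true then _ else _) = _
    rw [hh]
    simp only [H.getD]
    split_ifs <;> rfl
  · simp only [H.getD]; rfl
  · simp only [H.getD]; rfl
  · simp only [H.getD]; rw [Option.isSome_map]; rfl
  · simp only [H.getD]; rfl
  · simp only [H.getD]; rfl
  · simp only [H.getD]
    change (if (m.getD (dflt M')).dr = w.d then _ else _) = _
    split_ifs <;> rfl

theorem act_mp (H : LHom M' M φ) (p : Pos) (m : Option (V L')) (w : Wk L')
    (hh : M.hlt (φ w.x.l) = M'.hlt w.x.l) :
    act M p (m.map (V.mp φ)) (w.mp φ) = (act M' p m w).map (Wk.mp φ) := by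
  unfold act
  rw [Option.isNone_map, act0_mp H, act1_mp H _ _ _ hh]
  split_ifs <;> rfl

theorem ex_mp (H : LHom M' M φ) (m : Option (V L')) (x : V L') (s : S L')
    (hh : M.hlt (φ s.w.x.l) = M'.hlt s.w.x.l) :
    ex M (m.map (V.mp φ)) (x.mp φ) (s.mp φ) = ((ex M' m x s).1.mp φ, (ex M' m x s).2.mp φ) := by
  unfold ex
  have := act_mp H s.pos m s.w hh
  change (match act M s.pos (m.map (V.mp φ)) (s.w.mp φ) with | none => _ | some w1 => _) = _
  rw [this]
  cases act M' s.pos m s.w <;> rfl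

theorem sto_mp (H : LHom M' M φ) (op : Op) (x : V L') (s : S L')
    (hh : M.hlt (φ s.w.x.l) = M'.hlt s.w.x.l) :
    sto M op (x.mp φ) (s.mp φ) = ((sto M' op x s).1.mp φ, (sto M' op x s).2.mp φ) := by
  cases op
  case exS => exact ex_mp H (some x) x s hh
  case exN => exact ex_mp H none x s hh
  case dl => 
    simp only [sto, V.mp, S.mp, H.d1, H.d2]
  case dlc =>
    simp only [sto, V.mp, S.mp, H.d1, H.b0]
  all_goals rfl

theorem gop_mp (op : Op) (x : V L') : gop (A0 L) op (x.mp φ) () =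
    ((gop (A0 L') op x ()).1.mp φ, ()) := by
  cases op <;> rfl

theorem step_mp (H : LHom M' M φ) (q : Q L' Unit) (m : Option (V L'))
    (hh : M.hlt (φ q.w.x.l) = M'.hlt q.w.x.l) (hs : M.hlt (φ q.s.w.x.l) = M'.hlt q.s.w.x.l) :
    step M (A0 L) (q.mp φ) (m.map (V.mp φ)) = (step M' (A0 L') q m).map (Q.mp φ) := by
  unfold step
  change (act M q.pos _ (q.w.mp φ)).map _ = _
  rw [act_mp H _ _ _ hh]
  cases act M' q.pos m q.w with
  | none => rfl
  | some w1 =>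
    simp only [Option.map_some]
    congr 1
    unfold fin
    have h1 := sto_mp H w1.op w1.x q.s hs
    have h2 := gop_mp (φ := φ) w1.op (sto M' w1.op w1.x q.s).1
    change (⟨_, { w1.mp φ with x := (gop (A0 L) w1.op (sto M w1.op (w1.x.mp φ) (q.s.mp φ)).1 ()).1 },
      (sto M w1.op (w1.x.mp φ) (q.s.mp φ)).2, _⟩ : Q L Unit) = _
    rw [h1, h2]
    rfl

theorem drO_mp (o : Option (Q L' Unit)) : drO (o.map (Q.mp φ)) = drO o := by
  cases o <;> rfl

theorem msg_mp (l r : Option (Q L' Unit)) (x : Q L' Unit) :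
    msg (l.map (Q.mp φ)) (x.mp φ) (r.map (Q.mp φ)) = (msg l x r).map (V.mp φ) := by
  unfold msg
  change (if mvP x.pos then _ else (if sd x.pos = 1 then _ else _ : Option (Q L Unit)).bind fun z =>
    if z.pos = flipP x.pos then _ else _) = _
  have : ∀ o : Option (Q L' Unit), ((o.map (Q.mp φ)).bind fun z =>
      if z.pos = flipP x.pos then some z.w.o else none) =
      (o.bind fun z => if z.pos = flipP x.pos then some z.w.o else none).map (V.mp φ) := by
    intro o
    cases o with
    | none => rfl
    | some z =>
      simp only [Option.map_some, Option.bind_some]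
      change (if z.pos = flipP x.pos then _ else _) = _
      split_ifs <;> rfl
  by_cases h1 : mvP x.pos
  · rw [if_pos h1, if_pos h1]; rfl
  · rw [if_neg h1, if_neg h1]
    by_cases h2 : sd x.pos = 1
    · rw [if_pos h2, if_pos h2]; exact this r
    · rw [if_neg h2, if_neg h2]; exact this l

theorem rule_mp (H : LHom M' M φ) (l c r : Option (Q L' Unit))
    (hl : ∀ q, q ∈ l → M.hlt (φ q.w.x.l) = M'.hlt q.w.x.l ∧
      M.hlt (φ q.s.w.x.l) = M'.hlt q.s.w.x.l)
    (hc : ∀ q, q ∈ c → M.hlt (φ q.w.x.l) = M'.hlt q.w.x.l ∧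
      M.hlt (φ q.s.w.x.l) = M'.hlt q.s.w.x.l)
    (hr : ∀ q, q ∈ r → M.hlt (φ q.w.x.l) = M'.hlt q.w.x.l ∧
      M.hlt (φ q.s.w.x.l) = M'.hlt q.s.w.x.l) :
    rule M (A0 L) (l.map (Q.mp φ)) (c.map (Q.mp φ)) (r.map (Q.mp φ)) =
      (rule M' (A0 L') l c r).map (Q.mp φ) := by
  have e1 : isL (l.map (Q.mp φ)) (c.map (Q.mp φ)) = isL l c := by
    unfold isL; rw [drO_mp, drO_mp]
  have e2 : isC (c.map (Q.mp φ)) = isC c := by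
    unfold isC; rw [drO_mp]
  have e3 : isR (c.map (Q.mp φ)) (r.map (Q.mp φ)) = isR c r := by
    unfold isR; rw [drO_mp, drO_mp]
  have key : ∀ (o : Option (Q L' Unit)) (m : Q L' Unit → Option (V L'))
      (m2 : Q L Unit → Option (V L)) (_ : ∀ x, m2 (x.mp φ) = (m x).map (V.mp φ))
      (_ : ∀ q, q ∈ o → M.hlt (φ q.w.x.l) = M'.hlt q.w.x.l ∧
      M.hlt (φ q.s.w.x.l) = M'.hlt q.s.w.x.l),
      ((o.map (Q.mp φ)).bind fun x => step M (A0 L) x (m2 x)) =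
        (o.bind fun x => step M' (A0 L') x (m x)).map (Q.mp φ) := by
    intro o m m2 h1 h2
    cases o with
    | none => rfl
    | some q =>
      simp only [Option.map_some, Option.bind_some]
      rw [h1]
      exact step_mp H q _ (h2 q rfl).1 (h2 q rfl).2
  unfold rule
  change (match isL (l.map (Q.mp φ)) (c.map (Q.mp φ)), isC (c.map (Q.mp φ)),
    isR (c.map (Q.mp φ)) (r.map (Q.mp φ)) with
    | true, false, false => _ | false, true, false => _ | false, false, true => _
    | _, _, _ => _) = Option.map (Q.mp φ)
    (match isL (Γ := Unit) l c, isC (Γ := Unit) c, isR (Γ := Unit) c r with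
    | true, false, false => _ | false, true, false => _ | false, false, true => _
    | _, _, _ => _)
  rw [e1, e2, e3]
  cases isL l c <;> cases isC c <;> cases isR c r
  all_goals try rfl
  · exact key r (fun _ => none) (fun _ => none) (fun _ => rfl) hr
  · exact key c (fun x => msg l x r) (fun x => msg (l.map (Q.mp φ)) x (r.map (Q.mp φ)))
      (fun x => msg_mp l r x) hc
  · exact key l (fun _ => none) (fun _ => none) (fun _ => rfl) hl

end SimCA
end

section
namespace SimCA
open Encodable

abbrev T3 (n : ℕ) := Fin (n + 1) × Fin (n + 1) × Fin (n + 1)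

theorem encode_map {α : Type} [Encodable α] (l : List α) :
    encode l = encode (l.map fun x => (encode x : ℕ)) := by
  induction l with
  | nil => rfl
  | cons a l ih => rw [List.map_cons, encode_list_cons, encode_list_cons, ih]; rfl

theorem encode_finArrow {α : Type} [Encodable α] {n : ℕ} (v : Fin n → α) :
    @encode _ Encodable.finArrow v = encode (List.ofFn v) := by
  have h : @encode _ Encodable.finArrow v = encode (List.Vector.ofFn v) := rfl
  rw [h, ← List.Vector.toList_ofFn]
  rfl

theorem encode_finPi {α : Type} [Encodable α] {n : ℕ} (v : Fin n → α) :
    @encode _ (Encodable.finPi n fun _ => α) v =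
      encode (List.ofFn fun i : Fin n => Nat.pair i (encode (v i))) := by
  have h : @encode _ (Encodable.finPi n fun _ => α) v = @encode _ Encodable.finArrow
      (fun i => (⟨i, v i⟩ : Σ _ : Fin n, α)) := rfl
  rw [h, encode_finArrow, encode_map, List.map_ofFn]
  rfl

theorem encode_arrow {n : ℕ} (f : T3 n → Fin (n + 1)) :
    encode f = encode ((List.range (sortedUniv (T3 n)).length).map fun i =>
      Nat.pair i (((sortedUniv (T3 n)).map fun t => ((f t).1 : ℕ)).getD i 0)) := by
  change @encode _ (Encodable.finPi _ fun _ => Fin (n + 1))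
    (fun i => f (fintypeEquivFin.symm i)) = _
  rw [encode_finPi]
  congr 1
  apply List.ext_getElem
  · rw [List.length_ofFn, List.length_map, List.length_range, length_sortedUniv]
  · intro i h1 h2
    have h3 : i < (sortedUniv (T3 n)).length := by simpa using h2
    simp only [List.getElem_ofFn, List.getElem_map, List.getElem_range]
    rw [List.getD_eq_getElem _ _ (by simpa using h2), List.getElem_map]
    congr 1
    change (f _).1 = (f _).1
    congr 2
    simp only [fintypeEquivFin, Equiv.symm_trans_apply, Equiv.symm_symm]
    simp only [List.Nodup.getEquivOfForallMemList, Equiv.coe_fn_mk, List.get_eq_getElem]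
    congr 1
    have : ∀ (a b : ℕ) (h : a = b) (x : Fin a), (cast (congrArg Fin h) x).1 = x.1 := by
      intro a b h x; subst h; rfl
    exact this _ _ (length_sortedUniv (T3 n)).symm ⟨i, by rwa [length_sortedUniv] at h3⟩

theorem sorted_eq {l₁ l₂ : List ℕ} (h1 : l₁.Pairwise (· < ·)) (h2 : l₂.Pairwise (· < ·))
    (h : ∀ x, x ∈ l₁ ↔ x ∈ l₂) : l₁ = l₂ := by
  have p : l₁.Perm l₂ := (List.perm_ext_iff_of_nodup (h1.imp fun h => ne_of_lt h)
    (h2.imp fun h => ne_of_lt h)).2 h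
  exact p.eq_of_sortedLE (h1.imp fun h => le_of_lt h).sortedLE (h2.imp fun h => le_of_lt h).sortedLE

/-- codes of the triples -/
def trip (n : ℕ) : List ℕ :=
  (List.range (Nat.pair n (Nat.pair n n) + 1)).filter fun c =>
    decide (c.unpair.1 ≤ n ∧ c.unpair.2.unpair.1 ≤ n ∧ c.unpair.2.unpair.2 ≤ n)

theorem pair_mono {a b c d : ℕ} (h : a ≤ b) (h' : c ≤ d) : Nat.pair a c ≤ Nat.pair b d := by
  rcases h.lt_or_eq with h | rfl
  · rcases h'.lt_or_eq with h' | rfl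
    · exact ((Nat.pair_lt_pair_left _ h).trans (Nat.pair_lt_pair_right _ h')).le
    · exact (Nat.pair_lt_pair_left _ h).le
  · rcases h'.lt_or_eq with h' | rfl
    · exact (Nat.pair_lt_pair_right _ h').le
    · exact le_rfl

theorem sortedUniv_trip (n : ℕ) : (sortedUniv (T3 n)).map (fun t => (encode t : ℕ)) = trip n := by
  apply sorted_eq
  · rw [List.pairwise_map]
    have h1 := Finset.pairwise_sort (Finset.univ : Finset (T3 n)) (encode' (T3 n) ⁻¹'o (· ≤ ·))
    have h2 := sortedUniv_nodup (T3 n)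
    refine (h1.and h2).imp ?_
    rintro a b ⟨h3, h4⟩
    exact lt_of_le_of_ne h3 fun h => h4 (encode_injective h)
  · exact List.Pairwise.filter _ List.pairwise_lt_range
  · intro x
    simp only [List.mem_map, mem_sortedUniv, true_and, trip, List.mem_filter, List.mem_range,
      decide_eq_true_eq]
    constructor
    · rintro ⟨⟨a, b, c⟩, rfl⟩
      change Nat.pair a (Nat.pair b c) < _ ∧ (Nat.unpair (Nat.pair a (Nat.pair b c))).1 ≤ n ∧
        (Nat.unpair (Nat.unpair (Nat.pair a (Nat.pair b c))).2).1 ≤ n ∧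
        (Nat.unpair (Nat.unpair (Nat.pair a (Nat.pair b c))).2).2 ≤ n
      simp only [Nat.unpair_pair]
      have := a.2
      have := b.2
      have := c.2
      refine ⟨Nat.lt_succ_of_le (pair_mono (by omega) (pair_mono (by omega) (by omega))),
        by omega, by omega, by omega⟩
    · rintro ⟨-, h1, h2, h3⟩
      refine ⟨(⟨x.unpair.1, by omega⟩, ⟨x.unpair.2.unpair.1, by omega⟩,
        ⟨x.unpair.2.unpair.2, by omega⟩), ?_⟩
      change Nat.pair x.unpair.1 (Nat.pair x.unpair.2.unpair.1 x.unpair.2.unpair.2) = x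
      rw [Nat.pair_unpair, Nat.pair_unpair]

theorem encode_rule {n : ℕ} (f : T3 n → Fin (n + 1)) (v : ℕ → ℕ → ℕ → ℕ)
    (h : ∀ a b c, (f (a, b, c)).1 = v a b c) :
    encode (⟨n, f⟩ : Σ n : ℕ, (Fin (n + 1) × Fin (n + 1) × Fin (n + 1) → Fin (n + 1))) =
      Nat.pair n (encode ((List.range (trip n).length).map fun i => Nat.pair i
        (((trip n).map fun c =>
        v c.unpair.1 c.unpair.2.unpair.1 c.unpair.2.unpair.2).getD i 0))) := by
  change Nat.pair n (encode f) = _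
  rw [encode_arrow, ← sortedUniv_trip, List.map_map, List.length_map]
  have e : ∀ t : T3 n, (f t).1 = ((fun c : ℕ => v c.unpair.1 c.unpair.2.unpair.1
      c.unpair.2.unpair.2) ∘ fun t : T3 n => (encode t : ℕ)) t := by
    intro ⟨a, b, c⟩
    rw [h]
    change _ = v (Nat.unpair (Nat.pair a (Nat.pair b c))).1
        (Nat.unpair (Nat.unpair (Nat.pair a (Nat.pair b c))).2).1
        (Nat.unpair (Nat.unpair (Nat.pair a (Nat.pair b c))).2).2
    simp only [Nat.unpair_pair]
  have e' : (fun t : T3 n => (f t).1) = _ := funext e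
  rw [e']

theorem trip_primrec : Primrec trip := by
  have h1 : PrimrecRel fun (c n : ℕ) => c.unpair.1 ≤ n ∧ c.unpair.2.unpair.1 ≤ n ∧
      c.unpair.2.unpair.2 ≤ n := by
    have e1 : Primrec fun x : ℕ × ℕ => x.1.unpair.1 :=
      Primrec.fst.comp (Primrec.unpair.comp Primrec.fst)
    have e2 : Primrec fun x : ℕ × ℕ => x.1.unpair.2.unpair :=
      Primrec.unpair.comp (Primrec.snd.comp (Primrec.unpair.comp Primrec.fst))
    exact (Primrec.nat_le.comp e1 Primrec.snd).and
      ((Primrec.nat_le.comp (Primrec.fst.comp e2) Primrec.snd).and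
        (Primrec.nat_le.comp (Primrec.snd.comp e2) Primrec.snd))
  have h2 := h1.listFilter
  refine (h2.comp (Primrec.list_range.comp (Primrec.succ.comp
    (Primrec₂.natPair.comp Primrec.id (Primrec₂.natPair.comp Primrec.id Primrec.id))))
    Primrec.id).of_eq fun n => ?_
  rfl

theorem code_primrec {nb : ℕ → ℕ} (hn : Primrec nb) {v : ℕ → ℕ → ℕ → ℕ → ℕ}
    (hv : Primrec fun x : ℕ × ℕ × ℕ × ℕ => v x.1 x.2.1 x.2.2.1 x.2.2.2) :
    Primrec fun p => Nat.pair (nb p) (encode ((List.range (trip (nb p)).length).map fun i =>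
      Nat.pair i (((trip (nb p)).map fun c =>
        v p c.unpair.1 c.unpair.2.unpair.1 c.unpair.2.unpair.2).getD i 0))) := by
  have h0 : Primrec fun p => (trip (nb p)).map fun c =>
        v p c.unpair.1 c.unpair.2.unpair.1 c.unpair.2.unpair.2 := by
    refine Primrec.list_map (trip_primrec.comp hn) ?_
    have e1 : Primrec fun x : ℕ × ℕ => x.2.unpair.1 :=
      Primrec.fst.comp (Primrec.unpair.comp Primrec.snd)
    have e2 : Primrec fun x : ℕ × ℕ => x.2.unpair.2.unpair :=
      Primrec.unpair.comp (Primrec.snd.comp (Primrec.unpair.comp Primrec.snd))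
    exact hv.comp (Primrec.fst.pair (e1.pair e2))
  refine Primrec₂.natPair.comp hn (Primrec.encode.comp (Primrec.list_map
    (Primrec.list_range.comp (Primrec.list_length.comp (trip_primrec.comp hn))) ?_))
  exact Primrec₂.natPair.comp Primrec.snd
    ((Primrec.list_getD 0).comp (h0.comp Primrec.fst) Primrec.snd)

end SimCA
end

section
namespace SimCA
open Turing Encodable

/-! ### taking particles apart -/

def toLV {L : Type} (w : Wk L) : List L :=
  [w.x.l, w.o.l, w.mO.l, w.mP.l, w.rO.l, w.rP.l, w.qO.l, w.qP.l]

def toL {L : Type} (q : Q L Unit) : List L := toLV q.w ++ toLV q.s.w ++ [q.s.z]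

def bldV {L : Type} (v : V Unit) (l : L) : V L := ⟨v.pos, v.op, v.dr, v.f, l⟩

def bldW {L : Type} (w : Wk Unit) (i : ℕ) (e : ℕ → L) : Wk L :=
  ⟨bldV w.x (e i), bldV w.o (e (i + 1)), bldV w.mO (e (i + 2)), bldV w.mP (e (i + 3)),
    bldV w.rO (e (i + 4)), bldV w.rP (e (i + 5)), bldV w.qO (e (i + 6)), bldV w.qP (e (i + 7)),
    w.op, w.k, w.d⟩

def bld {L : Type} (s : Q Unit Unit) (e : ℕ → L) : Q L Unit :=
  ⟨s.pos, bldW s.w 0 e, ⟨s.s.pos, bldW s.s.w 8 e, e 16⟩, ()⟩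

def sk {L : Type} (q : Q L Unit) : Q Unit Unit := q.mp fun _ => ()

theorem bld_sk {L : Type} (q : Q L Unit) (d : L) : bld (sk q) (fun j => (toL q).getD j d) = q := rfl

theorem bld_mp {L L' : Type} (φ : L' → L) (s : Q Unit Unit) (e : ℕ → L') :
    (bld s e).mp φ = bld s (fun j => φ (e j)) := rfl

theorem toL_mp {L L' : Type} (φ : L' → L) (q : Q L' Unit) : toL (q.mp φ) = (toL q).map φ := rfl

theorem sk_mp {L L' : Type} (φ : L' → L) (q : Q L' Unit) : sk (q.mp φ) = sk q := rfl

theorem length_toL {L : Type} (q : Q L Unit) : (toL q).length = 17 := rfl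

instance finite_V {L : Type} [Finite L] : Finite (V L) :=
  Finite.of_injective (fun v : V L => (v.pos, v.op, v.dr, v.f, v.l)) (by
    rintro ⟨⟩ ⟨⟩ h; simp_all)

instance finite_Wk {L : Type} [Finite L] : Finite (Wk L) :=
  Finite.of_injective (fun v : Wk L => (v.x, v.o, v.mO, v.mP, v.rO, v.rP, v.qO, v.qP,
    v.op, v.k, v.d)) (by rintro ⟨⟩ ⟨⟩ h; simp_all)

instance finite_S {L : Type} [Finite L] : Finite (S L) :=
  Finite.of_injective (fun v : S L => (v.pos, v.w, v.z)) (by rintro ⟨⟩ ⟨⟩ h; simp_all)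

instance finite_Q {L Γ : Type} [Finite L] [Finite Γ] : Finite (Q L Γ) :=
  Finite.of_injective (fun v : Q L Γ => (v.pos, v.w, v.s, v.g)) (by
    rintro ⟨⟩ ⟨⟩ h; simp_all)

/-! ### terms -/

inductive Trm
  | var (i j : ℕ) (b : Bool)
  | b0
  | u0
  | d1 (x y : Trm)
  | d2 (x y : Trm)

def MT : Mealy Trm where
  d1 := .d1
  d2 := .d2
  b0 := .b0
  u0 := .u0
  hlt t := match t with
    | .var _ _ b => b
    | _ => false

/-! ### the input symbols -/

def ic (p c : ℕ) : Option (Option Bool) := ((none :: p.bits.reverse.map some) : List (Option Bool))[c]?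

def sym {Γ : Type} [Inhabited Γ] (g : Γ × Γ × Γ) : Option (Option Bool) → Γ
  | none => default
  | some none => g.1
  | some (some b) => if b then g.2.2 else g.2.1

theorem sym_ic {Γ : Type} [Inhabited Γ] (g : Γ × Γ × Γ) (p c : ℕ) :
    sym g (ic p c) = (inp g p).getI c := by
  have : inp g p = ((none :: p.bits.reverse.map some) : List (Option Bool)).map
      (fun o => sym g (some o)) := by
    simp only [inp, List.map_cons, List.map_map]
    rfl
  rw [this, List.getI_eq_getElem?_getD, List.getElem?_map]
  unfold ic
  cases ((none :: p.bits.reverse.map some) : List (Option Bool))[c]? <;> rfl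

theorem bits_primrec : Primrec Nat.bits := by
  have h : Primrec₂ fun (_ : Unit) (n : ℕ) => n.bits := by
    refine Primrec.nat_strong_rec _ (g := fun _ l => some (if l.length = 0 then [] else
      (decide (l.length % 2 = 1)) :: l.getD (l.length / 2) [])) ?_ ?_
    · have hl : Primrec fun x : Unit × List (List Bool) => x.2.length :=
        Primrec.list_length.comp Primrec.snd
      refine Primrec.option_some.comp (Primrec.ite (Primrec.eq.comp hl (Primrec.const 0))
        (Primrec.const []) (Primrec.list_cons.comp ?_ ?_))
      · exact (Primrec.eq.comp (Primrec.nat_mod.comp hl (Primrec.const 2))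
          (Primrec.const 1)).decide
      · exact (Primrec.list_getD []).comp Primrec.snd (Primrec.nat_div.comp hl (Primrec.const 2))
    · intro _ n
      rw [List.length_map, List.length_range]
      congr 1
      split_ifs with hn
      · subst hn; simp
      · rw [List.getD_eq_getElem _ _ (by simp; omega), List.getElem_map, List.getElem_range]
        rcases Nat.even_or_odd' n with ⟨k, rfl | rfl⟩
        · rw [Nat.bit0_bits k (by omega), Nat.mul_div_cancel_left k (by omega),
            Nat.mul_mod_right]
          rfl
        · rw [Nat.bit1_bits k, show (2 * k + 1) / 2 = k by omega,
            show (2 * k + 1) % 2 = 1 by omega]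
          rfl
  exact h.comp (Primrec.const ()) Primrec.id

theorem ic_primrec : Primrec₂ ic := by
  refine Primrec.list_getElem?.comp (Primrec.list_cons.comp (Primrec.const none)
    (Primrec.list_map (Primrec.list_reverse.comp (bits_primrec.comp Primrec.fst)) ?_)) Primrec.snd
  exact Primrec.option_some.comp Primrec.snd

/-- combining primitive recursive functions over a finite type -/
theorem primrec_finite {D α σ : Type} [Primcodable D] [Finite D] [Primcodable α] [Primcodable σ]
    [Inhabited σ] (f : D → α → σ) (h : ∀ d, Primrec (f d)) : Primrec₂ f := by
  classical
  have := Fintype.ofFinite D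
  have key : ∀ l : List D, Primrec₂ fun (d : D) (x : α) => if d ∈ l then f d x else default := by
    intro l
    induction l with
    | nil => exact (Primrec.const default).of_eq fun _ => by simp
    | cons a l ih =>
      have : Primrec fun y : D × α => if y.1 = a then f a y.2 else
          if y.1 ∈ l then f y.1 y.2 else default :=
        Primrec.ite (Primrec.eq.comp Primrec.fst (Primrec.const a))
          ((h a).comp Primrec.snd) ih
      refine this.of_eq fun y => ?_
      by_cases hy : y.1 = a
      · simp [hy]
      · simp [hy]
  refine (key Finset.univ.toList).of_eq fun y => ?_
  simp

/-! ### the letters -/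

section Let
variable {Γ Λ : Type} [Inhabited Γ] [Inhabited Λ] (N : TM0.Machine Γ Λ) (g : Γ × Γ × Γ) {KF : ℕ}
  (ε : Fx Γ Λ ≃ Fin KF)

abbrev Lt (KF : ℕ) := Fin KF × ℕ

def mm (p : ℕ) : ℕ := p + 1

def d1N (p : ℕ) (x y : Lt KF) : Lt KF :=
  (ε (F1 N (ε.symm x.1) (ε.symm y.1) (sym g (ic p y.2)) (sym g (ic p (y.2 + 1)))),
    min (y.2 + 1) (mm p))
def d2N (x y : Lt KF) : Lt KF := (ε (F2 N (ε.symm x.1) (ε.symm y.1)), x.2)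
def b0N : Lt KF := (ε none, 0)
def u0N : Lt KF := (ε (some none), 0)
def hltN (x : Lt KF) : Bool := Hf (ε.symm x.1)

abbrev Lp (KF p : ℕ) := {y : Lt KF // y.2 ≤ mm p}

def Mp (p : ℕ) : Mealy (Lp KF p) where
  d1 x y := ⟨d1N N g ε p x.1 y.1, min_le_right _ _⟩
  d2 x y := ⟨d2N N ε x.1 y.1, x.2⟩
  b0 := ⟨b0N ε, Nat.zero_le _⟩
  u0 := ⟨u0N ε, Nat.zero_le _⟩
  hlt x := hltN ε x.1

theorem Mp_spec (p : ℕ) : Spec N (Mp N g ε p) (fun x => ε.symm x.1.1) (fun x => x.1.2) (mm p)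
    fun c => (inp g p).getI c where
  fb := ε.symm_apply_apply _
  fu := ε.symm_apply_apply _
  cu := rfl
  f1 z v := by
    simp only [← sym_ic]
    exact ε.symm_apply_apply _
  c1 z v := rfl
  f2 z v := ε.symm_apply_apply _
  c2 z v := rfl
  h x := rfl

theorem inp_length (p : ℕ) : (inp g p).length ≤ mm p := by
  simp only [inp, List.length_cons, List.length_map, List.length_reverse, mm]
  have : p.bits.length = p.size := Nat.size_eq_bits_len p
  have h2 : p.size ≤ p := Nat.size_le.2 Nat.lt_two_pow_self
  omega

def clamp (p : ℕ) (y : Lt KF) : Lt KF := (y.1, min y.2 (mm p))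

def toLet (p : ℕ) (y : Lt KF) : Lp KF p := ⟨clamp p y, min_le_right _ _⟩

theorem toLet_val (p : ℕ) (x : Lp KF p) : toLet p x.1 = x := by
  apply Subtype.ext
  refine Prod.ext rfl ?_
  exact min_eq_left x.2

/-- evaluation of terms -/
def ev (p : ℕ) (env : ℕ → List (Lt KF)) : Trm → Lt KF
  | .var i j _ => clamp p ((env i).getD j (b0N ε))
  | .b0 => b0N ε
  | .u0 => u0N ε
  | .d1 x y => d1N N g ε p (ev p env x) (ev p env y)
  | .d2 x y => d2N N ε (ev p env x) (ev p env y)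

def phi (p : ℕ) (env : ℕ → List (Lt KF)) : Trm → Lp KF p
  | .var i j _ => toLet p ((env i).getD j (b0N ε))
  | .b0 => (Mp N g ε p).b0
  | .u0 => (Mp N g ε p).u0
  | .d1 x y => (Mp N g ε p).d1 (phi p env x) (phi p env y)
  | .d2 x y => (Mp N g ε p).d2 (phi p env x) (phi p env y)

theorem phi_val (p : ℕ) (env : ℕ → List (Lt KF)) (t : Trm) :
    (phi N g ε p env t).1 = ev N g ε p env t := by
  induction t with
  | var i j b => rfl
  | b0 => rfl
  | u0 => rfl
  | d1 x y hx hy => simp only [phi, ev, ← hx, ← hy]; rfl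
  | d2 x y hx hy => simp only [phi, ev, ← hx, ← hy]; rfl

theorem phi_hom (p : ℕ) (env : ℕ → List (Lt KF)) : LHom MT (Mp N g ε p) (phi N g ε p env) where
  b0 := rfl
  u0 := rfl
  d1 _ _ := rfl
  d2 _ _ := rfl

theorem d1N_primrec : Primrec fun x : ℕ × Lt KF × Lt KF => d1N N g ε x.1 x.2.1 x.2.2 := by
  have hF : Primrec fun y : Fin KF × Fin KF × Option (Option Bool) × Option (Option Bool) =>
      ε (F1 N (ε.symm y.1) (ε.symm y.2.1) (sym g y.2.2.1) (sym g y.2.2.2)) :=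
    Primrec.dom_finite _
  have hc : Primrec fun x : ℕ × Lt KF × Lt KF => x.2.2.2 :=
    Primrec.snd.comp (Primrec.snd.comp Primrec.snd)
  have h1 : Primrec fun x : ℕ × Lt KF × Lt KF => ic x.1 x.2.2.2 := ic_primrec.comp Primrec.fst hc
  have h2 : Primrec fun x : ℕ × Lt KF × Lt KF => ic x.1 (x.2.2.2 + 1) :=
    ic_primrec.comp Primrec.fst (Primrec.succ.comp hc)
  have h3 : Primrec fun x : ℕ × Lt KF × Lt KF => x.2.1.1 :=
    Primrec.fst.comp (Primrec.fst.comp Primrec.snd)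
  have h4 : Primrec fun x : ℕ × Lt KF × Lt KF => x.2.2.1 :=
    Primrec.fst.comp (Primrec.snd.comp Primrec.snd)
  exact (hF.comp (h3.pair (h4.pair (h1.pair h2)))).pair
    (Primrec.nat_min.comp (Primrec.succ.comp hc) (Primrec.succ.comp Primrec.fst))

theorem d2N_primrec : Primrec fun x : Lt KF × Lt KF => d2N N ε x.1 x.2 := by
  have hF : Primrec fun y : Fin KF × Fin KF => ε (F2 N (ε.symm y.1) (ε.symm y.2)) :=
    Primrec.dom_finite _
  exact (hF.comp ((Primrec.fst.comp Primrec.fst).pair (Primrec.fst.comp Primrec.snd))).pair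
    (Primrec.snd.comp Primrec.fst)

theorem hltN_primrec : Primrec (hltN ε) := by
  have hF : Primrec fun y : Fin KF => Hf (ε.symm y) := Primrec.dom_finite _
  exact hF.comp Primrec.fst

theorem clamp_primrec : Primrec₂ (clamp (KF := KF)) :=
  (Primrec.fst.comp Primrec.snd).pair
    (Primrec.nat_min.comp (Primrec.snd.comp Primrec.snd) (Primrec.succ.comp Primrec.fst))

/-- environments -/
def envOf {α : Type} (y : List α × List α × List α) (i : ℕ) : List α :=
  match i with
  | 0 => y.1
  | 1 => y.2.1
  | _ => y.2.2

theorem ev_primrec (t : Trm) :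
    Primrec fun x : ℕ × List (Lt KF) × List (Lt KF) × List (Lt KF) =>
      ev N g ε x.1 (envOf x.2) t := by
  induction t with
  | var i j b =>
    have h : Primrec fun x : ℕ × List (Lt KF) × List (Lt KF) × List (Lt KF) => envOf x.2 i := by
      match i with
      | 0 => exact Primrec.fst.comp Primrec.snd
      | 1 => exact Primrec.fst.comp (Primrec.snd.comp Primrec.snd)
      | _ + 2 => exact Primrec.snd.comp (Primrec.snd.comp Primrec.snd)
    exact clamp_primrec.comp Primrec.fst ((Primrec.list_getD (b0N ε)).comp h (Primrec.const j))
  | b0 => exact Primrec.const _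
  | u0 => exact Primrec.const _
  | d1 x y hx hy => exact (d1N_primrec N g ε).comp (Primrec.fst.pair (hx.pair hy))
  | d2 x y hx hy => exact (d2N_primrec N ε).comp (hx.pair hy)

theorem evs_primrec (ts : List Trm) :
    Primrec fun x : ℕ × List (Lt KF) × List (Lt KF) × List (Lt KF) =>
      ts.map (ev N g ε x.1 (envOf x.2)) := by
  induction ts with
  | nil => exact Primrec.const []
  | cons t ts ih => exact Primrec.list_cons.comp (ev_primrec N g ε t) ih

end Let

end SimCA
end

section
namespace SimCA
open Turing Encodable

/-! ### coding of states by numbers -/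

section Fin3
variable {Γ Λ : Type} [Inhabited Γ] [Inhabited Λ] (N : TM0.Machine Γ Λ) (g : Γ × Γ × Γ) {K KF : ℕ}
  (ε : Fx Γ Λ ≃ Fin KF) (κ : Q Unit Unit ≃ Fin K)

abbrev Cd (K KF : ℕ) := Option (Fin K × List (Lt KF))

def cd {p : ℕ} (x : Option (Q (Lp KF p) Unit)) : Cd K KF :=
  x.map fun q => (κ (sk q), (toL q).map Subtype.val)

def un (p : ℕ) (x : Cd K KF) : Option (Q (Lp KF p) Unit) :=
  x.map fun y => bld (κ.symm y.1) fun j => toLet p (y.2.getD j (b0N ε))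

theorem un_cd {p : ℕ} (x : Option (Q (Lp KF p) Unit)) : un ε κ p (cd κ x) = x := by
  cases x with
  | none => rfl
  | some q =>
    simp only [un, cd, Option.map_some, Equiv.symm_apply_apply]
    congr 1
    have h : (fun j => toLet p (((toL q).map Subtype.val).getD j (b0N ε))) =
        fun j => (toL q).getD j (toLet p (b0N ε)) := by
      funext j
      rw [List.getD_eq_getElem?_getD, List.getD_eq_getElem?_getD, List.getElem?_map]
      cases (toL q)[j]? with
      | none => rfl
      | some y => exact toLet_val p y
    rw [h]
    exact bld_sk q _

abbrev Dt (K : ℕ) := Option (Fin K × Bool × Bool)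

def dt (x : Cd K KF) : Dt K :=
  x.map fun y => (y.1, hltN ε (y.2.getD 0 (b0N ε)), hltN ε (y.2.getD 8 (b0N ε)))

def tmp (i : ℕ) (d : Dt K) : Option (Q Trm Unit) :=
  d.map fun y => bld (κ.symm y.1) fun j => .var i j (if j = 0 then y.2.1 else y.2.2)

def Rt (d : Dt K × Dt K × Dt K) : Option (Q Trm Unit) :=
  rule MT (A0 Trm) (tmp κ 0 d.1) (tmp κ 1 d.2.1) (tmp κ 2 d.2.2)

def ls (x : Cd K KF) : List (Lt KF) := (x.map Prod.snd).getD []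

theorem un_eq (p i : ℕ) (env : ℕ → List (Lt KF)) (x : Cd K KF) (h : env i = ls x) :
    un ε κ p x = (tmp κ i (dt ε x)).map (Q.mp (phi N g ε p env)) := by
  cases x with
  | none => rfl
  | some y =>
    have h' : env i = y.2 := h
    simp only [un, tmp, dt, Option.map_some, bld_mp, phi, h']

theorem hlt_eq (p i : ℕ) (env : ℕ → List (Lt KF)) (x : Cd K KF) (h : env i = ls x)
    (q : Q Trm Unit) (hq : q ∈ tmp κ i (dt ε x)) :
    (Mp N g ε p).hlt (phi N g ε p env q.w.x.l) = MT.hlt q.w.x.l ∧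
      (Mp N g ε p).hlt (phi N g ε p env q.s.w.x.l) = MT.hlt q.s.w.x.l := by
  cases x with
  | none => cases hq
  | some y =>
    have h' : env i = y.2 := h
    simp only [tmp, dt, Option.map_some, Option.mem_some_iff] at hq
    subst hq
    constructor
    · change hltN ε (clamp p ((env i).getD 0 (b0N ε))) = hltN ε (y.2.getD 0 (b0N ε))
      rw [h']; rfl
    · change hltN ε (clamp p ((env i).getD 8 (b0N ε))) = hltN ε (y.2.getD 8 (b0N ε))
      rw [h']; rfl

/-- the rule on codes -/
def RC (p : ℕ) (x y z : Cd K KF) : Cd K KF :=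
  (Rt κ (dt ε x, dt ε y, dt ε z)).map fun q =>
    (κ (sk q), (toL q).map (ev N g ε p (envOf (ls x, ls y, ls z))))

theorem RC_eq (p : ℕ) (x y z : Cd K KF) :
    cd κ (rule (Mp N g ε p) (A0 _) (un ε κ p x) (un ε κ p y) (un ε κ p z)) =
      RC N g ε κ p x y z := by
  rw [un_eq N g ε κ p 0 (envOf (ls x, ls y, ls z)) x rfl,
    un_eq N g ε κ p 1 (envOf (ls x, ls y, ls z)) y rfl,
    un_eq N g ε κ p 2 (envOf (ls x, ls y, ls z)) z rfl]
  have h := rule_mp (phi_hom N g ε p (envOf (ls x, ls y, ls z))) (tmp κ 0 (dt ε x))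
    (tmp κ 1 (dt ε y)) (tmp κ 2 (dt ε z)) (hlt_eq N g ε κ p 0 _ x rfl)
    (hlt_eq N g ε κ p 1 _ y rfl) (hlt_eq N g ε κ p 2 _ z rfl)
  refine (congrArg (cd κ) h).trans ?_
  refine (Option.map_map _ _ (Rt κ (dt ε x, dt ε y, dt ε z))).trans ?_
  unfold RC
  congr 1
  funext q
  simp only [Function.comp, sk_mp, toL_mp, List.map_map]
  congr 1
  apply List.map_congr_left
  intro t _
  exact phi_val N g ε p _ t

theorem ls_primrec : Primrec (ls (K := K) (KF := KF)) :=
  Primrec.option_getD.comp (Primrec.option_map Primrec.id (Primrec.snd.comp Primrec.snd))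
    (Primrec.const [])

theorem dt_primrec : Primrec (dt (K := K) ε) := by
  refine Primrec.option_map Primrec.id ?_
  have h : ∀ j, Primrec fun y : Cd K KF × (Fin K × List (Lt KF)) =>
      hltN ε (y.2.2.getD j (b0N ε)) := fun j => (hltN_primrec ε).comp
    ((Primrec.list_getD (b0N ε)).comp (Primrec.snd.comp Primrec.snd) (Primrec.const j))
  exact (Primrec.fst.comp Primrec.snd).pair ((h 0).pair (h 8))

theorem RC_primrec : Primrec fun x : ℕ × Cd K KF × Cd K KF × Cd K KF =>
    RC N g ε κ x.1 x.2.1 x.2.2.1 x.2.2.2 := by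
  have h : Primrec₂ fun (d : Dt K × Dt K × Dt K)
      (x : ℕ × List (Lt KF) × List (Lt KF) × List (Lt KF)) =>
      (((Rt κ d).map fun q => (κ (sk q), (toL q).map (ev N g ε x.1 (envOf x.2)))) : Cd K KF) := by
    apply primrec_finite
    intro d
    cases Rt κ d with
    | none => exact Primrec.const none
    | some q =>
      exact Primrec.option_some.comp ((Primrec.const (κ (sk q))).pair (evs_primrec N g ε (toL q)))
  have h1 : Primrec fun x : ℕ × Cd K KF × Cd K KF × Cd K KF => x.2.1 :=
    Primrec.fst.comp Primrec.snd
  have h2 : Primrec fun x : ℕ × Cd K KF × Cd K KF × Cd K KF => x.2.2.1 :=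
    Primrec.fst.comp (Primrec.snd.comp Primrec.snd)
  have h3 : Primrec fun x : ℕ × Cd K KF × Cd K KF × Cd K KF => x.2.2.2 :=
    Primrec.snd.comp (Primrec.snd.comp Primrec.snd)
  exact h.comp (((dt_primrec ε).comp h1).pair (((dt_primrec ε).comp h2).pair
    ((dt_primrec ε).comp h3))) (Primrec.fst.pair ((ls_primrec.comp h1).pair
    ((ls_primrec.comp h2).pair (ls_primrec.comp h3))))

def dc (a : ℕ) : Cd K KF := (decode a : Option (Cd K KF)).getD none

theorem dc_primrec : Primrec (dc (K := K) (KF := KF)) :=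
  Primrec.option_getD.comp Primrec.decode (Primrec.const none)

theorem dc_encode (x : Cd K KF) : dc (encode x) = x := by
  simp [dc, encodek]

/-- the rule on numbers -/
def vv (p a b c : ℕ) : ℕ :=
  encode (RC N g ε κ p (dc a) (dc b) (dc c))

theorem vv_primrec : Primrec fun x : ℕ × ℕ × ℕ × ℕ =>
    vv N g ε κ x.1 x.2.1 x.2.2.1 x.2.2.2 := by
  refine Primrec.encode.comp ((RC_primrec N g ε κ).comp (Primrec.fst.pair
    ((dc_primrec.comp ?_).pair ((dc_primrec.comp ?_).pair (dc_primrec.comp ?_)))))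
  · exact Primrec.fst.comp Primrec.snd
  · exact Primrec.fst.comp (Primrec.snd.comp Primrec.snd)
  · exact Primrec.snd.comp (Primrec.snd.comp Primrec.snd)

/-- bound for codes of lists -/
def lb (l : ℕ) : ℕ → ℕ
  | 0 => 0
  | k + 1 => Nat.pair l (lb l k) + 1

theorem lb_primrec (k : ℕ) : Primrec fun l => lb l k := by
  induction k with
  | zero => exact Primrec.const 0
  | succ k ih => exact Primrec.succ.comp (Primrec₂.natPair.comp Primrec.id ih)

theorem encode_le_lb {α : Type} [Encodable α] (l : ℕ) (s : List α) (h : ∀ x ∈ s, encode x ≤ l) :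
    encode s ≤ lb l s.length := by
  induction s with
  | nil => simp [lb]
  | cons a s ih =>
    rw [encode_list_cons, List.length_cons]
    refine Nat.succ_le_succ (pair_mono (h a (by simp)) (ih fun x hx => h x (by simp [hx])))

def NB (K KF p : ℕ) : ℕ := Nat.pair K (lb (Nat.pair KF (mm p)) 17) + 1

theorem NB_primrec (K KF : ℕ) : Primrec (NB K KF) :=
  Primrec.succ.comp (Primrec₂.natPair.comp (Primrec.const K)
    ((lb_primrec 17).comp (Primrec₂.natPair.comp (Primrec.const KF) Primrec.succ)))

theorem encode_cd_le {p : ℕ} (x : Option (Q (Lp KF p) Unit)) : encode (cd κ x) ≤ NB K KF p := by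
  cases x with
  | none => exact Nat.zero_le _
  | some q =>
    change Nat.pair (κ (sk q)).1 (encode ((toL q).map Subtype.val)) + 1 ≤ _
    refine Nat.succ_le_succ (pair_mono (κ (sk q)).2.le ?_)
    have := encode_le_lb (Nat.pair KF (mm p)) ((toL q).map Subtype.val) (by
      intro x hx
      obtain ⟨y, -, rfl⟩ := List.mem_map.1 hx
      exact pair_mono y.1.1.2.le y.2)
    rwa [List.length_map, length_toL] at this

def eS (p : ℕ) (a : Fin (NB K KF p + 1)) : Option (Q (Lp KF p) Unit) := un ε κ p (dc a.1)

def enS (p : ℕ) (x : Option (Q (Lp KF p) Unit)) : Fin (NB K KF p + 1) :=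
  ⟨encode (cd κ x), Nat.lt_succ_of_le (encode_cd_le κ x)⟩

def fS (p : ℕ) (t : T3 (NB K KF p)) : Fin (NB K KF p + 1) :=
  enS κ p (rule (Mp N g ε p) (A0 _) (eS ε κ p t.1) (eS ε κ p t.2.1) (eS ε κ p t.2.2))

theorem fS_cod (p : ℕ) : Cod (Mp N g ε p) (A0 _) (fS N g ε κ p) (eS ε κ p) (enS κ p) where
  ee x := by
    change un ε κ p (dc (encode (cd κ x))) = x
    rw [dc_encode]
    exact un_cd ε κ x
  en0 := rfl
  hf a b c := rfl

theorem fS_val (p : ℕ) (a b c : Fin (NB K KF p + 1)) :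
    (fS N g ε κ p (a, b, c)).1 = vv N g ε κ p a b c :=
  congrArg encode (RC_eq N g ε κ p (dc a.1) (dc b.1) (dc c.1))

theorem fS_primrec : Primrec fun p =>
    encode (⟨NB K KF p, fS N g ε κ p⟩ :
      Σ n : ℕ, (Fin (n + 1) × Fin (n + 1) × Fin (n + 1) → Fin (n + 1))) := by
  refine (code_primrec (NB_primrec K KF) (vv_primrec N g ε κ)).of_eq fun p => ?_
  exact (encode_rule (fS N g ε κ p) (vv N g ε κ p) (fS_val N g ε κ p)).symm

theorem fS_nil (p : ℕ) :
    (∃ k : ℕ, ∀ x : ℤ → Fin (NB K KF p + 1), (caOfRule (fS N g ε κ p))^[k] x = fun _ => 0) ↔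
      (StateTransition.eval (TM0.step N) (TM0.init (inp g p))).Dom := by
  rw [(fS_cod N g ε κ p).nil, ← (Mp_spec N g ε p).hlt_iff (inp_length g p)]
  exact nil_iff

end Fin3

theorem main : ¬ ∃ g : ℕ → Bool, Computable g ∧
      ∀ (n : ℕ) (f : Fin (n + 1) × Fin (n + 1) × Fin (n + 1) → Fin (n + 1)),
        f (0, 0, 0) = 0 →
        (∃! μ : Measure (ℤ → Fin (n + 1)), IsProbabilityMeasure μ ∧
          ∀ A : Set (ℤ → Fin (n + 1)), MeasurableSet A →
            μ (caOfRule f ⁻¹' A) = μ A) →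
        (∀ ε : ℝ, 0 < ε → ∃ k : ℕ, ∀ x : ℤ → Fin (n + 1),
          besicovitchDist ((caOfRule f)^[k] x) (fun _ => 0) < ε) →
        (g (Encodable.encode
            (⟨n, f⟩ : Σ n : ℕ, (Fin (n + 1) × Fin (n + 1) × Fin (n + 1) → Fin (n + 1))))
            = true ↔
          (∃ k : ℕ, ∀ x : ℤ → Fin (n + 1), (caOfRule f)^[k] x = fun _ => 0)) := by
  rintro ⟨G, hG, h⟩
  obtain ⟨Γ, Λ, i1, i2, i3, i4, N, g, hN⟩ := exists_TM
  obtain ⟨K, ⟨κ⟩⟩ := Finite.exists_equiv_fin (Q Unit Unit)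
  obtain ⟨KF, ⟨ε⟩⟩ := Finite.exists_equiv_fin (Fx Γ Λ)
  have key : ∀ p, G (encode (⟨NB K KF p, fS N g ε κ p⟩ :
      Σ n : ℕ, (Fin (n + 1) × Fin (n + 1) × Fin (n + 1) → Fin (n + 1)))) = true ↔
      ((Denumerable.ofNat Nat.Partrec.Code p).eval 0).Dom := by
    intro p
    have C := fS_cod N g ε κ p
    rw [h _ _ C.f0 C.UE C.AND, fS_nil, hN]
  apply ComputablePred.halting_problem 0
  rw [ComputablePred.computable_iff]
  refine ⟨fun c => G (encode (⟨NB K KF (encode c), fS N g ε κ (encode c)⟩ :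
      Σ n : ℕ, (Fin (n + 1) × Fin (n + 1) × Fin (n + 1) → Fin (n + 1)))),
    hG.comp ((fS_primrec N g ε κ).to_comp.comp Computable.encode), ?_⟩
  funext c
  refine propext ?_
  rw [key, Denumerable.ofNat_encode]

end SimCA
end

/-- Nilpotency is undecidable even within the class of uniquely ergodic
and asymptotically-nilpotent-in-density cellular automata: there is no total
computable function `g` from (the effective encoding of) codes `(n, f)` of radius-1
cellular automata to `Bool` such that for every code whose automaton is both uniquely
ergodic and AND, `g (n, f) = true` iff `Φ_{n,f}` is nilpotent. -/
theorem nilpotency_undecidable_within_uniquelyErgodic_AND :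
    ¬ ∃ g : ℕ → Bool, Computable g ∧
      ∀ (n : ℕ) (f : Fin (n + 1) × Fin (n + 1) × Fin (n + 1) → Fin (n + 1)),
        f (0, 0, 0) = 0 →
        (∃! μ : Measure (ℤ → Fin (n + 1)), IsProbabilityMeasure μ ∧
          ∀ A : Set (ℤ → Fin (n + 1)), MeasurableSet A →
            μ (caOfRule f ⁻¹' A) = μ A) →
        (∀ ε : ℝ, 0 < ε → ∃ k : ℕ, ∀ x : ℤ → Fin (n + 1),
          besicovitchDist ((caOfRule f)^[k] x) (fun _ => 0) < ε) →
        (g (Encodable.encode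
            (⟨n, f⟩ : Σ n : ℕ, (Fin (n + 1) × Fin (n + 1) × Fin (n + 1) → Fin (n + 1))))
            = true ↔
          (∃ k : ℕ, ∀ x : ℤ → Fin (n + 1), (caOfRule f)^[k] x = fun _ => 0)) := by
  exact SimCA.main
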